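/- Suppose φ : ℂ → ℝ is smooth, periodic and non-constant, that 0 < τ < max_E φ − min_E φ, and that ∇(Δφ)(z) ≠ 0 for every z with Δφ(z) = 0. Let ψ be the unique continuous periodic function with φ − τ ≤ ψ ≤ φ which is distributionally subharmonic on {ψ > φ − τ} and distributionally superharmonic on {ψ < φ} (the optimal weight), and let M₊(ψ) = {ψ = φ}. Then the counting function satisfies the Weyl law lim_{h→0⁺} 2πh·N(e^{−τ/h}, h) = ∫_{M₊(ψ)∩E} Δφ(z) L(dz); equivalently, the number N([0,e^{−τ/h}]) of singular values of h∂̄ on L²_φ(M) in [0,e^{−τ/h}] equals (1/(2πh))∫_{M₊(ψ)∩E} Δφ L(dz) + o(1)/h as h → 0⁺. -/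

import Mathlib

open MeasureTheory Real Complex

noncomputable section

/-- `f : ℂ → α` is 2π-periodic in both the real and the imaginary direction. -/
def PeriodicC {α : Type*} (f : ℂ → α) : Prop :=
  ∀ z : ℂ, f (z + (2 * Real.pi : ℝ)) = f z ∧ f (z + (2 * Real.pi : ℝ) * Complex.I) = f z

/-- The Cauchy–Riemann operator `∂̄ = (∂ₓ + i ∂_y)/2`. -/
noncomputable def dbar (u : ℂ → ℂ) (z : ℂ) : ℂ :=
  (fderiv ℝ u z 1 + Complex.I * fderiv ℝ u z Complex.I) / 2

/-- The Laplacian `Δ = ∂ₓ² + ∂_y²` of a real-valued function on `ℂ ≅ ℝ²`. -/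
noncomputable def lapC (f : ℂ → ℝ) (z : ℂ) : ℝ :=
  fderiv ℝ (fun w => fderiv ℝ f w 1) z 1 +
    fderiv ℝ (fun w => fderiv ℝ f w Complex.I) z Complex.I

/-- The fundamental domain `E = [0,2π) × [0,2π)`. -/
def Efd : Set ℂ :=
  {z : ℂ | z.re ∈ Set.Ico 0 (2 * Real.pi) ∧ z.im ∈ Set.Ico 0 (2 * Real.pi)}

/-- The squared weighted norm `‖u‖_{φ,h}² = ∫_E |u|² e^{-2φ/h}`. -/
noncomputable def wInt (φ : ℂ → ℝ) (h : ℝ) (u : ℂ → ℂ) : ℝ :=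
  ∫ z in Efd, ‖u z‖ ^ 2 * Real.exp (-2 * φ z / h)

/-- The counting function `N(t,h)`: the supremum of `dim V` over finite-dimensional
complex subspaces `V` of smooth periodic functions on which `‖h ∂̄ u‖_{φ,h} ≤ t ‖u‖_{φ,h}`. -/
noncomputable def countN (φ : ℂ → ℝ) (t h : ℝ) : ℕ :=
  sSup {n : ℕ | ∃ V : Submodule ℂ (ℂ → ℂ),
    Module.finrank ℂ V = n ∧
    (∀ u ∈ V, ContDiff ℝ (⊤ : ℕ∞) u ∧ PeriodicC u) ∧
    (∀ u ∈ V, wInt φ h (fun z => (h : ℂ) * dbar u z) ≤ t ^ 2 * wInt φ h u)}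

/-- `v` is distributionally subharmonic on the open set `U`. -/
def DSubhOn (v : ℂ → ℝ) (U : Set ℂ) : Prop :=
  ∀ χ : ℂ → ℝ, ContDiff ℝ (⊤ : ℕ∞) χ → HasCompactSupport χ → (∀ z, 0 ≤ χ z) →
    tsupport χ ⊆ U → 0 ≤ ∫ z : ℂ, v z * lapC χ z

/-- `v` is distributionally superharmonic on the open set `U`. -/
def DSuphOn (v : ℂ → ℝ) (U : Set ℂ) : Prop :=
  ∀ χ : ℂ → ℝ, ContDiff ℝ (⊤ : ℕ∞) χ → HasCompactSupport χ → (∀ z, 0 ≤ χ z) →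
    tsupport χ ⊆ U → (∫ z : ℂ, v z * lapC χ z) ≤ 0

open scoped Topology

/-! ### Periodic functions and the fundamental domain -/

namespace PeriodicC

variable {α β : Type*}

lemma comp {f : ℂ → α} (hf : PeriodicC f) (g : α → β) : PeriodicC (fun z => g (f z)) :=
  fun z => ⟨congrArg g (hf z).1, congrArg g (hf z).2⟩

lemma comp₂ {γ : Type*} {f : ℂ → α} {g : ℂ → β} (hf : PeriodicC f) (hg : PeriodicC g)
    (k : α → β → γ) : PeriodicC (fun z => k (f z) (g z)) :=
  fun z => ⟨congrArg₂ k (hf z).1 (hg z).1, congrArg₂ k (hf z).2 (hg z).2⟩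

lemma shift {f : ℂ → α} (hf : PeriodicC f) (x : ℂ) : PeriodicC (fun z => f (z + x)) := by
  intro z
  constructor
  · have := (hf (z + x)).1
    rwa [add_right_comm] at this
  · have := (hf (z + x)).2
    rwa [add_right_comm] at this

/-- Invariance under the whole lattice. -/
lemma add_lattice {f : ℂ → α} (hf : PeriodicC f) (m n : ℤ) (z : ℂ) :
    f (z + m * (2 * Real.pi : ℝ) + n * ((2 * Real.pi : ℝ) * Complex.I)) = f z := by
  have h1 : Function.Periodic f ((2 * Real.pi : ℝ) : ℂ) := fun z => (hf z).1
  have h2 : Function.Periodic f ((2 * Real.pi : ℝ) * Complex.I) := fun z => (hf z).2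
  rw [(h2.int_mul n) _, (h1.int_mul m) z]

end PeriodicC

lemma exists_add_lattice_mem_Efd (z : ℂ) : ∃ m n : ℤ,
    z + m * (2 * Real.pi : ℝ) + n * ((2 * Real.pi : ℝ) * Complex.I) ∈ Efd := by
  refine ⟨-toIcoDiv Real.two_pi_pos 0 z.re, -toIcoDiv Real.two_pi_pos 0 z.im, ?_⟩
  have h1 := toIcoMod_mem_Ico Real.two_pi_pos 0 z.re
  have h2 := toIcoMod_mem_Ico Real.two_pi_pos 0 z.im
  rw [toIcoMod, zero_add] at h1 h2
  constructor
  · simpa [sub_eq_add_neg] using h1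
  · simpa [sub_eq_add_neg] using h2

lemma Efd_subset_closedBall : Efd ⊆ Metric.closedBall 0 (4 * Real.pi) := by
  rintro z ⟨⟨h1, h2⟩, h3, h4⟩
  rw [mem_closedBall_zero_iff]
  refine (Complex.norm_le_abs_re_add_abs_im z).trans ?_
  rw [abs_of_nonneg h1, abs_of_nonneg h3]
  linarith

lemma volume_Efd_lt_top : volume Efd < ⊤ :=
  (measure_mono Efd_subset_closedBall).trans_lt (isCompact_closedBall _ _).measure_lt_top

lemma Continuous.integrableOn_Efd {F : Type*} [NormedAddCommGroup F] {f : ℂ → F}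
    (hf : Continuous f) : IntegrableOn f Efd :=
  (hf.continuousOn.integrableOn_compact (isCompact_closedBall 0 (4 * Real.pi))).mono_set
    Efd_subset_closedBall

/-- Integrals over the fundamental domain as iterated integrals. -/
lemma setIntegral_Efd_eq {F : Type*} [NormedAddCommGroup F] [NormedSpace ℝ F]
    {f : ℂ → F} (hf : Continuous f) :
    ∫ z in Efd, f z = ∫ x in (0 : ℝ)..(2 * Real.pi), ∫ y in (0 : ℝ)..(2 * Real.pi), f ⟨x, y⟩ := by
  have h1 := Complex.volume_preserving_equiv_real_prod.symm.setIntegral_preimage_emb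
    Complex.measurableEquivRealProd.symm.measurableEmbedding f Efd
  rw [← h1]
  have h2 : Complex.measurableEquivRealProd.symm ⁻¹' Efd =
    (Set.Ico 0 (2 * Real.pi) ×ˢ Set.Ico 0 (2 * Real.pi)) := by
    ext ⟨x, y⟩
    rfl
  have hc : Continuous fun p : ℝ × ℝ => f ⟨p.1, p.2⟩ :=
    hf.comp Complex.equivRealProdCLM.symm.continuous
  have hint : IntegrableOn (fun p : ℝ × ℝ => f ⟨p.1, p.2⟩)
      (Set.Ico 0 (2 * Real.pi) ×ˢ Set.Ico 0 (2 * Real.pi)) (volume.prod volume) :=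
    (hc.continuousOn.integrableOn_compact (isCompact_Icc.prod isCompact_Icc)).mono_set
      (Set.prod_mono Set.Ico_subset_Icc_self Set.Ico_subset_Icc_self)
  rw [h2, Measure.volume_eq_prod]
  rw [show (∫ x in Set.Ico 0 (2 * Real.pi) ×ˢ Set.Ico 0 (2 * Real.pi),
    f (Complex.measurableEquivRealProd.symm x) ∂volume.prod volume) =
    ∫ p in Set.Ico 0 (2 * Real.pi) ×ˢ Set.Ico 0 (2 * Real.pi), f ⟨p.1, p.2⟩ ∂volume.prod volume
    from rfl]
  rw [setIntegral_prod _ hint, intervalIntegral.integral_of_le Real.two_pi_pos.le,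
    integral_Ico_eq_integral_Ioc]
  congr 1
  ext x
  rw [intervalIntegral.integral_of_le Real.two_pi_pos.le, integral_Ico_eq_integral_Ioc]

/-- Translation invariance of the integral of a periodic function over a period. -/
lemma PeriodicC.setIntegral_shift {F : Type*} [NormedAddCommGroup F] [NormedSpace ℝ F]
    {f : ℂ → F} (hp : PeriodicC f) (hf : Continuous f) (w : ℂ) :
    ∫ z in Efd, f (z + w) = ∫ z in Efd, f z := by
  rw [setIntegral_Efd_eq hf, setIntegral_Efd_eq (f := fun z => f (z + w)) (by fun_prop)]
  have h1 : ∀ x : ℝ, (∫ y in (0 : ℝ)..(2 * Real.pi), f ((⟨x, y⟩ : ℂ) + w)) =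
      ∫ y in (0 : ℝ)..(2 * Real.pi), f ⟨x + w.re, y⟩ := by
    intro x
    have hper : Function.Periodic (fun y : ℝ => f ⟨x + w.re, y⟩) (2 * Real.pi) := by
      intro y
      have := (hp ⟨x + w.re, y⟩).2
      simp only
      rw [← this]
      congr 1
      apply Complex.ext <;> simp
    have h2 : (∫ y in (0 : ℝ)..(2 * Real.pi), f ((⟨x, y⟩ : ℂ) + w)) =
        ∫ y in (0 : ℝ)..(2 * Real.pi), (fun y : ℝ => f ⟨x + w.re, y⟩) (y + w.im) := by
      congr 1
    rw [h2, intervalIntegral.integral_comp_add_right (fun y : ℝ => f ⟨x + w.re, y⟩),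
      zero_add, add_comm (2 * Real.pi), hper.intervalIntegral_add_eq w.im 0, zero_add]
  simp_rw [h1]
  have hper : Function.Periodic
      (fun x : ℝ => ∫ y in (0 : ℝ)..(2 * Real.pi), f ⟨x, y⟩) (2 * Real.pi) := by
    intro x
    simp only
    congr 1
    ext y
    rw [← (hp ⟨x, y⟩).1]
    congr 1
    apply Complex.ext <;> simp
  rw [intervalIntegral.integral_comp_add_right
    (fun x : ℝ => ∫ y in (0 : ℝ)..(2 * Real.pi), f ⟨x, y⟩),
    zero_add, add_comm (2 * Real.pi), hper.intervalIntegral_add_eq w.re 0, zero_add]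

lemma PeriodicC.setIntegral_ball_le {f : ℂ → ℝ} (hp : PeriodicC f) (hf : Continuous f)
    (h0 : ∀ z, 0 ≤ f z) (z : ℂ) {r : ℝ} (hr : r ≤ Real.pi) :
    ∫ w in Metric.ball z r, f w ≤ ∫ w in Efd, f w := by
  set t : ℂ := z - ⟨Real.pi, Real.pi⟩ with ht
  have hsub : Metric.ball z r ⊆ (fun w => w - t) ⁻¹' Efd := by
    intro w hw
    rw [Metric.mem_ball, dist_eq_norm] at hw
    have h1 := (Complex.abs_re_le_norm (w - z)).trans_lt hw
    have h2 := (Complex.abs_im_le_norm (w - z)).trans_lt hw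
    rw [abs_lt] at h1 h2
    simp only [Complex.sub_re, Complex.sub_im] at h1 h2
    refine ⟨⟨?_, ?_⟩, ⟨?_, ?_⟩⟩ <;> simp [ht] <;> linarith [h1.1, h1.2, h2.1, h2.2]
  have h1 : ∫ w in (fun w => w - t) ⁻¹' Efd, f w = ∫ w in Efd, f w := by
    have := (measurePreserving_sub_right volume t).setIntegral_preimage_emb
      (measurableEmbedding_subRight t) (fun w => f (w + t)) Efd
    rw [← hp.setIntegral_shift hf t, ← this]
    simp
  rw [← h1]
  refine setIntegral_mono_set ?_ (Filter.Eventually.of_forall h0) hsub.eventuallyLE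
  have : IntegrableOn (fun w => f (w + t)) Efd :=
    (hf.comp (continuous_id.add continuous_const)).integrableOn_Efd
  have h2 := (measurePreserving_sub_right volume t).integrableOn_comp_preimage
    (measurableEmbedding_subRight t) (f := fun w => f (w + t)) (s := Efd)
  have h3 := h2.2 this
  simpa [Function.comp_def] using h3

lemma PeriodicC.exists_isMax {f : ℂ → ℝ} (hp : PeriodicC f) (hf : Continuous f) :
    ∃ z₀, ∀ z, f z ≤ f z₀ := by
  obtain ⟨z₀, -, h⟩ := (isCompact_closedBall (0 : ℂ) (4 * Real.pi)).exists_isMaxOn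
    ⟨0, by simp [Real.pi_pos.le]⟩ hf.continuousOn
  refine ⟨z₀, fun z => ?_⟩
  obtain ⟨m, n, hmn⟩ := exists_add_lattice_mem_Efd z
  rw [← hp.add_lattice m n z]
  exact h (Efd_subset_closedBall hmn)

lemma PeriodicC.exists_bound {F : Type*} [NormedAddCommGroup F] {f : ℂ → F} (hp : PeriodicC f)
    (hf : Continuous f) : ∃ C, 0 < C ∧ ∀ z, ‖f z‖ ≤ C := by
  obtain ⟨z₀, h⟩ := (hp.comp norm).exists_isMax hf.norm
  exact ⟨‖f z₀‖ + 1, by positivity, fun z => (h z).trans (by linarith)⟩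

lemma PeriodicC.uniformContinuous {F : Type*} [NormedAddCommGroup F] {f : ℂ → F}
    (hp : PeriodicC f) (hf : Continuous f) : UniformContinuous f := by
  rw [Metric.uniformContinuous_iff]
  intro ε hε
  have h := (isCompact_closedBall (0 : ℂ) (4 * Real.pi + 1)).uniformContinuousOn_of_continuous
    hf.continuousOn
  rw [Metric.uniformContinuousOn_iff] at h
  obtain ⟨δ, hδ, h⟩ := h ε hε
  refine ⟨min δ 1, by positivity, fun {a b} hab => ?_⟩
  obtain ⟨m, n, hmn⟩ := exists_add_lattice_mem_Efd a
  rw [← hp.add_lattice m n a, ← hp.add_lattice m n b]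
  have ha := Efd_subset_closedBall hmn
  set l : ℂ := m * (2 * Real.pi : ℝ) + n * ((2 * Real.pi : ℝ) * Complex.I) with hl
  rw [add_assoc] at ha ⊢
  rw [add_assoc]
  rw [← hl] at ha ⊢
  have hd : dist (a + l) (b + l) = dist a b := dist_add_right _ _ _
  refine h _ (Metric.closedBall_subset_closedBall (by linarith) ha) _ ?_ ?_
  · rw [Metric.mem_closedBall] at ha ⊢
    have := dist_triangle (b + l) (a + l) 0
    rw [dist_comm (b + l) (a + l), hd] at this
    have := hab.le.trans (min_le_right _ _)
    linarith
  · rw [hd]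
    exact hab.trans_le (min_le_left _ _)

lemma PeriodicC.fderiv {F : Type*} [NormedAddCommGroup F] [NormedSpace ℝ F] {f : ℂ → F}
    (hp : PeriodicC f) : PeriodicC (fderiv ℝ f) := by
  intro z
  constructor
  · rw [← fderiv_comp_add_right]
    congr 1
    ext w
    exact (hp w).1
  · rw [← fderiv_comp_add_right]
    congr 1
    ext w
    exact (hp w).2

lemma PeriodicC.lapC {f : ℂ → ℝ} (hp : PeriodicC f) : PeriodicC (lapC f) := by
  have h1 := (hp.fderiv.comp (fun L => L 1)).fderiv
  have h2 := (hp.fderiv.comp (fun L => L Complex.I)).fderiv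
  exact h1.comp₂ h2 fun L M => L 1 + M Complex.I

lemma PeriodicC.dbar {f : ℂ → ℂ} (hp : PeriodicC f) : PeriodicC (dbar f) :=
  hp.fderiv.comp fun L => (L 1 + Complex.I * L Complex.I) / 2

/-- The integral of a directional derivative of a periodic function over a period vanishes. -/
lemma PeriodicC.setIntegral_fderiv {f : ℂ → ℝ} (hp : PeriodicC f) (hf : ContDiff ℝ 1 f) (e : ℂ) :
    ∫ z in Efd, _root_.fderiv ℝ f z e = 0 := by
  have hfc := hf.continuous
  have hf'c : Continuous (_root_.fderiv ℝ f) := hf.continuous_fderiv (by simp)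
  obtain ⟨C, hC, hb⟩ := hp.fderiv.exists_bound hf'c
  have : IsFiniteMeasure (volume.restrict Efd) := ⟨by simpa using volume_Efd_lt_top⟩
  have key := hasDerivAt_integral_of_dominated_loc_of_deriv_le (μ := volume.restrict Efd)
    (F := fun (t : ℝ) z => f (z + t • e)) (F' := fun t z => _root_.fderiv ℝ f (z + t • e) e)
    (x₀ := 0) (s := Set.univ) (bound := fun _ => C * ‖e‖) Filter.univ_mem
    (Filter.Eventually.of_forall fun t =>
      (hfc.comp (continuous_id.add continuous_const)).aestronglyMeasurable)
    (hfc.comp (continuous_id.add continuous_const)).integrableOn_Efd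
    (by
      have : Continuous fun z => _root_.fderiv ℝ f (z + (0 : ℝ) • e) e := by fun_prop
      exact this.aestronglyMeasurable)
    (Filter.Eventually.of_forall fun z t _ =>
      (ContinuousLinearMap.le_opNorm _ _).trans (by gcongr; exact hb _))
    (integrable_const _)
    (Filter.Eventually.of_forall fun z t _ => by
      have h1 : HasDerivAt (fun t : ℝ => z + t • e) e t := by
        simpa using ((hasDerivAt_id t).smul_const e).const_add z
      exact ((hf.differentiable (by simp)) (z + t • e)).hasFDerivAt.comp_hasDerivAt t h1)
  have h2 := key.2
  have h3 : (fun t : ℝ => ∫ z in Efd, f (z + t • e)) = fun _ => ∫ z in Efd, f z := by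
    ext t
    exact hp.setIntegral_shift hfc _
  rw [h3] at h2
  have h4 := h2.unique (hasDerivAt_const _ _)
  simpa using h4

lemma ContDiff.fderiv_apply_const {F : Type*} [NormedAddCommGroup F] [NormedSpace ℝ F]
    {f : ℂ → F} (hf : ContDiff ℝ (⊤ : ℕ∞) f) (e : ℂ) :
    ContDiff ℝ (⊤ : ℕ∞) fun z => fderiv ℝ f z e :=
  (hf.fderiv_right (m := (⊤ : ℕ∞)) (by simp)).clm_apply contDiff_const

lemma ContDiff.lapC {f : ℂ → ℝ} (hf : ContDiff ℝ (⊤ : ℕ∞) f) : ContDiff ℝ (⊤ : ℕ∞) (lapC f) :=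
  ((hf.fderiv_apply_const 1).fderiv_apply_const 1).add
    ((hf.fderiv_apply_const Complex.I).fderiv_apply_const Complex.I)

lemma ContDiff.dbar {f : ℂ → ℂ} (hf : ContDiff ℝ (⊤ : ℕ∞) f) : ContDiff ℝ (⊤ : ℕ∞) (dbar f) :=
  ((hf.fderiv_apply_const 1).add
    (contDiff_const.mul (hf.fderiv_apply_const Complex.I))).div_const 2

lemma PeriodicC.setIntegral_lapC {f : ℂ → ℝ} (hp : PeriodicC f) (hf : ContDiff ℝ (⊤ : ℕ∞) f) :
    ∫ z in Efd, _root_.lapC f z = 0 := by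
  unfold _root_.lapC
  have h (e : ℂ) : ContDiff ℝ (⊤ : ℕ∞) fun z => _root_.fderiv ℝ f z e := hf.fderiv_apply_const e
  rw [integral_add ((h 1).fderiv_apply_const 1).continuous.integrableOn_Efd
    ((h Complex.I).fderiv_apply_const Complex.I).continuous.integrableOn_Efd,
    (hp.fderiv.comp (fun L => L 1)).setIntegral_fderiv ((h 1).of_le (by simp)),
    (hp.fderiv.comp (fun L => L Complex.I)).setIntegral_fderiv ((h _).of_le (by simp)), add_zero]

/-! ### Calculus with the Laplacian -/

section Laplacian

open InnerProductSpace Topology Laplacian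

lemma ContDiff.contDiffAt_two {F : Type*} [NormedAddCommGroup F] [NormedSpace ℝ F] {f : ℂ → F}
    (hf : ContDiff ℝ (⊤ : ℕ∞) f) {z : ℂ} : ContDiffAt ℝ 2 f z :=
  hf.contDiffAt.of_le (WithTop.coe_le_coe.2 (le_top : (2 : ℕ∞) ≤ ⊤))

lemma fderiv_fderiv_apply {F : Type*} [NormedAddCommGroup F] [NormedSpace ℝ F] {f : ℂ → F} {z : ℂ}
    (hf : ContDiffAt ℝ 2 f z) (e v : ℂ) :
    fderiv ℝ (fun w => fderiv ℝ f w e) z v = fderiv ℝ (fderiv ℝ f) z v e := by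
  have h : DifferentiableAt ℝ (fderiv ℝ f) z :=
    (hf.fderiv_right (m := 1) (by norm_num)).differentiableAt (by norm_num)
  rw [fderiv_clm_apply h (differentiableAt_const e)]
  simp

lemma lapC_eq_laplacian {f : ℂ → ℝ} {z : ℂ} (hf : ContDiffAt ℝ 2 f z) : lapC f z = Δ f z := by
  rw [laplacian_eq_iteratedFDeriv_complexPlane]
  simp only [iteratedFDeriv_two_apply, lapC]
  rw [fderiv_fderiv_apply hf, fderiv_fderiv_apply hf]
  simp

lemma lapC_congr {f g : ℂ → ℝ} {z : ℂ} (h : f =ᶠ[𝓝 z] g) : lapC f z = lapC g z := by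
  have h1 (e : ℂ) : (fun w => fderiv ℝ f w e) =ᶠ[𝓝 z] fun w => fderiv ℝ g w e := by
    filter_upwards [h.fderiv (𝕜 := ℝ)] with w hw
    rw [hw]
  simp only [lapC, (h1 1).fderiv_eq, (h1 Complex.I).fderiv_eq]

lemma lapC_add {f g : ℂ → ℝ} {z : ℂ} (hf : ContDiffAt ℝ 2 f z) (hg : ContDiffAt ℝ 2 g z) :
    lapC (fun w => f w + g w) z = lapC f z + lapC g z := by
  rw [lapC_eq_laplacian hf, lapC_eq_laplacian hg, lapC_eq_laplacian (hf.add hg)]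
  exact hf.laplacian_add hg

lemma lapC_sub {f g : ℂ → ℝ} {z : ℂ} (hf : ContDiffAt ℝ 2 f z) (hg : ContDiffAt ℝ 2 g z) :
    lapC (fun w => f w - g w) z = lapC f z - lapC g z := by
  rw [lapC_eq_laplacian hf, lapC_eq_laplacian hg, lapC_eq_laplacian (hf.sub hg)]
  exact hf.laplacian_sub hg

lemma lapC_const_mul {f : ℂ → ℝ} {z : ℂ} (c : ℝ) (hf : ContDiffAt ℝ 2 f z) :
    lapC (fun w => c * f w) z = c * lapC f z := by
  rw [lapC_eq_laplacian hf, lapC_eq_laplacian (contDiffAt_const.mul hf)]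
  exact laplacian_smul c hf

lemma lapC_const (c : ℝ) (z : ℂ) : lapC (fun _ => c) z = 0 := by
  simp [lapC]

lemma lapC_neg (f : ℂ → ℝ) (z : ℂ) : lapC (fun w => -f w) z = -lapC f z := by
  simp only [lapC, fderiv_fun_neg, neg_apply]
  ring

lemma lapC_comp_add (f : ℂ → ℝ) (a z : ℂ) : lapC (fun w => f (w + a)) z = lapC f (z + a) := by
  simp only [lapC, fderiv_comp_add_right]
  rw [fderiv_comp_add_right (f := fun w => fderiv ℝ f w 1),
    fderiv_comp_add_right (f := fun w => fderiv ℝ f w Complex.I)]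

lemma fderiv_const_sub_comp {F : Type*} [NormedAddCommGroup F] [NormedSpace ℝ F] (f : ℂ → F)
    (a z : ℂ) : fderiv ℝ (fun w => f (a - w)) z = -fderiv ℝ f (a - z) := by
  have h1 := (ContinuousLinearEquiv.neg ℝ (M := ℂ)).comp_right_fderiv
    (f := fun x => f (x + a)) (x := z)
  have h2 : (fun x => f (x + a)) ∘ (ContinuousLinearEquiv.neg ℝ (M := ℂ)) =
      fun w => f (a - w) := by
    ext w
    simp [neg_add_eq_sub]
  rw [h2] at h1
  rw [h1, fderiv_comp_add_right]
  ext v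
  simp [neg_add_eq_sub]

lemma lapC_comp_const_sub (f : ℂ → ℝ) (a z : ℂ) :
    lapC (fun w => f (a - w)) z = lapC f (a - z) := by
  simp only [lapC, fderiv_const_sub_comp]
  have h (e : ℂ) : fderiv ℝ (fun w => (-fderiv ℝ f (a - w)) e) z =
      -fderiv ℝ (fun w => -fderiv ℝ f w e) (a - z) :=
    fderiv_const_sub_comp (fun w => -fderiv ℝ f w e) a z
  rw [h, h]
  simp

lemma lapC_of_support {f : ℂ → ℝ} {z : ℂ} (h : z ∉ tsupport f) : lapC f z = 0 := by
  rw [lapC_congr (g := fun _ => (0 : ℝ)) (notMem_tsupport_iff_eventuallyEq.1 h), lapC_const]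

lemma tsupport_lapC_subset (f : ℂ → ℝ) : tsupport (lapC f) ⊆ tsupport f := by
  refine closure_minimal (fun z hz => ?_) (isClosed_tsupport f)
  by_contra h
  exact hz (lapC_of_support h)

lemma HasCompactSupport.lapC {f : ℂ → ℝ} (h : HasCompactSupport f) : HasCompactSupport (lapC f) :=
  h.mono' (subset_closure.trans (tsupport_lapC_subset f))

/-- At a local maximum the Laplacian is nonpositive. -/
lemma IsLocalMax.lapC_nonpos {G : ℂ → ℝ} {z : ℂ} (hG : ContDiffAt ℝ 2 G z)
    (hmax : IsLocalMax G z) : lapC G z ≤ 0 := by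
  have key (e : ℂ) : fderiv ℝ (fun w => fderiv ℝ G w e) z e ≤ 0 := by
    by_contra! hpos
    have hline : ∀ t : ℝ, HasDerivAt (fun t : ℝ => z + t • e) e t := fun t => by
      simpa using ((hasDerivAt_id t).smul_const e).const_add z
    have hcont : Filter.Tendsto (fun t : ℝ => z + t • e) (𝓝 0) (𝓝 z) := by
      have := (hline 0).continuousAt.tendsto
      simpa using this
    have hd : ∀ᶠ w in 𝓝 z, DifferentiableAt ℝ G w :=
      (hG.eventually (by simp)).mono fun w hw => hw.differentiableAt (by norm_num)
    have hs : deriv (fun t : ℝ => G (z + t • e)) =ᶠ[𝓝 0] fun t => fderiv ℝ G (z + t • e) e := by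
      filter_upwards [hcont.eventually hd] with t ht
      exact (ht.hasFDerivAt.comp_hasDerivAt t (hline t)).deriv
    have hd2 : DifferentiableAt ℝ (fun w => fderiv ℝ G w e) z :=
      ((hG.fderiv_right (m := 1) (by norm_num)).differentiableAt (by norm_num)).clm_apply
        (differentiableAt_const e)
    have hdd : deriv (deriv fun t : ℝ => G (z + t • e)) 0 =
        fderiv ℝ (fun w => fderiv ℝ G w e) z e := by
      rw [hs.deriv_eq]
      have h1 : HasFDerivAt (fun w => fderiv ℝ G w e) (fderiv ℝ (fun w => fderiv ℝ G w e) z)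
          (z + (0 : ℝ) • e) := by simpa using hd2.hasFDerivAt
      exact (h1.comp_hasDerivAt (0 : ℝ) (hline 0)).deriv
    have hm : IsLocalMax (fun t : ℝ => G (z + t • e)) 0 := by
      have := hcont.eventually hmax
      simpa [IsLocalMax, IsMaxFilter] using this
    have hc : ContinuousAt (fun t : ℝ => G (z + t • e)) 0 := by
      have h2 : ContinuousAt G (z + (0 : ℝ) • e) := by simpa using hG.continuousAt
      exact h2.comp (f := fun t : ℝ => z + t • e) (hline 0).continuousAt
    have hmin := isLocalMin_of_deriv_deriv_pos (hdd ▸ hpos) hm.deriv_eq_zero hc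
    have hconst : (fun t : ℝ => G (z + t • e)) =ᶠ[𝓝 0] fun _ => G (z + (0 : ℝ) • e) := by
      filter_upwards [hm, hmin] with t h1 h2
      exact le_antisymm h1 h2
    have : deriv (deriv fun t : ℝ => G (z + t • e)) 0 = 0 := by
      rw [hconst.deriv.deriv_eq]
      simp
    rw [hdd] at this
    exact hpos.ne' this
  exact add_nonpos (key 1) (key Complex.I)

lemma integral_mul_fderiv_comm {f g : ℂ → ℝ} (hf : ContDiff ℝ 1 f) (hg : ContDiff ℝ 1 g)
    (hs : HasCompactSupport g) (e : ℂ) :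
    ∫ z, f z * fderiv ℝ g z e = -∫ z, fderiv ℝ f z e * g z := by
  have hf' : Continuous fun z => fderiv ℝ f z e := (hf.continuous_fderiv (by simp)).clm_apply
    continuous_const
  have hg' : Continuous fun z => fderiv ℝ g z e := (hg.continuous_fderiv (by simp)).clm_apply
    continuous_const
  apply integral_mul_fderiv_eq_neg_fderiv_mul_of_integrable
  · exact (hf'.mul hg.continuous).integrable_of_hasCompactSupport hs.mul_left
  · exact (hf.continuous.mul hg').integrable_of_hasCompactSupport
      ((hs.fderiv_apply (𝕜 := ℝ) e).mul_left)
  · exact (hf.continuous.mul hg.continuous).integrable_of_hasCompactSupport hs.mul_left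
  · exact fun x _ => hf.differentiable (by simp) x
  · exact fun x _ => hg.differentiable (by simp) x

/-- Green's identity against a compactly supported function. -/
lemma integral_mul_lapC {f χ : ℂ → ℝ} (hf : ContDiff ℝ (⊤ : ℕ∞) f)
    (hχ : ContDiff ℝ (⊤ : ℕ∞) χ) (hs : HasCompactSupport χ) :
    ∫ z, f z * lapC χ z = ∫ z, lapC f z * χ z := by
  have key (e : ℂ) : ∫ z, f z * fderiv ℝ (fun w => fderiv ℝ χ w e) z e =
      ∫ z, fderiv ℝ (fun w => fderiv ℝ f w e) z e * χ z := by
    rw [integral_mul_fderiv_comm (hf.of_le (by simp)) ((hχ.fderiv_apply_const e).of_le (by simp))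
      (hs.fderiv_apply (𝕜 := ℝ) e), integral_mul_fderiv_comm
      ((hf.fderiv_apply_const e).of_le (by simp)) (hχ.of_le (by simp)) hs, neg_neg]
  have i1 (e : ℂ) : Integrable fun z => f z * fderiv ℝ (fun w => fderiv ℝ χ w e) z e :=
    (hf.continuous.mul ((hχ.fderiv_apply_const e).fderiv_apply_const e).continuous
      ).integrable_of_hasCompactSupport
      (((hs.fderiv_apply (𝕜 := ℝ) e).fderiv_apply (𝕜 := ℝ) e).mul_left)
  have i2 (e : ℂ) : Integrable fun z => fderiv ℝ (fun w => fderiv ℝ f w e) z e * χ z :=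
    (((hf.fderiv_apply_const e).fderiv_apply_const e).continuous.mul
      hχ.continuous).integrable_of_hasCompactSupport hs.mul_left
  simp only [lapC, mul_add, add_mul]
  rw [integral_add (i1 1) (i1 Complex.I), integral_add (i2 1) (i2 Complex.I), key, key]

lemma contDiff_normSq : ContDiff ℝ (⊤ : ℕ∞) Complex.normSq := by
  have : (Complex.normSq : ℂ → ℝ) = fun z => z.re * z.re + z.im * z.im := by
    ext z; exact Complex.normSq_apply z
  rw [this]
  exact (Complex.reCLM.contDiff.mul Complex.reCLM.contDiff).add
    (Complex.imCLM.contDiff.mul Complex.imCLM.contDiff)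

lemma hasFDerivAt_normSq (z : ℂ) : HasFDerivAt (Complex.normSq : ℂ → ℝ)
    ((2 * z.re) • Complex.reCLM + (2 * z.im) • Complex.imCLM) z := by
  have h : (Complex.normSq : ℂ → ℝ) = fun z => z.re * z.re + z.im * z.im := by
    ext z; exact Complex.normSq_apply z
  rw [h]
  have h1 := (Complex.reCLM.hasFDerivAt (x := z)).mul (Complex.reCLM.hasFDerivAt (x := z))
  have h2 := (Complex.imCLM.hasFDerivAt (x := z)).mul (Complex.imCLM.hasFDerivAt (x := z))
  refine (h1.add h2).congr_fderiv ?_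
  ext <;> (simp; ring)

/-- The Laplacian of a composition `P ∘ c`. -/
lemma lapC_comp {P P' : ℝ → ℝ} {P'' : ℝ} {c : ℂ → ℝ} {z : ℂ} (hc : ContDiffAt ℝ 2 c z)
    (hP : ∀ᶠ s in 𝓝 (c z), HasDerivAt P (P' s) s) (hP' : HasDerivAt P' P'' (c z)) :
    lapC (fun w => P (c w)) z = P' (c z) * lapC c z +
      P'' * ((fderiv ℝ c z 1) ^ 2 + (fderiv ℝ c z Complex.I) ^ 2) := by
  have hd : ∀ᶠ w in 𝓝 z, DifferentiableAt ℝ c w :=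
    (hc.eventually (by simp)).mono fun w hw => hw.differentiableAt (by norm_num)
  have hd2 (e : ℂ) : DifferentiableAt ℝ (fun w => fderiv ℝ c w e) z :=
    ((hc.fderiv_right (m := 1) (by norm_num)).differentiableAt (by norm_num)).clm_apply
      (differentiableAt_const e)
  have key (e : ℂ) : fderiv ℝ (fun w => fderiv ℝ (fun w => P (c w)) w e) z e =
      P' (c z) * fderiv ℝ (fun w => fderiv ℝ c w e) z e + P'' * (fderiv ℝ c z e) ^ 2 := by
    have h1 : (fun w => fderiv ℝ (fun w => P (c w)) w e) =ᶠ[𝓝 z]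
        fun w => P' (c w) * fderiv ℝ c w e := by
      filter_upwards [hd, hc.continuousAt.eventually hP] with w hw hPw
      have := hPw.comp_hasFDerivAt w hw.hasFDerivAt
      rw [show (fun w => P (c w)) = P ∘ c from rfl, this.fderiv]
      simp
    rw [h1.fderiv_eq]
    have h2 := hP'.comp_hasFDerivAt z hd.self_of_nhds.hasFDerivAt
    have h3 := h2.mul (hd2 e).hasFDerivAt
    rw [show (fun w => P' (c w) * fderiv ℝ c w e) =
      ((P' ∘ c) * fun w => fderiv ℝ c w e) from rfl, h3.fderiv]
    simp
    ring
  simp only [lapC]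
  rw [key, key]
  ring

lemma lapC_normSq (z : ℂ) : lapC Complex.normSq z = 4 := by
  have h (e : ℂ) : (fun w => fderiv ℝ (Complex.normSq : ℂ → ℝ) w e) =
      ((2 * e.re) • Complex.reCLM + (2 * e.im) • Complex.imCLM : ℂ →L[ℝ] ℝ) := by
    ext w
    rw [(hasFDerivAt_normSq w).fderiv]
    simp
    ring
  simp only [lapC, h, ContinuousLinearMap.fderiv]
  simp
  norm_num

lemma lapC_radial {P P' : ℝ → ℝ} {P'' : ℝ} {z : ℂ}
    (hP : ∀ s, HasDerivAt P (P' s) s) (hP' : HasDerivAt P' P'' (Complex.normSq z)) :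
    lapC (fun w => P (Complex.normSq w)) z =
      4 * (P' (Complex.normSq z) + Complex.normSq z * P'') := by
  rw [lapC_comp contDiff_normSq.contDiffAt_two
    (Filter.Eventually.of_forall hP) hP', lapC_normSq, (hasFDerivAt_normSq z).fderiv]
  simp only [Complex.normSq_apply]
  simp
  ring

end Laplacian

/-! ### A radial mollifier built from a smoothed logarithm -/

section Kernel

open Topology

/-- A smooth monotone function equal to `s` for `s ≤ 1/2` and to `1` for `1 ≤ s`. -/
def kerT (s : ℝ) : ℝ := 1 - (1 - s) * Real.smoothTransition (2 * (1 - s))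

lemma contDiff_kerT : ContDiff ℝ (⊤ : ℕ∞) kerT :=
  contDiff_const.sub ((contDiff_const.sub contDiff_id).mul
    (Real.smoothTransition.contDiff.comp (contDiff_const.mul (contDiff_const.sub contDiff_id))))

lemma kerT_of_le {s : ℝ} (h : s ≤ 1 / 2) : kerT s = s := by
  rw [kerT, Real.smoothTransition.one_of_one_le (by linarith)]
  ring

lemma kerT_of_one_le {s : ℝ} (h : 1 ≤ s) : kerT s = 1 := by
  rw [kerT, Real.smoothTransition.zero_of_nonpos (by linarith)]
  ring

lemma kerT_le_one (s : ℝ) : kerT s ≤ 1 := by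
  rcases le_total s 1 with h | h
  · have := mul_nonneg (sub_nonneg.2 h) (Real.smoothTransition.nonneg (2 * (1 - s)))
    rw [kerT]
    linarith
  · exact (kerT_of_one_le h).le

lemma monotone_kerT : Monotone kerT := by
  intro s t hst
  rcases le_total 1 t with h | h
  · rw [kerT_of_one_le h]
    exact kerT_le_one s
  · have h1 : Real.smoothTransition (2 * (1 - t)) ≤ Real.smoothTransition (2 * (1 - s)) :=
      Real.smoothTransition.monotone (by linarith)
    have := mul_le_mul (by linarith : 1 - t ≤ 1 - s) h1 (Real.smoothTransition.nonneg _)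
      (by linarith)
    simp only [kerT]
    linarith

lemma deriv_kerT_nonneg (s : ℝ) : 0 ≤ deriv kerT s := monotone_kerT.deriv_nonneg

lemma deriv_kerT_of_lt {s : ℝ} (h : s < 1 / 2) : deriv kerT s = 1 := by
  have : kerT =ᶠ[𝓝 s] id := by
    filter_upwards [eventually_lt_nhds h] with t ht
    exact kerT_of_le ht.le
  rw [this.deriv_eq]
  simp

lemma deriv_kerT_of_le {s : ℝ} (h : 1 ≤ s) : deriv kerT s = 0 := by
  have hmax : IsLocalMax kerT s := Filter.Eventually.of_forall fun t => by
    rw [kerT_of_one_le h]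
    exact kerT_le_one t
  exact hmax.deriv_eq_zero

lemma contDiff_deriv_kerT : ContDiff ℝ (⊤ : ℕ∞) (deriv kerT) :=
  (contDiff_infty_iff_deriv.1 contDiff_kerT).2

/-- `kerT s / s`, extended smoothly through `s = 0`. -/
def kerQ (s : ℝ) : ℝ := if s ≤ 1 / 2 then 1 else kerT s / s

lemma kerQ_of_pos {s : ℝ} (h : 0 < s) : kerQ s = kerT s / s := by
  rw [kerQ]
  split_ifs with h1
  · rw [kerT_of_le h1, div_self h.ne']
  · rfl

lemma mul_kerQ (s : ℝ) : s * kerQ s = kerT s := by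
  rw [kerQ]
  split_ifs with h
  · rw [kerT_of_le h, mul_one]
  · rw [mul_div_cancel₀]
    intro h0
    rw [h0] at h
    norm_num at h

lemma contDiff_kerQ : ContDiff ℝ (⊤ : ℕ∞) kerQ := by
  rw [contDiff_iff_contDiffAt]
  intro s
  rcases lt_or_ge s (1 / 2) with h | h
  · have : kerQ =ᶠ[𝓝 s] fun _ => 1 := by
      filter_upwards [eventually_lt_nhds h] with t ht
      rw [kerQ, if_pos ht.le]
    exact contDiffAt_const.congr_of_eventuallyEq this
  · have h0 : 0 < s := by linarith
    have : kerQ =ᶠ[𝓝 s] fun t => kerT t / t := by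
      filter_upwards [eventually_gt_nhds h0] with t ht
      exact kerQ_of_pos ht
    exact (contDiff_kerT.contDiffAt.div contDiffAt_id h0.ne').congr_of_eventuallyEq this

/-- A smoothed logarithm: `kerP s = log s` for `1 ≤ s`. -/
def kerP (s : ℝ) : ℝ := ∫ x in (1 : ℝ)..s, kerQ x

lemma hasDerivAt_kerP (s : ℝ) : HasDerivAt kerP (kerQ s) s :=
  intervalIntegral.integral_hasDerivAt_right
    (contDiff_kerQ.continuous.intervalIntegrable _ _)
    (contDiff_kerQ.continuous.stronglyMeasurableAtFilter _ _) contDiff_kerQ.continuous.continuousAt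

lemma contDiff_kerP : ContDiff ℝ (⊤ : ℕ∞) kerP := by
  refine contDiff_infty_iff_deriv.2 ⟨fun s => (hasDerivAt_kerP s).differentiableAt, ?_⟩
  rw [show deriv kerP = kerQ from funext fun s => (hasDerivAt_kerP s).deriv]
  exact contDiff_kerQ

lemma kerP_of_one_le {s : ℝ} (h : 1 ≤ s) : kerP s = Real.log s := by
  have h1 : ∫ x in (1 : ℝ)..s, kerQ x = ∫ x in (1 : ℝ)..s, x⁻¹ := by
    refine intervalIntegral.integral_congr fun x hx => ?_
    rw [Set.uIcc_of_le h] at hx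
    rw [kerQ_of_pos (by linarith [hx.1]), kerT_of_one_le hx.1, one_div]
  rw [kerP, h1, integral_inv_of_pos one_pos (by linarith), div_one]

/-- The smoothed fundamental solution at scale `r`. -/
def logKer (r : ℝ) (y : ℂ) : ℝ := kerP (Complex.normSq y / r ^ 2) + 2 * Real.log r

/-- The Laplacian of `logKer`. -/
def rhoKer (r : ℝ) (y : ℂ) : ℝ := 4 / r ^ 2 * deriv kerT (Complex.normSq y / r ^ 2)

lemma contDiff_logKer (r : ℝ) : ContDiff ℝ (⊤ : ℕ∞) (logKer r) :=
  (contDiff_kerP.comp (contDiff_normSq.div_const _)).add contDiff_const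

lemma contDiff_rhoKer (r : ℝ) : ContDiff ℝ (⊤ : ℕ∞) (rhoKer r) :=
  contDiff_const.mul (contDiff_deriv_kerT.comp (contDiff_normSq.div_const _))

lemma lapC_logKer (r : ℝ) (y : ℂ) : lapC (logKer r) y = rhoKer r y := by
  have h1 : ∀ s, HasDerivAt (fun s => kerP (s / r ^ 2) + 2 * Real.log r)
      (kerQ (s / r ^ 2) * (1 / r ^ 2)) s := fun s => by
    exact ((hasDerivAt_kerP (s / r ^ 2)).comp s
      ((hasDerivAt_id s).div_const (r ^ 2))).add_const (2 * Real.log r)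
  have hQ (s : ℝ) : HasDerivAt kerQ (deriv kerQ s) s :=
    (contDiff_kerQ.differentiable (by simp) s).hasDerivAt
  have h2 : HasDerivAt (fun s => kerQ (s / r ^ 2) * (1 / r ^ 2))
      (deriv kerQ (Complex.normSq y / r ^ 2) * (1 / r ^ 2) * (1 / r ^ 2)) (Complex.normSq y) := by
    exact ((hQ (Complex.normSq y / r ^ 2)).comp (Complex.normSq y)
      ((hasDerivAt_id _).div_const (r ^ 2))).mul_const (1 / r ^ 2)
  have h3 := lapC_radial (P := fun s => kerP (s / r ^ 2) + 2 * Real.log r) h1 h2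
  have h4 (s : ℝ) : deriv kerT s = kerQ s + s * deriv kerQ s := by
    have h5 : HasDerivAt (fun s => s * kerQ s) (1 * kerQ s + s * deriv kerQ s) s :=
      (hasDerivAt_id s).mul (hQ s)
    simp only [mul_kerQ] at h5
    rw [h5.deriv, one_mul]
  rw [show logKer r = fun w => (fun s => kerP (s / r ^ 2) + 2 * Real.log r) (Complex.normSq w)
    from rfl, h3, rhoKer, h4]
  ring

lemma rhoKer_nonneg (r : ℝ) (y : ℂ) : 0 ≤ rhoKer r y :=
  mul_nonneg (by positivity) (deriv_kerT_nonneg _)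

lemma one_le_normSq_div {r : ℝ} (hr : 0 < r) {y : ℂ} (hy : r ≤ ‖y‖) :
    1 ≤ Complex.normSq y / r ^ 2 := by
  rw [one_le_div (by positivity), Complex.normSq_eq_norm_sq]
  gcongr

lemma rhoKer_of_le {r : ℝ} (hr : 0 < r) {y : ℂ} (hy : r ≤ ‖y‖) : rhoKer r y = 0 := by
  rw [rhoKer, deriv_kerT_of_le (one_le_normSq_div hr hy), mul_zero]

lemma logKer_of_le {r : ℝ} (hr : 0 < r) {y : ℂ} (hy : r ≤ ‖y‖) :
    logKer r y = 2 * Real.log ‖y‖ := by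
  have hy0 : 0 < ‖y‖ := hr.trans_le hy
  rw [logKer, kerP_of_one_le (one_le_normSq_div hr hy), Complex.normSq_eq_norm_sq,
    Real.log_div (by positivity) (by positivity), Real.log_pow, Real.log_pow]
  push_cast
  ring

lemma tsupport_subset_closedBall {g : ℂ → ℝ} {r : ℝ} (h : ∀ y, r ≤ ‖y‖ → g y = 0) :
    tsupport g ⊆ Metric.closedBall 0 r := by
  refine closure_minimal (fun y hy => ?_) Metric.isClosed_closedBall
  rw [mem_closedBall_zero_iff]
  by_contra! h'
  exact hy (h y h'.le)

lemma hasCompactSupport_of_norm {g : ℂ → ℝ} {r : ℝ} (h : ∀ y, r ≤ ‖y‖ → g y = 0) :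
    HasCompactSupport g :=
  (isCompact_closedBall (0 : ℂ) r).of_isClosed_subset (isClosed_tsupport g)
    (tsupport_subset_closedBall h)

lemma hasCompactSupport_rhoKer {r : ℝ} (hr : 0 < r) : HasCompactSupport (rhoKer r) :=
  hasCompactSupport_of_norm fun _ hy => rhoKer_of_le hr hy

lemma logKer_mono {a b : ℝ} (ha : 0 < a) (hab : a ≤ b) (y : ℂ) : logKer a y ≤ logKer b y := by
  have hd : ∀ r ∈ Set.Ioi (0 : ℝ), HasDerivAt (fun r => logKer r y)
      (2 / r * (1 - kerT (Complex.normSq y / r ^ 2))) r := by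
    intro r hr
    have hr0 : r ≠ 0 := (Set.mem_Ioi.1 hr).ne'
    have h1 : HasDerivAt (fun r : ℝ => Complex.normSq y / r ^ 2)
        (-2 * Complex.normSq y / r ^ 3) r := by
      have := (hasDerivAt_const r (Complex.normSq y)).div (hasDerivAt_pow 2 r) (by positivity)
      refine this.congr_deriv ?_
      field_simp
      ring
    have h2 := ((hasDerivAt_kerP (Complex.normSq y / r ^ 2)).comp r h1).add
      ((Real.hasDerivAt_log hr0).const_mul 2)
    refine h2.congr_deriv ?_
    rw [← mul_kerQ]
    field_simp
    ring
  refine monotoneOn_of_deriv_nonneg (convex_Ioi (0 : ℝ))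
    (fun r hr => (hd r hr).continuousAt.continuousWithinAt)
    (fun r hr => ?_) (fun r hr => ?_) (Set.mem_Ioi.2 ha) (Set.mem_Ioi.2 (ha.trans_le hab)) hab
  · rw [interior_Ioi] at hr
    exact (hd r hr).differentiableAt.differentiableWithinAt
  · rw [interior_Ioi] at hr
    rw [(hd r hr).deriv]
    have := kerT_le_one (Complex.normSq y / r ^ 2)
    have hr' : 0 < r := hr
    exact mul_nonneg (by positivity) (by linarith)

lemma rhoKer_scale {r : ℝ} (y : ℂ) : rhoKer r y = (r ^ 2)⁻¹ * rhoKer 1 (r⁻¹ • y) := by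
  simp only [rhoKer]
  rw [show Complex.normSq (r⁻¹ • y) / 1 ^ 2 = Complex.normSq y / r ^ 2 by
    simp [Complex.normSq_mul]; ring]
  ring

/-- The total mass of `rhoKer`. -/
def rhoMass : ℝ := ∫ y, rhoKer 1 y

lemma integral_rhoKer {r : ℝ} (hr : 0 < r) : ∫ y, rhoKer r y = rhoMass := by
  simp_rw [rhoKer_scale (r := r)]
  rw [integral_const_mul, Measure.integral_comp_inv_smul_of_nonneg volume _ hr.le,
    Complex.finrank_real_complex, smul_eq_mul, ← mul_assoc, inv_mul_cancel₀ (by positivity),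
    one_mul, rhoMass]

lemma rhoMass_pos : 0 < rhoMass := by
  refine (contDiff_rhoKer 1).continuous.integral_pos_of_hasCompactSupport_nonneg_nonzero
    (hasCompactSupport_rhoKer one_pos) (rhoKer_nonneg 1) (x := 0) ?_
  rw [rhoKer, deriv_kerT_of_lt (by norm_num [Complex.normSq])]
  norm_num

/-- The normalized mollifier at scale `r`. -/
def ker (r : ℝ) (y : ℂ) : ℝ := rhoMass⁻¹ * rhoKer r y

lemma contDiff_ker (r : ℝ) : ContDiff ℝ (⊤ : ℕ∞) (ker r) := contDiff_const.mul (contDiff_rhoKer r)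

lemma ker_nonneg (r : ℝ) (y : ℂ) : 0 ≤ ker r y :=
  mul_nonneg (inv_nonneg.2 rhoMass_pos.le) (rhoKer_nonneg r y)

lemma ker_of_le {r : ℝ} (hr : 0 < r) {y : ℂ} (hy : r ≤ ‖y‖) : ker r y = 0 := by
  rw [ker, rhoKer_of_le hr hy, mul_zero]

lemma hasCompactSupport_ker {r : ℝ} (hr : 0 < r) : HasCompactSupport (ker r) :=
  hasCompactSupport_of_norm fun _ hy => ker_of_le hr hy

lemma integral_ker {r : ℝ} (hr : 0 < r) : ∫ y, ker r y = 1 := by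
  simp only [ker]
  rw [integral_const_mul, integral_rhoKer hr, inv_mul_cancel₀ rhoMass_pos.ne']

lemma ker_lower {r : ℝ} (hr : 0 < r) {y : ℂ} (hy : ‖y‖ ≤ r / 2) :
    rhoMass⁻¹ * (4 / r ^ 2) = ker r y := by
  rw [ker, rhoKer, deriv_kerT_of_lt, mul_one]
  rw [div_lt_iff₀ (by positivity), Complex.normSq_eq_norm_sq]
  have : ‖y‖ ^ 2 ≤ (r / 2) ^ 2 := by gcongr
  nlinarith [sq_pos_of_pos hr]

lemma lapC_ker_scale {r : ℝ} (y : ℂ) : lapC (ker r) y = (r ^ 4)⁻¹ * lapC (ker 1) (r⁻¹ • y) := by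
  have h1 : ker r = fun y => (r ^ 2)⁻¹ * ker 1 (r⁻¹ • y) := by
    ext y
    simp only [ker]
    rw [rhoKer_scale]
    ring
  have hs : ContDiff ℝ (⊤ : ℕ∞) fun y : ℂ => ker 1 (r⁻¹ • y) :=
    (contDiff_ker 1).comp (contDiff_const_smul r⁻¹)
  rw [h1, lapC_const_mul _ hs.contDiffAt_two]
  have h2 (e : ℂ) : fderiv ℝ (fun w => fderiv ℝ (fun y : ℂ => ker 1 (r⁻¹ • y)) w e) y e =
      r⁻¹ * (r⁻¹ * fderiv ℝ (fun w => fderiv ℝ (ker 1) w e) (r⁻¹ • y) e) := by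
    have h3 : (fun w => fderiv ℝ (fun y : ℂ => ker 1 (r⁻¹ • y)) w e) =
        fun w => r⁻¹ * (fun w => fderiv ℝ (ker 1) w e) (r⁻¹ • w) := by
      ext w
      rw [fderiv_comp_smul]
      simp
    have h4 : DifferentiableAt ℝ (fun w => (fun w => fderiv ℝ (ker 1) w e) (r⁻¹ • w)) y :=
      (((contDiff_ker 1).fderiv_apply_const e).comp
        (contDiff_const_smul r⁻¹)).differentiable (by simp) y
    rw [h3, fderiv_const_mul h4,
      fderiv_comp_smul (f := fun w => fderiv ℝ (ker 1) w e)]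
    simp
  simp only [lapC]
  rw [h2, h2]
  ring

lemma exists_lapC_ker_bound : ∃ C, 0 < C ∧ ∀ r, 0 < r → ∀ y, |lapC (ker r) y| ≤ C / r ^ 4 := by
  obtain ⟨C, hC⟩ := (contDiff_ker 1).lapC.continuous.bounded_above_of_compact_support
    (hasCompactSupport_ker one_pos).lapC
  have hC0 : 0 ≤ C := (norm_nonneg _).trans (hC 0)
  refine ⟨C + 1, by linarith, fun r hr y => ?_⟩
  rw [lapC_ker_scale, abs_mul, abs_of_pos (by positivity : (0:ℝ) < (r ^ 4)⁻¹), div_eq_inv_mul]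
  gcongr
  exact (hC _).trans (by linarith)

lemma lapC_ker_of_lt {r : ℝ} (hr : 0 < r) {y : ℂ} (hy : r < ‖y‖) : lapC (ker r) y = 0 := by
  refine lapC_of_support fun h => ?_
  have := tsupport_subset_closedBall (fun y hy => ker_of_le hr hy) h
  rw [mem_closedBall_zero_iff] at this
  linarith

end Kernel

/-! ### Convolution and mollification -/

section Mollify

open Topology

/-- Convolution of real functions on `ℂ`. -/
def conv (v g : ℂ → ℝ) (z : ℂ) : ℝ := ∫ t, v t * g (z - t)

lemma conv_eq_convolution (v g : ℂ → ℝ) :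
    conv v g = convolution v g (ContinuousLinearMap.mul ℝ ℝ) volume := rfl

lemma HasCompactSupport.const_sub_comp {g : ℂ → ℝ} (hc : HasCompactSupport g) (z : ℂ) :
    HasCompactSupport fun t => g (z - t) :=
  hc.comp_homeomorph (Homeomorph.subLeft z)

lemma integrable_conv {v g : ℂ → ℝ} (hv : Continuous v) (hg : Continuous g)
    (hc : HasCompactSupport g) (z : ℂ) : Integrable fun t => v t * g (z - t) :=
  (hv.mul (hg.comp (continuous_sub_left z))).integrable_of_hasCompactSupport
    (hc.const_sub_comp z).mul_left

lemma contDiff_conv {v g : ℂ → ℝ} (hv : Continuous v) (hg : ContDiff ℝ (⊤ : ℕ∞) g)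
    (hc : HasCompactSupport g) : ContDiff ℝ (⊤ : ℕ∞) (conv v g) := by
  rw [conv_eq_convolution]
  exact hc.contDiff_convolution_right _ hv.locallyIntegrable hg

lemma fderiv_conv {v g : ℂ → ℝ} (hv : Continuous v) (hg : ContDiff ℝ (⊤ : ℕ∞) g)
    (hc : HasCompactSupport g) (z e : ℂ) :
    fderiv ℝ (conv v g) z e = conv v (fun y => fderiv ℝ g y e) z := by
  have h1 := hc.hasFDerivAt_convolution_right (ContinuousLinearMap.mul ℝ ℝ)
    hv.locallyIntegrable (hg.of_le (by simp)) z (μ := volume)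
  rw [conv_eq_convolution, h1.fderiv, convolution_precompR_apply _ hv.locallyIntegrable
    (hc.fderiv (𝕜 := ℝ)) (hg.continuous_fderiv (by simp))]
  rfl

lemma lapC_conv {v g : ℂ → ℝ} (hv : Continuous v) (hg : ContDiff ℝ (⊤ : ℕ∞) g)
    (hc : HasCompactSupport g) (z : ℂ) : lapC (conv v g) z = conv v (lapC g) z := by
  have h1 (e : ℂ) : (fun w => fderiv ℝ (conv v g) w e) = conv v fun y => fderiv ℝ g y e :=
    funext fun w => fderiv_conv hv hg hc w e
  have hc' (e : ℂ) : HasCompactSupport fun y => fderiv ℝ g y e := hc.fderiv_apply (𝕜 := ℝ) e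
  have hg' (e : ℂ) := hg.fderiv_apply_const e
  have h2 (e : ℂ) : fderiv ℝ (fun w => fderiv ℝ (conv v g) w e) z e =
      conv v (fun y => fderiv ℝ (fun w => fderiv ℝ g w e) y e) z := by
    rw [h1, fderiv_conv hv (hg' e) (hc' e)]
  rw [lapC, h2, h2, conv, conv, conv, ← integral_add]
  · simp only [lapC, mul_add]
  · exact integrable_conv hv ((hg' _).fderiv_apply_const _).continuous
      ((hc' _).fderiv_apply (𝕜 := ℝ) _) z
  · exact integrable_conv hv ((hg' _).fderiv_apply_const _).continuous
      ((hc' _).fderiv_apply (𝕜 := ℝ) _) z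

lemma conv_lapC_eq (v g : ℂ → ℝ) (z : ℂ) :
    conv v (lapC g) z = ∫ t, v t * lapC (fun s => g (z - s)) t := by
  simp only [conv, lapC_comp_const_sub]

lemma conv_lapC_comm {f g : ℂ → ℝ} (hf : ContDiff ℝ (⊤ : ℕ∞) f) (hg : ContDiff ℝ (⊤ : ℕ∞) g)
    (hc : HasCompactSupport g) (z : ℂ) : conv f (lapC g) z = conv (lapC f) g z := by
  rw [conv_lapC_eq, integral_mul_lapC (χ := fun s => g (z - s)) hf
    (hg.comp (contDiff_const.sub contDiff_id)) (hc.const_sub_comp z)]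
  rfl

lemma PeriodicC.conv {v : ℂ → ℝ} (hv : PeriodicC v) (g : ℂ → ℝ) : PeriodicC (conv v g) := by
  have h (w : ℂ) (hw : ∀ z, v (z + w) = v z) (z : ℂ) : _root_.conv v g (z + w) =
      _root_.conv v g z := by
    unfold _root_.conv
    rw [← integral_add_right_eq_self _ w]
    refine integral_congr_ae (Filter.Eventually.of_forall fun t => ?_)
    simp only [hw, add_sub_add_right_eq_sub]
  exact fun z => ⟨h _ (fun z => (hv z).1) z, h _ (fun z => (hv z).2) z⟩

lemma tsupport_const_sub_comp_subset {g : ℂ → ℝ} {r : ℝ} (h : ∀ y, r ≤ ‖y‖ → g y = 0) (z : ℂ) :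
    tsupport (fun t => g (z - t)) ⊆ Metric.closedBall z r := by
  refine closure_minimal (fun y hy => ?_) Metric.isClosed_closedBall
  rw [Metric.mem_closedBall, dist_comm, dist_eq_norm]
  by_contra! h'
  exact hy (h _ h'.le)

/-- Testing a distributionally subharmonic function with a translated bump function. -/
lemma DSubhOn.conv_lapC_nonneg {v g : ℂ → ℝ} {U : Set ℂ} (hv : DSubhOn v U)
    (hg : ContDiff ℝ (⊤ : ℕ∞) g) {r : ℝ} (h : ∀ y, r ≤ ‖y‖ → g y = 0) (h0 : ∀ y, 0 ≤ g y) {z : ℂ}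
    (hz : Metric.closedBall z r ⊆ U) : 0 ≤ conv v (lapC g) z := by
  rw [conv_lapC_eq]
  exact hv _ (hg.comp (contDiff_const.sub contDiff_id))
    ((hasCompactSupport_of_norm h).const_sub_comp z) (fun t => h0 _)
    ((tsupport_const_sub_comp_subset h z).trans hz)

lemma DSuphOn.neg {v : ℂ → ℝ} {U : Set ℂ} (hv : DSuphOn v U) : DSubhOn (fun z => -v z) U := by
  intro χ h1 h2 h3 h4
  have := hv χ h1 h2 h3 h4
  simp only [neg_mul, integral_neg]
  linarith

lemma DSubhOn.neg {v : ℂ → ℝ} {U : Set ℂ} (hv : DSubhOn v U) : DSuphOn (fun z => -v z) U := by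
  intro χ h1 h2 h3 h4
  have := hv χ h1 h2 h3 h4
  simp only [neg_mul, integral_neg]
  linarith

lemma dSubhOn_of_lapC_nonneg {f : ℂ → ℝ} {U : Set ℂ} (hf : ContDiff ℝ (⊤ : ℕ∞) f)
    (h : ∀ z ∈ U, 0 ≤ lapC f z) : DSubhOn f U := by
  intro χ h1 h2 h3 h4
  rw [integral_mul_lapC hf h1 h2]
  refine integral_nonneg fun z => ?_
  by_cases hz : z ∈ tsupport χ
  · exact mul_nonneg (h z (h4 hz)) (h3 z)
  · simp [image_eq_zero_of_notMem_tsupport hz]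

/-- The mollification of `v` at scale `r`. -/
def moll (r : ℝ) (v : ℂ → ℝ) : ℂ → ℝ := conv v (ker r)

lemma contDiff_moll {v : ℂ → ℝ} (hv : Continuous v) {r : ℝ} (hr : 0 < r) :
    ContDiff ℝ (⊤ : ℕ∞) (moll r v) :=
  contDiff_conv hv (contDiff_ker r) (hasCompactSupport_ker hr)

lemma PeriodicC.moll {v : ℂ → ℝ} (hv : PeriodicC v) (r : ℝ) : PeriodicC (moll r v) := hv.conv _

lemma lapC_moll {v : ℂ → ℝ} (hv : Continuous v) {r : ℝ} (hr : 0 < r) (z : ℂ) :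
    lapC (moll r v) z = conv v (lapC (ker r)) z :=
  lapC_conv hv (contDiff_ker r) (hasCompactSupport_ker hr) z

lemma lapC_moll_of_contDiff {f : ℂ → ℝ} (hf : ContDiff ℝ (⊤ : ℕ∞) f) {r : ℝ} (hr : 0 < r) (z : ℂ) :
    lapC (moll r f) z = moll r (lapC f) z := by
  rw [lapC_moll hf.continuous hr, conv_lapC_comm hf (contDiff_ker r) (hasCompactSupport_ker hr)]
  rfl

lemma integrable_moll {v : ℂ → ℝ} (hv : Continuous v) {r : ℝ} (hr : 0 < r) (z : ℂ) :
    Integrable fun t => v t * ker r (z - t) :=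
  integrable_conv hv (contDiff_ker r).continuous (hasCompactSupport_ker hr) z

lemma moll_mono {v v' : ℂ → ℝ} (hv : Continuous v) (hv' : Continuous v') {r : ℝ} (hr : 0 < r)
    {z : ℂ} (h : ∀ t ∈ Metric.closedBall z r, v t ≤ v' t) : moll r v z ≤ moll r v' z := by
  refine integral_mono (integrable_moll hv hr z) (integrable_moll hv' hr z) fun t => ?_
  by_cases ht : t ∈ Metric.closedBall z r
  · exact mul_le_mul_of_nonneg_right (h t ht) (ker_nonneg _ _)
  · rw [Metric.mem_closedBall, dist_comm, dist_eq_norm, not_le] at ht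
    simp [ker_of_le hr ht.le]

lemma moll_const {r : ℝ} (hr : 0 < r) (c : ℝ) (z : ℂ) : moll r (fun _ => c) z = c := by
  simp only [moll, conv]
  rw [integral_const_mul, integral_sub_left_eq_self (ker r), integral_ker hr, mul_one]

lemma moll_sub {v v' : ℂ → ℝ} (hv : Continuous v) (hv' : Continuous v') {r : ℝ} (hr : 0 < r)
    (z : ℂ) : moll r (fun t => v t - v' t) z = moll r v z - moll r v' z := by
  simp only [moll, conv]
  rw [← integral_sub (integrable_moll hv hr z) (integrable_moll hv' hr z)]
  simp only [sub_mul]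

lemma moll_const_mul (v : ℂ → ℝ) (c r : ℝ) (z : ℂ) :
    moll r (fun t => c * v t) z = c * moll r v z := by
  simp only [moll, conv, mul_assoc]
  rw [integral_const_mul]

lemma moll_neg (v : ℂ → ℝ) (r : ℝ) (z : ℂ) : moll r (fun t => -v t) z = -moll r v z := by
  simp only [moll, conv, neg_mul]
  rw [integral_neg]

lemma moll_le {v : ℂ → ℝ} (hv : Continuous v) {r : ℝ} (hr : 0 < r) {z : ℂ} {c : ℝ}
    (h : ∀ t ∈ Metric.closedBall z r, v t ≤ c) : moll r v z ≤ c :=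
  (moll_mono hv continuous_const hr h).trans_eq (moll_const hr c z)

lemma le_moll {v : ℂ → ℝ} (hv : Continuous v) {r : ℝ} (hr : 0 < r) {z : ℂ} {c : ℝ}
    (h : ∀ t ∈ Metric.closedBall z r, c ≤ v t) : c ≤ moll r v z :=
  (moll_const hr c z).symm.le.trans (moll_mono continuous_const hv hr h)

lemma abs_moll_sub_le {v : ℂ → ℝ} (hv : Continuous v) {r : ℝ} (hr : 0 < r) {z : ℂ} {ε : ℝ}
    (h : ∀ t ∈ Metric.closedBall z r, |v t - v z| ≤ ε) : |moll r v z - v z| ≤ ε := by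
  rw [abs_le]
  constructor
  · have := le_moll hv hr (c := v z - ε) fun t ht => by linarith [(abs_le.1 (h t ht)).1]
    linarith
  · have := moll_le hv hr (c := v z + ε) fun t ht => by linarith [(abs_le.1 (h t ht)).2]
    linarith

lemma PeriodicC.exists_moll_close {v : ℂ → ℝ} (hp : PeriodicC v) (hv : Continuous v) {ε : ℝ}
    (hε : 0 < ε) : ∃ r₀ > 0, ∀ r, 0 < r → r ≤ r₀ → ∀ z, |_root_.moll r v z - v z| ≤ ε := by
  obtain ⟨δ, hδ, h⟩ := Metric.uniformContinuous_iff.1 (hp.uniformContinuous hv) ε hε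
  refine ⟨δ / 2, by positivity, fun r hr hr0 z => abs_moll_sub_le hv hr fun t ht => ?_⟩
  exact (h (lt_of_le_of_lt (Metric.mem_closedBall.1 ht) (by linarith))).le

lemma tendsto_moll {v : ℂ → ℝ} (hv : Continuous v) (z : ℂ) :
    Filter.Tendsto (fun r => moll r v z) (𝓝[>] 0) (𝓝 (v z)) := by
  rw [Metric.tendsto_nhdsWithin_nhds]
  intro ε hε
  obtain ⟨δ, hδ, h⟩ := Metric.continuousAt_iff.1 (hv.continuousAt (x := z)) (ε / 2) (by positivity)
  refine ⟨δ, hδ, fun r hr hr' => ?_⟩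
  rw [Real.dist_eq, sub_zero, abs_of_pos hr] at hr'
  refine lt_of_le_of_lt (abs_moll_sub_le hv hr fun t ht => ?_) (half_lt_self hε)
  exact (h (lt_of_le_of_lt (Metric.mem_closedBall.1 ht) hr')).le

lemma DSubhOn.lapC_moll_nonneg {v : ℂ → ℝ} (hc : Continuous v) {U : Set ℂ} (hv : DSubhOn v U)
    {r : ℝ} (hr : 0 < r) {z : ℂ} (hz : Metric.closedBall z r ⊆ U) : 0 ≤ lapC (moll r v) z := by
  rw [lapC_moll hc hr]
  exact hv.conv_lapC_nonneg (contDiff_ker r) (fun y hy => ker_of_le hr hy) (ker_nonneg r) hz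

lemma DSubhOn.moll_mono_radius {v : ℂ → ℝ} (hc : Continuous v) {U : Set ℂ} (hv : DSubhOn v U)
    {a b : ℝ} (ha : 0 < a) (hab : a ≤ b) {z : ℂ} (hz : Metric.closedBall z b ⊆ U) :
    moll a v z ≤ moll b v z := by
  have hb : 0 < b := ha.trans_le hab
  have hL : ContDiff ℝ (⊤ : ℕ∞) fun y => logKer b y - logKer a y :=
    (contDiff_logKer b).sub (contDiff_logKer a)
  have hlap : lapC (fun y => rhoMass⁻¹ * (logKer b y - logKer a y)) =
      fun y => ker b y - ker a y := by
    ext y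
    rw [lapC_const_mul _ hL.contDiffAt_two, lapC_sub (contDiff_logKer b).contDiffAt_two
      (contDiff_logKer a).contDiffAt_two, lapC_logKer, lapC_logKer, ker, ker]
    ring
  have h1 := hv.conv_lapC_nonneg (g := fun y => rhoMass⁻¹ * (logKer b y - logKer a y))
    (contDiff_const.mul hL) (r := b)
    (fun y hy => by rw [logKer_of_le hb hy, logKer_of_le ha (hab.trans hy)]; simp)
    (fun y => mul_nonneg (inv_nonneg.2 rhoMass_pos.le) (sub_nonneg.2 (logKer_mono ha hab y))) hz
  rw [hlap, conv] at h1
  simp only [mul_sub] at h1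
  rw [integral_sub (integrable_moll hc hb z) (integrable_moll hc ha z)] at h1
  exact sub_nonneg.1 h1

lemma DSubhOn.le_moll {v : ℂ → ℝ} (hc : Continuous v) {U : Set ℂ} (hv : DSubhOn v U)
    {r : ℝ} (hr : 0 < r) {z : ℂ} (hz : Metric.closedBall z r ⊆ U) : v z ≤ moll r v z := by
  refine le_of_tendsto (tendsto_moll hc z) ?_
  filter_upwards [Ioo_mem_nhdsGT hr] with a ha
  exact hv.moll_mono_radius hc ha.1 ha.2.le hz

lemma DSuphOn.lapC_moll_nonpos {v : ℂ → ℝ} (hc : Continuous v) {U : Set ℂ} (hv : DSuphOn v U)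
    {r : ℝ} (hr : 0 < r) {z : ℂ} (hz : Metric.closedBall z r ⊆ U) : lapC (moll r v) z ≤ 0 := by
  have := hv.neg.lapC_moll_nonneg (v := fun z => -v z) hc.neg hr hz
  rw [show moll r (fun z => -v z) = fun z => -moll r v z from funext (moll_neg v r),
    lapC_neg] at this
  linarith

lemma DSuphOn.moll_le {v : ℂ → ℝ} (hc : Continuous v) {U : Set ℂ} (hv : DSuphOn v U)
    {r : ℝ} (hr : 0 < r) {z : ℂ} (hz : Metric.closedBall z r ⊆ U) : moll r v z ≤ v z := by
  have := hv.neg.le_moll (v := fun z => -v z) hc.neg hr hz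
  rw [moll_neg] at this
  linarith

end Mollify

/-! ### Regularity of the solution of the double obstacle problem -/

section Obstacle

open Topology

/-- The second moment of the mollifier. -/
def kerM : ℝ := ∫ y, Complex.normSq y * ker 1 y

lemma kerM_pos : 0 < kerM := by
  refine (contDiff_normSq.mul (contDiff_ker 1)).continuous
    |>.integral_pos_of_hasCompactSupport_nonneg_nonzero
    (hasCompactSupport_ker one_pos).mul_left
    (fun y => mul_nonneg (Complex.normSq_nonneg y) (ker_nonneg 1 y)) (x := 1 / 2) ?_
  rw [← ker_lower one_pos (by norm_num)]
  have := rhoMass_pos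
  have : Complex.normSq (1 / 2) = 1 / 4 := by norm_num [Complex.normSq_apply]
  rw [this]
  positivity

lemma ker_scale {r : ℝ} (y : ℂ) : ker r y = (r ^ 2)⁻¹ * ker 1 (r⁻¹ • y) := by
  simp only [ker]
  rw [rhoKer_scale]
  ring

lemma moll_normSq {r : ℝ} (hr : 0 < r) (z : ℂ) :
    moll r (fun t => Complex.normSq (t - z)) z = r ^ 2 * kerM := by
  have h1 : moll r (fun t => Complex.normSq (t - z)) z = ∫ y, Complex.normSq y * ker r y := by
    rw [moll, conv, ← integral_sub_left_eq_self (fun y => Complex.normSq y * ker r y) volume z]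
    refine integral_congr_ae (Filter.Eventually.of_forall fun t => ?_)
    simp only
    rw [← Complex.normSq_neg, neg_sub]
  have h2 (y : ℂ) : Complex.normSq y * ker r y =
      (fun y => Complex.normSq y * ker 1 y) (r⁻¹ • y) := by
    simp only
    rw [ker_scale]
    simp [Complex.normSq_mul]
    ring
  rw [h1]
  rw [integral_congr_ae (Filter.Eventually.of_forall h2),
    Measure.integral_comp_inv_smul_of_nonneg volume (fun y => Complex.normSq y * ker 1 y) hr.le, Complex.finrank_real_complex]
  rfl

lemma exists_ker_bound : ∃ C, 0 < C ∧ ∀ r, 0 < r → ∀ y, |ker r y| ≤ C / r ^ 2 := by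
  obtain ⟨C, hC⟩ := (contDiff_ker 1).continuous.bounded_above_of_compact_support
    (hasCompactSupport_ker one_pos)
  have hC0 : 0 ≤ C := (norm_nonneg _).trans (hC 0)
  refine ⟨C + 1, by linarith, fun r hr y => ?_⟩
  rw [ker_scale, abs_mul, abs_of_pos (by positivity : (0:ℝ) < (r ^ 2)⁻¹), div_eq_inv_mul]
  gcongr
  exact (hC _).trans (by linarith)

/-- Quantitative sub-mean value property. -/
lemma add_le_moll_of_le_lapC {f : ℂ → ℝ} (hf : ContDiff ℝ (⊤ : ℕ∞) f) {r : ℝ} (hr : 0 < r) {z : ℂ}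
    {c : ℝ} (h : ∀ t ∈ Metric.closedBall z r, c ≤ lapC f t) :
    f z + c / 4 * (r ^ 2 * kerM) ≤ moll r f z := by
  have hq : ContDiff ℝ (⊤ : ℕ∞) fun t => Complex.normSq (t - z) :=
    contDiff_normSq.comp (contDiff_id.sub contDiff_const)
  have hq' : ContDiff ℝ (⊤ : ℕ∞) fun t => c / 4 * Complex.normSq (t - z) := contDiff_const.mul hq
  have hg : ContDiff ℝ (⊤ : ℕ∞) fun t => f t - c / 4 * Complex.normSq (t - z) := hf.sub hq'
  have h1 : DSubhOn (fun t => f t - c / 4 * Complex.normSq (t - z)) (Metric.closedBall z r) := by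
    refine dSubhOn_of_lapC_nonneg hg fun t ht => ?_
    rw [lapC_sub hf.contDiffAt_two hq'.contDiffAt_two, lapC_const_mul _ hq.contDiffAt_two]
    have : lapC (fun t => Complex.normSq (t - z)) t = 4 := by
      simp only [sub_eq_add_neg]
      rw [lapC_comp_add Complex.normSq, lapC_normSq]
    rw [this]
    linarith [h t ht]
  have h2 := h1.le_moll hg.continuous hr subset_rfl
  rw [moll_sub hf.continuous hq'.continuous hr, moll_const_mul, moll_normSq hr] at h2
  simp only [sub_self, map_zero, mul_zero, sub_zero] at h2
  linarith

lemma moll_le_add_of_lapC_le {f : ℂ → ℝ} (hf : ContDiff ℝ (⊤ : ℕ∞) f) {r : ℝ} (hr : 0 < r) {z : ℂ}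
    {c : ℝ} (h : ∀ t ∈ Metric.closedBall z r, lapC f t ≤ c) :
    moll r f z ≤ f z + c / 4 * (r ^ 2 * kerM) := by
  have := add_le_moll_of_le_lapC hf.neg hr (c := -c) (z := z) fun t ht => by
    rw [lapC_neg]
    linarith [h t ht]
  rw [moll_neg] at this
  linarith

/-- A convolution with a kernel at scale `κ` is controlled by a mollification at scale `4κ`. -/
lemma abs_conv_le_moll {v g : ℂ → ℝ} (hv : Continuous v) (h0 : ∀ t, 0 ≤ v t) {κ B : ℝ}
    (hκ : 0 < κ) (hB : ∀ y, |g y| ≤ B) (hg0 : ∀ y, κ < ‖y‖ → g y = 0) {z p : ℂ}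
    (hp : ‖z - p‖ ≤ κ) :
    |conv v g z| ≤ B * (4 * κ ^ 2 * rhoMass) * moll (4 * κ) v p := by
  have hκ4 : 0 < 4 * κ := by positivity
  have hB0 : 0 ≤ B := (abs_nonneg _).trans (hB 0)
  have hm := rhoMass_pos
  rw [moll, conv, conv, ← integral_const_mul, ← Real.norm_eq_abs]
  refine norm_integral_le_of_norm_le ((integrable_moll hv hκ4 p).const_mul _)
    (Filter.Eventually.of_forall fun t => ?_)
  rw [Real.norm_eq_abs, abs_mul, abs_of_nonneg (h0 t)]
  rcases lt_or_ge κ ‖z - t‖ with h | h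
  · rw [hg0 _ h, abs_zero, mul_zero]
    have := ker_nonneg (4 * κ) (p - t)
    have := h0 t
    positivity
  · have h1 : ‖p - t‖ ≤ 4 * κ / 2 := by
      calc ‖p - t‖ = ‖(z - t) - (z - p)‖ := by congr 1; ring
        _ ≤ ‖z - t‖ + ‖z - p‖ := norm_sub_le _ _
        _ ≤ _ := by linarith
    rw [← ker_lower hκ4 h1]
    calc v t * |g (z - t)| ≤ v t * B := mul_le_mul_of_nonneg_left (hB _) (h0 t)
      _ = _ := by field_simp

/-- `ψ` solves the double obstacle problem with obstacles `φ - τ` and `φ`. -/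
structure IsObst (φ ψ : ℂ → ℝ) (τ : ℝ) : Prop where
  smooth : ContDiff ℝ (⊤ : ℕ∞) φ
  per : PeriodicC φ
  pos : 0 < τ
  cont : Continuous ψ
  per' : PeriodicC ψ
  lower : ∀ z, φ z - τ ≤ ψ z
  upper : ∀ z, ψ z ≤ φ z
  sub : DSubhOn ψ {z | φ z - τ < ψ z}
  sup : DSuphOn ψ {z | ψ z < φ z}

namespace IsObst

variable {φ ψ : ℂ → ℝ} {τ : ℝ}

/-- The obstacle problem is symmetric under `ψ ↦ -ψ`. -/
lemma symm (h : IsObst φ ψ τ) : IsObst (fun z => τ - φ z) (fun z => -ψ z) τ where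
  smooth := contDiff_const.sub h.smooth
  per := h.per.comp fun x => τ - x
  pos := h.pos
  cont := h.cont.neg
  per' := h.per'.comp fun x => -x
  lower z := by linarith [h.upper z]
  upper z := by linarith [h.lower z]
  sub := by
    convert h.sup.neg using 2
    ext z
    constructor <;> intro h <;> linarith
  sup := by
    convert h.sub.neg using 2
    ext z
    constructor <;> intro h <;> linarith

lemma continuous_gap (h : IsObst φ ψ τ) : Continuous fun z => φ z - ψ z :=
  h.smooth.continuous.sub h.cont

lemma periodic_gap (h : IsObst φ ψ τ) : PeriodicC fun z => φ z - ψ z :=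
  h.per.comp₂ h.per' fun x y => x - y

lemma gap_nonneg (h : IsObst φ ψ τ) (z : ℂ) : 0 ≤ φ z - ψ z := by linarith [h.upper z]

lemma gap_le (h : IsObst φ ψ τ) (z : ℂ) : φ z - ψ z ≤ τ := by linarith [h.lower z]

lemma exists_gap_uniform (h : IsObst φ ψ τ) {ε : ℝ} (hε : 0 < ε) :
    ∃ r₀ > 0, ∀ z t, t ∈ Metric.closedBall z r₀ → |(φ t - ψ t) - (φ z - ψ z)| < ε := by
  obtain ⟨δ, hδ, hd⟩ := Metric.uniformContinuous_iff.1
    (h.periodic_gap.uniformContinuous h.continuous_gap) ε hε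
  refine ⟨δ / 2, by positivity, fun z t ht => ?_⟩
  exact hd (lt_of_le_of_lt (Metric.mem_closedBall.1 ht) (by linarith))

lemma exists_lap_bound (h : IsObst φ ψ τ) : ∃ C, 0 < C ∧ ∀ z, |lapC φ z| ≤ C :=
  h.per.lapC.exists_bound h.smooth.lapC.continuous

lemma exists_moll_gap_bound (h : IsObst φ ψ τ) : ∃ C > 0, ∃ r₀ > 0, ∀ p, φ p - ψ p = 0 →
    ∀ r, 0 < r → r ≤ r₀ → moll r (fun z => φ z - ψ z) p ≤ C * r ^ 2 := by
  obtain ⟨C, hC, hCb⟩ := h.exists_lap_bound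
  obtain ⟨r₀, hr₀, hu⟩ := h.exists_gap_uniform h.pos
  have hm := kerM_pos
  refine ⟨C / 4 * kerM, by positivity, r₀, hr₀, fun p hp r hr hrr => ?_⟩
  rw [moll_sub h.smooth.continuous h.cont hr]
  have h1 := moll_le_add_of_lapC_le h.smooth hr (z := p) (c := C)
    fun t _ => (abs_le.1 (hCb t)).2
  have h2 := h.sub.le_moll h.cont hr (z := p) fun t ht => by
    have := hu p t (Metric.closedBall_subset_closedBall hrr ht)
    rw [hp, sub_zero] at this
    have := (abs_lt.1 this).2
    simp only [Set.mem_ofPred_eq]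
    linarith
  linarith

lemma lapC_moll_eq (h : IsObst φ ψ τ) {κ : ℝ} (hκ : 0 < κ) (z : ℂ) :
    lapC (moll κ ψ) z = moll κ (lapC φ) z - conv (fun z => φ z - ψ z) (lapC (ker κ)) z := by
  rw [← lapC_moll_of_contDiff h.smooth hκ, ← lapC_moll h.continuous_gap hκ,
    show moll κ (fun z => φ z - ψ z) = fun z => moll κ φ z - moll κ ψ z from
      funext (moll_sub h.smooth.continuous h.cont hκ),
    lapC_sub (contDiff_moll h.smooth.continuous hκ).contDiffAt_two
      (contDiff_moll h.cont hκ).contDiffAt_two]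
  ring

lemma lapC_moll_nonpos (h : IsObst φ ψ τ) {κ : ℝ} (hκ : 0 < κ) {z : ℂ}
    (hz : ∀ t ∈ Metric.closedBall z κ, 0 < φ t - ψ t) : lapC (moll κ ψ) z ≤ 0 :=
  h.sup.lapC_moll_nonpos h.cont hκ fun t ht => sub_pos.1 (hz t ht)

lemma lapC_moll_nonneg (h : IsObst φ ψ τ) {κ : ℝ} (hκ : 0 < κ) {z : ℂ}
    (hz : ∀ t ∈ Metric.closedBall z κ, φ t - ψ t < τ) : 0 ≤ lapC (moll κ ψ) z :=
  h.sub.lapC_moll_nonneg h.cont hκ fun t ht => by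
    simp only [Set.mem_ofPred_eq]
    linarith [hz t ht]

lemma moll_eq (h : IsObst φ ψ τ) {κ : ℝ} (hκ : 0 < κ) {z : ℂ}
    (hz : ∀ t ∈ Metric.closedBall z κ, 0 < φ t - ψ t ∧ φ t - ψ t < τ) : moll κ ψ z = ψ z := by
  refine le_antisymm (h.sup.moll_le h.cont hκ fun t ht => sub_pos.1 (hz t ht).1)
    (h.sub.le_moll h.cont hκ fun t ht => ?_)
  simp only [Set.mem_ofPred_eq]
  linarith [(hz t ht).2]

lemma exists_lapC_moll_le (h : IsObst φ ψ τ) : ∃ C > 0, ∃ κ₀ > 0, ∀ κ, 0 < κ → κ ≤ κ₀ →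
    ∀ z, lapC (moll κ ψ) z ≤ C := by
  obtain ⟨C, hC, hCb⟩ := h.exists_lap_bound
  obtain ⟨D, hD, r₀, hr₀, hDb⟩ := h.exists_moll_gap_bound
  obtain ⟨B, hB, hBb⟩ := exists_lapC_ker_bound
  have hm := rhoMass_pos
  refine ⟨C + B * (4 * rhoMass) * (D * 16), by positivity, r₀ / 4, by positivity,
    fun κ hκ hκ0 z => ?_⟩
  by_cases hz : ∀ t ∈ Metric.closedBall z κ, 0 < φ t - ψ t
  · exact (h.lapC_moll_nonpos hκ hz).trans (by positivity)
  · push Not at hz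
    obtain ⟨p, hp, hp0⟩ := hz
    have hp0 : φ p - ψ p = 0 := le_antisymm hp0 (h.gap_nonneg p)
    rw [Metric.mem_closedBall, dist_comm, dist_eq_norm] at hp
    have h1 := abs_conv_le_moll h.continuous_gap h.gap_nonneg hκ (hBb κ hκ)
      (fun y hy => lapC_ker_of_lt hκ hy) hp
    have h2 := hDb p hp0 (4 * κ) (by positivity) (by linarith)
    have h3 : moll κ (lapC φ) z ≤ C :=
      moll_le h.smooth.lapC.continuous hκ fun t _ => (abs_le.1 (hCb t)).2
    rw [h.lapC_moll_eq hκ]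
    have h4 : B / κ ^ 4 * (4 * κ ^ 2 * rhoMass) * moll (4 * κ) (fun z => φ z - ψ z) p ≤
        B / κ ^ 4 * (4 * κ ^ 2 * rhoMass) * (D * (4 * κ) ^ 2) := by gcongr
    have h5 : B / κ ^ 4 * (4 * κ ^ 2 * rhoMass) * (D * (4 * κ) ^ 2) =
        B * (4 * rhoMass) * (D * 16) := by
      field_simp
      ring
    linarith [(abs_le.1 h1).1]

/-- The Laplacian of the mollified solution is bounded. -/
lemma exists_abs_lapC_moll_le (h : IsObst φ ψ τ) : ∃ C > 0, ∃ κ₀ > 0, ∀ κ, 0 < κ → κ ≤ κ₀ →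
    ∀ z, |lapC (moll κ ψ) z| ≤ C := by
  obtain ⟨C, hC, κ₀, hκ₀, h1⟩ := h.exists_lapC_moll_le
  obtain ⟨C', hC', κ₀', hκ₀', h2⟩ := h.symm.exists_lapC_moll_le
  refine ⟨max C C', lt_max_of_lt_left hC, min κ₀ κ₀', lt_min hκ₀ hκ₀', fun κ hκ hκ0 z => ?_⟩
  have h3 := h1 κ hκ (hκ0.trans (min_le_left _ _)) z
  have h4 := h2 κ hκ (hκ0.trans (min_le_right _ _)) z
  rw [show moll κ (fun z => -ψ z) = fun z => -moll κ ψ z from funext (moll_neg ψ κ),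
    lapC_neg] at h4
  rw [abs_le]
  constructor
  · linarith [le_max_right C C']
  · exact h3.trans (le_max_left _ _)

/-- Quadratic growth of the gap away from the contact set. -/
lemma exists_gap_le_sq (h : IsObst φ ψ τ) : ∃ K > 0, ∃ r₀ > 0, ∀ p, φ p - ψ p = 0 →
    ∀ y, ‖y - p‖ ≤ r₀ → φ y - ψ y ≤ K * ‖y - p‖ ^ 2 := by
  obtain ⟨C, hC, hCb⟩ := h.exists_lap_bound
  obtain ⟨D, hD, r₀, hr₀, hDb⟩ := h.exists_moll_gap_bound
  obtain ⟨B, hB, hBb⟩ := exists_ker_bound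
  obtain ⟨C', hC', κ₀, hκ₀, hC'b⟩ := h.exists_abs_lapC_moll_le
  have hm := rhoMass_pos
  have hkm := kerM_pos
  refine ⟨C / 4 * kerM + C' / 4 * kerM + B * (4 * rhoMass) * (D * 16), by positivity, r₀ / 4,
    by positivity, fun p hp y hy => ?_⟩
  rcases (norm_nonneg (y - p)).eq_or_lt with h0 | h0
  · have : y = p := by
      rw [← sub_eq_zero, ← norm_eq_zero]
      exact h0.symm
    subst this
    rw [hp]
    positivity
  set r := ‖y - p‖ with hr
  have h1 : moll r ψ y ≤ ψ y + C' / 4 * (r ^ 2 * kerM) := by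
    refine le_of_forall_pos_le_add fun ε hε => ?_
    obtain ⟨κ₁, hκ₁, hcl⟩ := h.per'.exists_moll_close h.cont (half_pos hε)
    set κ := min κ₀ κ₁
    have hκ : 0 < κ := lt_min hκ₀ hκ₁
    have hcl := hcl κ hκ (min_le_right _ _)
    have h2 := moll_le_add_of_lapC_le (contDiff_moll h.cont hκ) h0 (z := y)
      fun t _ => (abs_le.1 (hC'b κ hκ (min_le_left _ _) t)).2
    have h3 : moll r (fun t => ψ t - ε / 2) y ≤ moll r (moll κ ψ) y :=
      moll_mono (v := fun t => ψ t - ε / 2) (h.cont.sub continuous_const) (contDiff_moll h.cont hκ).continuous h0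
        fun t _ => by linarith [(abs_le.1 (hcl t)).1]
    rw [moll_sub h.cont continuous_const h0, moll_const h0] at h3
    linarith [(abs_le.1 (hcl y)).2]
  have h2 := add_le_moll_of_le_lapC h.smooth h0 (z := y) (c := -C)
    fun t _ => (abs_le.1 (hCb t)).1
  have h3 := abs_conv_le_moll h.continuous_gap h.gap_nonneg h0 (hBb r h0)
    (fun t ht => ker_of_le h0 ht.le) hr.symm.le
  have h4 := hDb p hp (4 * r) (by positivity) (by linarith)
  have h5 : B / r ^ 2 * (4 * r ^ 2 * rhoMass) * moll (4 * r) (fun z => φ z - ψ z) p ≤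
      B / r ^ 2 * (4 * r ^ 2 * rhoMass) * (D * (4 * r) ^ 2) := by gcongr
  have h6 : B / r ^ 2 * (4 * r ^ 2 * rhoMass) * (D * (4 * r) ^ 2) =
      B * (4 * rhoMass) * (D * 16) * r ^ 2 := by
    field_simp
    ring
  have h7 : moll r (fun z => φ z - ψ z) y ≤ B * (4 * rhoMass) * (D * 16) * r ^ 2 :=
    ((le_abs_self _).trans h3).trans (h5.trans_eq h6)
  rw [moll_sub h.smooth.continuous h.cont h0] at h7
  nlinarith

end IsObst

end Obstacle

section Density

open Topology

lemma volume_real_closedBall (z : ℂ) {r : ℝ} (hr : 0 ≤ r) :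
    volume.real (Metric.closedBall z r) = Real.pi * r ^ 2 := by
  rw [Measure.real, Complex.volume_closedBall]
  simp [ENNReal.toReal_ofReal hr, mul_comm]

/-- Near a density point of `S`, every point is comparatively close to `S`. -/
lemma ae_exists_near_of_density {S : Set ℂ} (hS : MeasurableSet S) :
    ∀ᵐ z, z ∈ S → ∀ ε > 0, ∀ᶠ κ in 𝓝[>] (0 : ℝ),
      ∀ y ∈ Metric.closedBall z κ, ∃ p ∈ S, ‖y - p‖ ≤ ε * κ := by
  have h1 := Besicovitch.ae_tendsto_measure_inter_div (volume : Measure ℂ) S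
  rw [ae_restrict_iff' hS] at h1
  filter_upwards [h1] with z hz hzS ε hε
  have h2 := (ENNReal.tendsto_toReal ENNReal.one_ne_top).comp (hz hzS)
  set δ := min ε 1 with hδ
  have hδ0 : 0 < δ := lt_min hε one_pos
  have h3 : Filter.Tendsto (fun κ : ℝ => 2 * κ) (𝓝[>] 0) (𝓝[>] 0) := by
    refine tendsto_nhdsWithin_iff.2 ⟨?_, ?_⟩
    · have : Filter.Tendsto (fun κ : ℝ => 2 * κ) (𝓝 0) (𝓝 (2 * 0)) :=
        (continuous_const.mul continuous_id).tendsto 0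
      rw [mul_zero] at this
      exact this.mono_left nhdsWithin_le_nhds
    · filter_upwards [self_mem_nhdsWithin] with κ hκ
      have : (0 : ℝ) < κ := hκ
      simpa using this
  have h4 := (h2.comp h3).eventually (lt_mem_nhds (a := 1 - δ ^ 2 / 4)
    (by rw [ENNReal.toReal_one]; linarith [sq_pos_of_pos hδ0]))
  filter_upwards [h4, self_mem_nhdsWithin] with κ hκ hκ0 y hy
  have hκ0 : 0 < κ := hκ0
  by_contra! hno
  have hd : Disjoint (S ∩ Metric.closedBall z (2 * κ)) (Metric.closedBall y (δ * κ)) := by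
    rw [Set.disjoint_left]
    rintro p ⟨hp, -⟩ hp'
    have := hno p hp
    rw [Metric.mem_closedBall, dist_comm, dist_eq_norm] at hp'
    have : δ * κ ≤ ε * κ := by
      gcongr
      exact min_le_left _ _
    linarith
  have hsub : S ∩ Metric.closedBall z (2 * κ) ∪ Metric.closedBall y (δ * κ) ⊆
      Metric.closedBall z (2 * κ) := by
    refine Set.union_subset Set.inter_subset_right (Metric.closedBall_subset_closedBall' ?_)
    have : δ * κ ≤ 1 * κ := by
      gcongr
      exact min_le_right _ _
    linarith [Metric.mem_closedBall.1 hy]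
  have hfin (a : ℂ) (r : ℝ) : volume (Metric.closedBall a r) ≠ ⊤ :=
    (isCompact_closedBall a r).measure_lt_top.ne
  have h5 := measureReal_mono (μ := volume) hsub (hfin _ _)
  rw [measureReal_union hd measurableSet_closedBall
    ((measure_mono Set.inter_subset_right).trans_lt (hfin z (2 * κ)).lt_top).ne (hfin _ _),
    volume_real_closedBall y (by positivity), volume_real_closedBall z (by positivity)] at h5
  simp only [Function.comp_apply, ENNReal.toReal_div] at hκ
  change _ < volume.real _ / volume.real _ at hκ
  rw [volume_real_closedBall z (by positivity), lt_div_iff₀ (by positivity)] at hκ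
  nlinarith

end Density

namespace IsObst

open Topology

variable {φ ψ : ℂ → ℝ} {τ : ℝ}

/-- At almost every contact point the gap vanishes to more than second order. -/
lemma ae_gap_isLittleO (h : IsObst φ ψ τ) : ∀ᵐ z, φ z - ψ z = 0 → ∀ ε > 0,
    ∀ᶠ κ in 𝓝[>] (0 : ℝ), ∀ t ∈ Metric.closedBall z κ, φ t - ψ t ≤ ε * κ ^ 2 := by
  obtain ⟨K, hK, r₀, hr₀, hb⟩ := h.exists_gap_le_sq
  have hcl : IsClosed {z | φ z - ψ z = 0} := isClosed_eq h.continuous_gap continuous_const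
  filter_upwards [ae_exists_near_of_density hcl.measurableSet] with z hz hz0 ε hε
  have hδ : 0 < min 1 (ε / K) := lt_min one_pos (by positivity)
  filter_upwards [hz hz0 _ hδ, Ioo_mem_nhdsGT hr₀] with κ hκ hκ0 t ht
  obtain ⟨p, hp, hpt⟩ := hκ t ht
  have hκ' := hκ0.1
  have h1 : ‖t - p‖ ≤ κ := hpt.trans (by nlinarith [min_le_left 1 (ε / K)])
  refine (hb p hp t (h1.trans hκ0.2.le)).trans ?_
  have h2 : ‖t - p‖ * ‖t - p‖ ≤ (ε / K * κ) * κ :=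
    mul_le_mul (hpt.trans (by gcongr; exact min_le_right _ _)) h1 (norm_nonneg _) (by positivity)
  calc K * ‖t - p‖ ^ 2 = K * (‖t - p‖ * ‖t - p‖) := by ring
    _ ≤ K * ((ε / K * κ) * κ) := by gcongr
    _ = ε * κ ^ 2 := by field_simp

lemma ae_tendsto_contact (h : IsObst φ ψ τ) : ∀ᵐ z, φ z - ψ z = 0 →
    Filter.Tendsto (fun κ => lapC (moll κ ψ) z) (𝓝[>] 0) (𝓝 (lapC φ z)) := by
  obtain ⟨B, hB, hBb⟩ := exists_lapC_ker_bound
  have hm := rhoMass_pos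
  filter_upwards [h.ae_gap_isLittleO] with z hz hz0
  have h1 : Filter.Tendsto (fun κ => conv (fun z => φ z - ψ z) (lapC (ker κ)) z) (𝓝[>] 0)
      (𝓝 0) := by
    rw [Metric.tendsto_nhds]
    intro ε hε
    have h4 : Filter.Tendsto (fun κ : ℝ => 4 * κ) (𝓝[>] 0) (𝓝[>] 0) := by
      refine tendsto_nhdsWithin_iff.2 ⟨?_, ?_⟩
      · have : Filter.Tendsto (fun κ : ℝ => 4 * κ) (𝓝 0) (𝓝 (4 * 0)) :=
          (continuous_const.mul continuous_id).tendsto 0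
        rw [mul_zero] at this
        exact this.mono_left nhdsWithin_le_nhds
      · filter_upwards [self_mem_nhdsWithin] with κ hκ
        have : (0 : ℝ) < κ := hκ
        simpa using this
    have hδ : 0 < ε / 2 / (B * (4 * rhoMass) * 16) := by positivity
    filter_upwards [h4.eventually (hz hz0 _ hδ), self_mem_nhdsWithin] with κ hκ hκ0
    have hκ0 : 0 < κ := hκ0
    have h5 := abs_conv_le_moll h.continuous_gap h.gap_nonneg hκ0 (hBb κ hκ0)
      (fun y hy => lapC_ker_of_lt hκ0 hy) (z := z) (p := z) (by simpa using hκ0.le)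
    have h6 := moll_le h.continuous_gap (r := 4 * κ) (by positivity) hκ
    rw [Real.dist_eq, sub_zero]
    refine h5.trans_lt ?_
    calc _ ≤ B / κ ^ 4 * (4 * κ ^ 2 * rhoMass) *
        (ε / 2 / (B * (4 * rhoMass) * 16) * (4 * κ) ^ 2) := by gcongr
      _ = ε / 2 := by
        field_simp
        ring
      _ < ε := by linarith
  have h2 := (tendsto_moll h.smooth.lapC.continuous z).sub h1
  rw [sub_zero] at h2
  refine h2.congr' ?_
  filter_upwards [self_mem_nhdsWithin] with κ hκ
  exact (h.lapC_moll_eq hκ z).symm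

lemma eventually_gap (h : IsObst φ ψ τ) {p : ℝ → Prop} {z : ℂ} (hp : ∀ᶠ s in 𝓝 (φ z - ψ z), p s) :
    ∀ᶠ κ in 𝓝[>] (0 : ℝ), ∀ t ∈ Metric.closedBall z κ, p (φ t - ψ t) := by
  have h1 : ∀ᶠ t in 𝓝 z, p (φ t - ψ t) := h.continuous_gap.continuousAt.eventually hp
  obtain ⟨ε, hε, hb⟩ := Metric.eventually_nhds_iff_ball.1 h1
  filter_upwards [Ioo_mem_nhdsGT hε] with κ hκ t ht
  exact hb t (Metric.closedBall_subset_ball hκ.2 ht)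

lemma eventually_lapC_moll_nonpos (h : IsObst φ ψ τ) {z : ℂ} (hz : 0 < φ z - ψ z) :
    ∀ᶠ κ in 𝓝[>] (0 : ℝ), lapC (moll κ ψ) z ≤ 0 := by
  filter_upwards [h.eventually_gap (lt_mem_nhds hz), self_mem_nhdsWithin] with κ h1 h2
  exact h.lapC_moll_nonpos h2 h1

lemma eventually_lapC_moll_nonneg (h : IsObst φ ψ τ) {z : ℂ} (hz : φ z - ψ z < τ) :
    ∀ᶠ κ in 𝓝[>] (0 : ℝ), 0 ≤ lapC (moll κ ψ) z := by
  filter_upwards [h.eventually_gap (gt_mem_nhds hz), self_mem_nhdsWithin] with κ h1 h2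
  exact h.lapC_moll_nonneg h2 h1

/-- The limit of the positive part of the Laplacian of the mollified solution. -/
lemma ae_tendsto_pos_part (h : IsObst φ ψ τ) : ∀ᵐ z,
    Filter.Tendsto (fun κ => max (lapC (moll κ ψ) z) 0) (𝓝[>] 0)
      (𝓝 ({z | ψ z = φ z}.indicator (lapC φ) z)) := by
  filter_upwards [h.ae_tendsto_contact] with z hz
  by_cases h0 : ψ z = φ z
  · rw [Set.indicator_of_mem (by exact h0)]
    have h1 := hz (by linarith)
    refine h1.congr' ?_
    filter_upwards [h.eventually_lapC_moll_nonneg (z := z) (by linarith [h.pos])] with κ hκ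
    exact (max_eq_left hκ).symm
  · rw [Set.indicator_of_notMem (by exact h0)]
    refine tendsto_const_nhds.congr' ?_
    have : 0 < φ z - ψ z := lt_of_le_of_ne (h.gap_nonneg z) fun h' => h0 (by linarith)
    filter_upwards [h.eventually_lapC_moll_nonpos this] with κ hκ
    exact (max_eq_right hκ).symm

lemma measurableSet_contact (h : IsObst φ ψ τ) : MeasurableSet {z | ψ z = φ z} :=
  (isClosed_eq h.cont h.smooth.continuous).measurableSet

/-- Dominated convergence over the fundamental domain. -/
lemma tendsto_setIntegral_Efd_of_bounded {F : ℝ → ℂ → ℝ} {G : ℂ → ℝ} {C r₀ : ℝ} (hr₀ : 0 < r₀)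
    (hF : ∀ r, 0 < r → Measurable (F r)) (hb : ∀ r, 0 < r → r ≤ r₀ → ∀ z, |F r z| ≤ C)
    (hlim : ∀ᵐ z, Filter.Tendsto (fun r => F r z) (𝓝[>] 0) (𝓝 (G z))) :
    Filter.Tendsto (fun r => ∫ z in Efd, F r z) (𝓝[>] 0) (𝓝 (∫ z in Efd, G z)) := by
  refine tendsto_integral_filter_of_dominated_convergence (fun _ => C) ?_ ?_ ?_ ?_
  · filter_upwards [self_mem_nhdsWithin] with r hr
    exact (hF r hr).aestronglyMeasurable
  · filter_upwards [Ioo_mem_nhdsGT hr₀] with r hr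
    exact Filter.Eventually.of_forall fun z => hb r hr.1 hr.2.le z
  · exact integrableOn_const volume_Efd_lt_top.ne
  · exact ae_restrict_of_ae hlim

lemma setIntegral_contact (h : IsObst φ ψ τ) :
    ∫ z in Efd, {z | ψ z = φ z}.indicator (lapC φ) z = ∫ z in {z | ψ z = φ z} ∩ Efd, lapC φ z := by
  rw [setIntegral_indicator h.measurableSet_contact, Set.inter_comm]

/-- The positive part of the Laplacian of the mollified solution tends to the contact integral. -/
lemma tendsto_integral_pos_part (h : IsObst φ ψ τ) :
    Filter.Tendsto (fun κ => ∫ z in Efd, max (lapC (moll κ ψ) z) 0) (𝓝[>] 0)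
      (𝓝 (∫ z in {z | ψ z = φ z} ∩ Efd, lapC φ z)) := by
  obtain ⟨C, hC, κ₀, hκ₀, hb⟩ := h.exists_abs_lapC_moll_le
  rw [← h.setIntegral_contact]
  refine tendsto_setIntegral_Efd_of_bounded (C := C) hκ₀ (fun κ hκ => ?_) (fun κ hκ hκ0 z => ?_)
    h.ae_tendsto_pos_part
  · exact ((contDiff_moll h.cont hκ).lapC.continuous.max continuous_const).measurable
  · have := abs_le.1 (hb κ hκ hκ0 z)
    rw [abs_of_nonneg (le_max_right _ _)]
    exact max_le this.2 hC.le

/-- The Laplacian of the mollified solution near the upper contact set. -/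
lemma tendsto_integral_upper (h : IsObst φ ψ τ) :
    Filter.Tendsto (fun κ => ∫ z in Efd, {z | φ z - ψ z ≤ τ / 2}.indicator (lapC (moll κ ψ)) z)
      (𝓝[>] 0) (𝓝 (∫ z in {z | ψ z = φ z} ∩ Efd, lapC φ z)) := by
  obtain ⟨C, hC, κ₀, hκ₀, hb⟩ := h.exists_abs_lapC_moll_le
  have hcl : IsClosed {z | φ z - ψ z ≤ τ / 2} := isClosed_le h.continuous_gap continuous_const
  have hτ := h.pos
  rw [← h.setIntegral_contact]
  refine tendsto_setIntegral_Efd_of_bounded (C := C) hκ₀ (fun κ hκ => ?_) (fun κ hκ hκ0 z => ?_) ?_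
  · exact (contDiff_moll h.cont hκ).lapC.continuous.measurable.indicator hcl.measurableSet
  · by_cases hz : z ∈ {z | φ z - ψ z ≤ τ / 2}
    · rw [Set.indicator_of_mem hz]
      exact hb κ hκ hκ0 z
    · rw [Set.indicator_of_notMem hz, abs_zero]
      exact hC.le
  · filter_upwards [h.ae_tendsto_contact] with z hz
    by_cases h0 : ψ z = φ z
    · have hz2 : z ∈ {z | φ z - ψ z ≤ τ / 2} := by
        change φ z - ψ z ≤ τ / 2
        linarith
      rw [Set.indicator_of_mem (by exact h0)]
      simp only [Set.indicator_of_mem hz2]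
      exact hz (by linarith)
    · rw [Set.indicator_of_notMem (by exact h0)]
      have hpos : 0 < φ z - ψ z := lt_of_le_of_ne (h.gap_nonneg z) fun h' => h0 (by linarith)
      refine tendsto_const_nhds.congr' ?_
      by_cases hz2 : z ∈ {z | φ z - ψ z ≤ τ / 2}
      · simp only [Set.indicator_of_mem hz2]
        have : φ z - ψ z ≤ τ / 2 := hz2
        filter_upwards [h.eventually_lapC_moll_nonpos hpos,
          h.eventually_lapC_moll_nonneg (z := z) (by linarith)] with κ h1 h2
        exact le_antisymm h2 h1
      · simp only [Set.indicator_of_notMem hz2]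
        exact Filter.Eventually.of_forall fun _ => rfl

/-- The lower contact region where the mollified solution stays above the lower obstacle carries
asymptotically no mass. -/
lemma tendsto_integral_lower (h : IsObst φ ψ τ) :
    Filter.Tendsto (fun R => ∫ z in Efd, {z | τ / 2 < φ z - ψ z ∧ φ z - τ ≤ moll R ψ z}.indicator
      (fun z => -lapC (moll R ψ) z) z) (𝓝[>] 0) (𝓝 0) := by
  obtain ⟨C, hC, κ₀, hκ₀, hb⟩ := h.exists_abs_lapC_moll_le
  have hτ := h.pos
  have hz0 : ∫ z in Efd, (fun _ : ℂ => (0 : ℝ)) z = 0 := by simp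
  refine Filter.Tendsto.mono_right (tendsto_setIntegral_Efd_of_bounded (G := fun _ => 0) (C := C) hκ₀
    (fun κ hκ => ?_) (fun κ hκ hκ0 z => ?_) ?_) (by rw [hz0])
  · refine (contDiff_moll h.cont hκ).lapC.continuous.neg.measurable.indicator ?_
    exact (measurableSet_lt measurable_const h.continuous_gap.measurable).inter
      (measurableSet_le (h.smooth.continuous.sub continuous_const).measurable
        (contDiff_moll h.cont hκ).continuous.measurable)
  · by_cases hz : z ∈ {z | τ / 2 < φ z - ψ z ∧ φ z - τ ≤ moll κ ψ z}
    · rw [Set.indicator_of_mem hz, abs_neg]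
      exact hb κ hκ hκ0 z
    · rw [Set.indicator_of_notMem hz, abs_zero]
      exact hC.le
  · filter_upwards [h.symm.ae_tendsto_contact, h.symm.ae_gap_isLittleO] with z hz hzf
    have hlap : lapC (fun z => τ - φ z) z = -lapC φ z := by
      rw [lapC_sub contDiffAt_const h.smooth.contDiffAt_two, lapC_const, zero_sub]
    have hneg (κ : ℝ) : lapC (moll κ fun z => -ψ z) z = -lapC (moll κ ψ) z := by
      rw [show moll κ (fun z => -ψ z) = fun z => -moll κ ψ z from funext (moll_neg ψ κ), lapC_neg]
    simp only [hlap, hneg] at hz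
    by_cases h0 : φ z - ψ z = τ
    · have hz1 := hz (by linarith)
      have hsgn : 0 ≤ -lapC φ z := by
        refine ge_of_tendsto hz1 ?_
        filter_upwards [h.eventually_lapC_moll_nonpos (z := z) (by linarith)] with κ hκ
        linarith
      rcases hsgn.eq_or_lt with h1 | h1
      · rw [← h1] at hz1
        refine squeeze_zero_norm (fun κ => ?_) (tendsto_norm_zero.comp hz1)
        exact norm_indicator_le_norm_self _ _
      · refine tendsto_const_nhds.congr' ?_
        have hkm := kerM_pos
        have hδ : 0 < -lapC φ z / 16 * kerM := by positivity
        have hlt : ∀ᶠ κ in 𝓝[>] (0 : ℝ), ∀ t ∈ Metric.closedBall z κ,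
            lapC φ t ≤ lapC φ z / 2 := by
          have : ∀ᶠ t in 𝓝 z, lapC φ t < lapC φ z / 2 :=
            h.smooth.lapC.continuous.continuousAt.eventually (gt_mem_nhds (by linarith))
          obtain ⟨ε, hε, hball⟩ := Metric.eventually_nhds_iff_ball.1 this
          filter_upwards [Ioo_mem_nhdsGT hε] with κ hκ t ht
          exact (hball t (Metric.closedBall_subset_ball hκ.2 ht)).le
        filter_upwards [hzf (by linarith) _ hδ, hlt, self_mem_nhdsWithin] with κ h2 h3 hκ
        have hκ : 0 < κ := hκ
        rw [Set.indicator_of_notMem]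
        rintro ⟨-, h4⟩
        have h5 := moll_le_add_of_lapC_le h.smooth hκ h3
        have h6 : moll κ (fun t => ψ t - φ t) z ≤ -lapC φ z / 16 * kerM * κ ^ 2 - τ :=
          moll_le (h.cont.sub h.smooth.continuous) hκ fun t ht => by
            have := h2 t ht
            change ψ t - φ t ≤ _
            linarith
        rw [moll_sub h.cont h.smooth.continuous hκ] at h6
        have h7 : 0 < -lapC φ z * (κ ^ 2 * kerM) := by positivity
        linarith
    · have hlt : φ z - ψ z < τ := lt_of_le_of_ne (h.gap_le z) h0
      refine tendsto_const_nhds.congr' ?_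
      by_cases hz2 : τ / 2 < φ z - ψ z
      · filter_upwards [h.eventually_lapC_moll_nonpos (z := z) (by linarith),
          h.eventually_lapC_moll_nonneg hlt] with κ h1 h2
        have : -lapC (moll κ ψ) z = 0 := by linarith
        by_cases hm : z ∈ {z | τ / 2 < φ z - ψ z ∧ φ z - τ ≤ moll κ ψ z}
        · rw [Set.indicator_of_mem hm, this]
        · rw [Set.indicator_of_notMem hm]
      · refine Filter.Eventually.of_forall fun κ => ?_
        exact (Set.indicator_of_notMem (fun hm => hz2 hm.1) _).symm

end IsObst

/-! ### A weighted mean value inequality for `∂̄` -/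

section MeanValue

open Topology

lemma integrable_uncurry_restrict {X F : Type*} [TopologicalSpace X] [MeasurableSpace X]
    [OpensMeasurableSpace X] [SecondCountableTopology X] [T2Space X] [NormedAddCommGroup F]
    {K : ℝ → X → F} (hK : Continuous (Function.uncurry K)) {μ : Measure X}
    [IsFiniteMeasureOnCompacts μ] [SFinite μ] {S T : Set X} (hST : S ⊆ T) (hT : IsCompact T)
    (a b : ℝ) :
    Integrable (Function.uncurry K) ((volume.restrict (Set.uIoc a b)).prod (μ.restrict S)) := by
  rw [Measure.prod_restrict]
  have h1 : IntegrableOn (Function.uncurry K) (Set.uIcc a b ×ˢ T)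
      ((volume : Measure ℝ).prod μ) :=
    hK.continuousOn.integrableOn_compact (isCompact_uIcc.prod hT)
  exact h1.mono_set (Set.prod_mono Set.uIoc_subset_uIcc hST)

lemma continuous_circleMap_uncurry : Continuous fun p : ℝ × ℝ => circleMap 0 p.1 p.2 := by
  unfold circleMap
  fun_prop

lemma hasDerivAt_circleMap_radius (t θ : ℝ) :
    HasDerivAt (fun t : ℝ => circleMap 0 t θ) (Complex.exp (θ * Complex.I)) t := by
  simp only [circleMap, zero_add]
  simpa using (Complex.ofRealCLM.hasDerivAt (x := t)).mul_const (Complex.exp (θ * Complex.I))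

lemma fderiv_circle_eq {v : ℂ → ℂ} (x : ℂ) (θ : ℝ) :
    fderiv ℝ v x (Complex.exp (θ * Complex.I)) +
      Complex.I * fderiv ℝ v x (Complex.I * Complex.exp (θ * Complex.I)) =
    2 * Complex.exp (-(θ * Complex.I)) * dbar v x := by
  have he : Complex.exp (θ * Complex.I) = Real.cos θ • (1 : ℂ) + Real.sin θ • Complex.I := by
    rw [Complex.exp_mul_I]
    simp
  have he' : Complex.I * Complex.exp (θ * Complex.I) =
      (-Real.sin θ) • (1 : ℂ) + Real.cos θ • Complex.I := by
    rw [he]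
    simp only [Complex.real_smul]
    push_cast
    linear_combination (Complex.sin θ) * Complex.I_mul_I
  have he2 : Complex.exp (-(θ * Complex.I)) = Complex.cos θ - Complex.sin θ * Complex.I := by
    rw [← neg_mul, Complex.exp_mul_I]
    simp
    ring
  rw [he', he, he2, map_add, map_add, map_smul, map_smul, map_smul, map_smul, dbar]
  simp only [Complex.real_smul]
  push_cast
  linear_combination (Complex.sin θ * fderiv ℝ v x Complex.I) * Complex.I_mul_I

lemma integral_fderiv_circle {v : ℂ → ℂ} (hv : ContDiff ℝ 1 v) {t : ℝ} (ht : t ≠ 0) :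
    ∫ θ in (-π)..π, fderiv ℝ v (circleMap 0 t θ) (Complex.I * Complex.exp (θ * Complex.I)) = 0 := by
  have hd (θ : ℝ) : HasDerivAt (fun θ : ℝ => v (circleMap 0 t θ))
      (fderiv ℝ v (circleMap 0 t θ) (circleMap 0 t θ * Complex.I)) θ :=
    ((hv.differentiable (by simp) _).hasFDerivAt).comp_hasDerivAt θ (hasDerivAt_circleMap 0 t θ)
  have h1 := intervalIntegral.integral_eq_sub_of_hasDerivAt (a := -π) (b := π)
    (fun θ _ => hd θ) (Continuous.intervalIntegrable (by
      have := hv.continuous_fderiv (by simp)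
      exact (this.comp (continuous_circleMap 0 t)).clm_apply
        ((continuous_circleMap 0 t).mul continuous_const)) _ _)
  have hper : circleMap 0 t π = circleMap 0 t (-π) := by
    have := periodic_circleMap 0 t (-π)
    rw [← this]
    congr 1
    ring
  rw [hper, sub_self] at h1
  have h2 (θ : ℝ) : fderiv ℝ v (circleMap 0 t θ) (circleMap 0 t θ * Complex.I) =
      t • fderiv ℝ v (circleMap 0 t θ) (Complex.I * Complex.exp (θ * Complex.I)) := by
    rw [← map_smul]
    congr 1
    simp [circleMap]
    ring
  simp only [h2] at h1
  rw [intervalIntegral.integral_smul, smul_eq_zero] at h1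
  exact h1.resolve_left ht

lemma norm_le_circle_add {v : ℂ → ℂ} (hv : ContDiff ℝ 1 v) {r : ℝ} (hr : 0 ≤ r) :
    2 * π * ‖v 0‖ ≤ (∫ θ in (-π)..π, ‖v (circleMap 0 r θ)‖) +
      2 * ∫ t in (0 : ℝ)..r, ∫ θ in (-π)..π, ‖dbar v (circleMap 0 t θ)‖ := by
  have hvf := hv.continuous_fderiv (by simp)
  have hcm := continuous_circleMap_uncurry
  have hK : Continuous (Function.uncurry fun t θ : ℝ =>
      fderiv ℝ v (circleMap 0 t θ) (Complex.exp (θ * Complex.I))) :=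
    (hvf.comp hcm).clm_apply (by fun_prop)
  have hdb : Continuous (dbar v) :=
    ((hvf.clm_apply continuous_const).add
      (continuous_const.mul (hvf.clm_apply continuous_const))).div_const 2
  have h1 (θ : ℝ) : v (circleMap 0 r θ) - v 0 = ∫ t in (0 : ℝ)..r,
      fderiv ℝ v (circleMap 0 t θ) (Complex.exp (θ * Complex.I)) := by
    rw [intervalIntegral.integral_eq_sub_of_hasDerivAt (f := fun t => v (circleMap 0 t θ))]
    · simp [circleMap]
    · exact fun t _ => ((hv.differentiable (by simp) _).hasFDerivAt).comp_hasDerivAt t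
        (hasDerivAt_circleMap_radius t θ)
    · exact (hK.comp (continuous_id.prodMk continuous_const)).intervalIntegrable _ _
  have hpi : (-π : ℝ) ≤ π := by linarith [Real.pi_pos]
  have h2 : (∫ θ in (-π)..π, v (circleMap 0 r θ)) - (2 * π) • v 0 = ∫ t in (0 : ℝ)..r,
      ∫ θ in (-π)..π, fderiv ℝ v (circleMap 0 t θ) (Complex.exp (θ * Complex.I)) := by
    have h3 : (2 * π) • v 0 = ∫ θ in (-π)..π, v 0 := by
      rw [intervalIntegral.integral_const]
      congr 1
      ring
    rw [h3, ← intervalIntegral.integral_sub (f := fun θ => v (circleMap 0 r θ)) (g := fun _ => v 0)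
      ((hv.continuous.comp (continuous_circleMap 0 r)).intervalIntegrable _ _)
      (by simp)]
    simp only [h1]
    simp only [intervalIntegral.integral_of_le hpi]
    rw [intervalIntegral_integral_swap]
    exact integrable_uncurry_restrict hK Set.Ioc_subset_Icc_self isCompact_Icc 0 r
  have h4 (t : ℝ) (ht : t ≠ 0) :
      ‖∫ θ in (-π)..π, fderiv ℝ v (circleMap 0 t θ) (Complex.exp (θ * Complex.I))‖ ≤
      2 * ∫ θ in (-π)..π, ‖dbar v (circleMap 0 t θ)‖ := by
    have hc1 : Continuous fun θ : ℝ =>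
        fderiv ℝ v (circleMap 0 t θ) (Complex.exp (θ * Complex.I)) :=
      (hvf.comp (continuous_circleMap 0 t)).clm_apply (by fun_prop)
    have hc2 : Continuous fun θ : ℝ => Complex.I *
        fderiv ℝ v (circleMap 0 t θ) (Complex.I * Complex.exp (θ * Complex.I)) :=
      continuous_const.mul ((hvf.comp (continuous_circleMap 0 t)).clm_apply (by fun_prop))
    have h5 := intervalIntegral.integral_add (hc1.intervalIntegrable (-π) π)
      (hc2.intervalIntegrable (μ := volume) (-π) π)
    rw [intervalIntegral.integral_const_mul, integral_fderiv_circle hv ht, mul_zero, add_zero] at h5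
    simp only [fderiv_circle_eq] at h5
    rw [← h5, ← intervalIntegral.integral_const_mul]
    refine (intervalIntegral.norm_integral_le_integral_norm hpi).trans_eq ?_
    congr 1
    ext θ
    rw [norm_mul, norm_mul, ← neg_mul, ← Complex.ofReal_neg, Complex.norm_exp_ofReal_mul_I]
    simp
  have hD : Continuous fun t : ℝ => ∫ θ in (-π)..π, ‖dbar v (circleMap 0 t θ)‖ :=
    intervalIntegral.continuous_parametric_intervalIntegral_of_continuous'
      (f := fun t θ => ‖dbar v (circleMap 0 t θ)‖) (hdb.comp hcm).norm _ _
  have h6 : ‖∫ t in (0 : ℝ)..r,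
      ∫ θ in (-π)..π, fderiv ℝ v (circleMap 0 t θ) (Complex.exp (θ * Complex.I))‖ ≤
      ∫ t in (0 : ℝ)..r, 2 * ∫ θ in (-π)..π, ‖dbar v (circleMap 0 t θ)‖ := by
    refine intervalIntegral.norm_integral_le_of_norm_le hr ?_
      ((continuous_const.mul hD).intervalIntegrable _ _)
    exact Filter.Eventually.of_forall fun t ht => h4 t ht.1.ne'
  rw [intervalIntegral.integral_const_mul, ← h2] at h6
  have h7 : ‖(2 * π) • v 0‖ = 2 * π * ‖v 0‖ := by
    rw [norm_smul, Real.norm_of_nonneg (by positivity)]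
  have h8 := intervalIntegral.norm_integral_le_integral_norm (μ := volume)
    (f := fun θ => v (circleMap 0 r θ)) hpi
  have h9 := norm_sub_norm_le ((2 * π) • v 0) (∫ θ in (-π)..π, v (circleMap 0 r θ))
  rw [norm_sub_rev] at h9
  linarith

/-- Cauchy–Schwarz on an interval. -/
lemma sq_intervalIntegral_le {g : ℝ → ℝ} (hg : Continuous g) {a b : ℝ} (hab : a ≤ b) :
    (∫ x in a..b, g x) ^ 2 ≤ (b - a) * ∫ x in a..b, g x ^ 2 := by
  rcases hab.eq_or_lt with rfl | hlt
  · simp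
  set m := ∫ x in a..b, g x with hm
  have h1 : 0 ≤ ∫ x in a..b, ((b - a) * g x - m) ^ 2 :=
    intervalIntegral.integral_nonneg hab fun x _ => sq_nonneg _
  have h2 : ∫ x in a..b, ((b - a) * g x - m) ^ 2 =
      (b - a) ^ 2 * (∫ x in a..b, g x ^ 2) - 2 * (b - a) * m * m + m ^ 2 * (b - a) := by
    have h3 : ∀ x, ((b - a) * g x - m) ^ 2 =
        (b - a) ^ 2 * g x ^ 2 - 2 * (b - a) * m * g x + m ^ 2 := fun x => by ring
    simp only [h3]
    rw [intervalIntegral.integral_add, intervalIntegral.integral_sub,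
      intervalIntegral.integral_const_mul, intervalIntegral.integral_const_mul,
      intervalIntegral.integral_const, ← hm, smul_eq_mul]
    · ring
    all_goals exact Continuous.intervalIntegrable (by fun_prop) _ _
  rw [h2] at h1
  have h4 : 0 < b - a := sub_pos.2 hlt
  have h5 : 0 ≤ (b - a) * ((b - a) * (∫ x in a..b, g x ^ 2) - m ^ 2) := by nlinarith
  linarith [nonneg_of_mul_nonneg_right h5 h4]

end MeanValue

section MeanValueSq

lemma normSq_le_circle_add {v : ℂ → ℂ} (hv : ContDiff ℝ 1 v) {r ρ δ : ℝ} (hr : 0 ≤ r)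
    (hrρ : r ≤ ρ) (hδ : 0 < δ) :
    ‖v 0‖ ^ 2 ≤ (1 + δ) / (2 * π) * (∫ θ in (-π)..π, ‖v (circleMap 0 r θ)‖ ^ 2) +
      (1 + 1 / δ) * (2 * ρ / π) *
        ∫ t in (0 : ℝ)..ρ, ∫ θ in (-π)..π, ‖dbar v (circleMap 0 t θ)‖ ^ 2 := by
  have hpi : (-π : ℝ) ≤ π := by linarith [Real.pi_pos]
  have hvf := hv.continuous_fderiv (by simp)
  have hcm := continuous_circleMap_uncurry
  have hdb : Continuous (dbar v) :=
    ((hvf.clm_apply continuous_const).add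
      (continuous_const.mul (hvf.clm_apply continuous_const))).div_const 2
  have hD : Continuous fun t : ℝ => ∫ θ in (-π)..π, ‖dbar v (circleMap 0 t θ)‖ :=
    intervalIntegral.continuous_parametric_intervalIntegral_of_continuous'
      (f := fun t θ => ‖dbar v (circleMap 0 t θ)‖) (hdb.comp hcm).norm _ _
  have hD2 : Continuous fun t : ℝ => ∫ θ in (-π)..π, ‖dbar v (circleMap 0 t θ)‖ ^ 2 :=
    intervalIntegral.continuous_parametric_intervalIntegral_of_continuous'
      (f := fun t θ => ‖dbar v (circleMap 0 t θ)‖ ^ 2) ((continuous_pow 2).comp (hdb.comp hcm).norm) _ _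
  have h0 := norm_le_circle_add hv hr
  set a := ∫ θ in (-π)..π, ‖v (circleMap 0 r θ)‖
  set d := ∫ t in (0 : ℝ)..r, ∫ θ in (-π)..π, ‖dbar v (circleMap 0 t θ)‖
  set A := ∫ θ in (-π)..π, ‖v (circleMap 0 r θ)‖ ^ 2
  set D := ∫ t in (0 : ℝ)..ρ, ∫ θ in (-π)..π, ‖dbar v (circleMap 0 t θ)‖ ^ 2
  have ha : a ^ 2 ≤ 2 * π * A := by
    have := sq_intervalIntegral_le
      ((hv.continuous.comp (continuous_circleMap 0 r)).norm) hpi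
    simpa [show π - -π = 2 * π by ring] using this
  have hd : d ^ 2 ≤ 2 * π * ρ * D := by
    have h1 : d ^ 2 ≤ r * ∫ t in (0 : ℝ)..r, (∫ θ in (-π)..π, ‖dbar v (circleMap 0 t θ)‖) ^ 2 := by
      simpa using sq_intervalIntegral_le hD hr
    have h2 : ∫ t in (0 : ℝ)..r, (∫ θ in (-π)..π, ‖dbar v (circleMap 0 t θ)‖) ^ 2 ≤
        ∫ t in (0 : ℝ)..r, 2 * π * ∫ θ in (-π)..π, ‖dbar v (circleMap 0 t θ)‖ ^ 2 := by
      refine intervalIntegral.integral_mono_on hr ((hD.pow 2).intervalIntegrable _ _)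
        ((continuous_const.mul hD2).intervalIntegrable _ _) fun t _ => ?_
      have := sq_intervalIntegral_le
        ((hdb.comp (continuous_circleMap 0 t)).norm) hpi
      simpa [show π - -π = 2 * π by ring] using this
    rw [intervalIntegral.integral_const_mul] at h2
    have h3 : ∫ t in (0 : ℝ)..r, ∫ θ in (-π)..π, ‖dbar v (circleMap 0 t θ)‖ ^ 2 ≤ D := by
      refine intervalIntegral.integral_mono_interval le_rfl hr hrρ ?_
        (hD2.intervalIntegrable _ _)
      exact Filter.Eventually.of_forall fun t =>
        intervalIntegral.integral_nonneg hpi fun θ _ => sq_nonneg _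
    have h4 : 0 ≤ ∫ t in (0 : ℝ)..r, ∫ θ in (-π)..π, ‖dbar v (circleMap 0 t θ)‖ ^ 2 :=
      intervalIntegral.integral_nonneg hr fun t _ =>
        intervalIntegral.integral_nonneg hpi fun θ _ => sq_nonneg _
    calc d ^ 2 ≤ r * (2 * π * D) := by
          refine h1.trans (mul_le_mul_of_nonneg_left (h2.trans ?_) hr)
          exact mul_le_mul_of_nonneg_left h3 (by positivity)
      _ ≤ ρ * (2 * π * D) := by
          have hD0 : 0 ≤ D := h4.trans h3
          exact mul_le_mul_of_nonneg_right hrρ (by positivity)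
      _ = _ := by ring
  have h1 : (2 * π * ‖v 0‖) ^ 2 ≤ (a + 2 * d) ^ 2 := pow_le_pow_left₀ (by positivity) h0 2
  have h2 : (a + 2 * d) ^ 2 ≤ (1 + δ) * a ^ 2 + (1 + 1 / δ) * (4 * d ^ 2) := by
    have h3 : (1 + δ) * a ^ 2 + (1 + 1 / δ) * (4 * d ^ 2) - (a + 2 * d) ^ 2 =
        (δ * a - 2 * d) ^ 2 / δ := by
      field_simp
      ring
    have : 0 ≤ (δ * a - 2 * d) ^ 2 / δ := by positivity
    linarith
  have h3 : (1 + δ) * a ^ 2 ≤ (1 + δ) * (2 * π * A) :=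
    mul_le_mul_of_nonneg_left ha (by positivity)
  have h4 : (1 + 1 / δ) * (4 * d ^ 2) ≤ (1 + 1 / δ) * (4 * (2 * π * ρ * D)) :=
    mul_le_mul_of_nonneg_left (by linarith) (by positivity)
  have h5 : 4 * π ^ 2 * ‖v 0‖ ^ 2 ≤ 4 * π ^ 2 * ((1 + δ) / (2 * π) * A +
      (1 + 1 / δ) * (2 * ρ / π) * D) := by
    have : 4 * π ^ 2 * ((1 + δ) / (2 * π) * A + (1 + 1 / δ) * (2 * ρ / π) * D) =
        (1 + δ) * (2 * π * A) + (1 + 1 / δ) * (4 * (2 * π * ρ * D)) := by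
      field_simp
      ring
    rw [this]
    nlinarith
  exact le_of_mul_le_mul_left h5 (by positivity)

/-- Integration over a disc in polar coordinates. -/
lemma integral_polar_closedBall {G : ℂ → ℝ} (hG : Continuous G) {ρ : ℝ} (hρ : 0 ≤ ρ) :
    ∫ r in (0 : ℝ)..ρ, r * ∫ θ in (-π)..π, G (circleMap 0 r θ) =
      ∫ x in Metric.closedBall 0 ρ, G x := by
  have hpi : (-π : ℝ) ≤ π := by linarith [Real.pi_pos]
  rw [← integral_indicator Metric.isClosed_closedBall.measurableSet,
    ← Complex.integral_comp_polarCoord_symm]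
  have h1 : ∀ p ∈ polarCoord.target,
      p.1 • (Metric.closedBall (0 : ℂ) ρ).indicator G (Complex.polarCoord.symm p) =
      (Set.Ioc 0 ρ ×ˢ Set.Ioo (-π) π).indicator
        (fun p : ℝ × ℝ => p.1 * G (circleMap 0 p.1 p.2)) p := by
    rintro ⟨r, θ⟩ ⟨hr, hθ⟩
    have hr' : 0 < r := hr
    have hs : Complex.polarCoord.symm (r, θ) = circleMap 0 r θ := by
      rw [Complex.polarCoord_symm_apply, circleMap, zero_add, Complex.exp_mul_I]
      simp
    rw [hs, smul_eq_mul]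
    by_cases h : r ≤ ρ
    · rw [Set.indicator_of_mem, Set.indicator_of_mem]
      · exact ⟨⟨hr', h⟩, hθ⟩
      · simp [abs_of_pos hr', h]
    · rw [Set.indicator_of_notMem, Set.indicator_of_notMem, mul_zero]
      · exact fun h' => h h'.1.2
      · simp [abs_of_pos hr', h]
  have hms : MeasurableSet (Set.Ioc 0 ρ ×ˢ Set.Ioo (-π) π : Set (ℝ × ℝ)) :=
    measurableSet_Ioc.prod measurableSet_Ioo
  rw [setIntegral_congr_fun polarCoord.open_target.measurableSet h1,
    setIntegral_indicator hms]
  have h2 : polarCoord.target ∩ Set.Ioc 0 ρ ×ˢ Set.Ioo (-π) π =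
      Set.Ioc 0 ρ ×ˢ Set.Ioo (-π) π := by
    refine Set.inter_eq_right.2 ?_
    rintro ⟨r, θ⟩ ⟨hr, hθ⟩
    exact ⟨hr.1, hθ⟩
  have hc : Continuous fun p : ℝ × ℝ => p.1 * G (circleMap 0 p.1 p.2) :=
    continuous_fst.mul (hG.comp continuous_circleMap_uncurry)
  rw [h2, Measure.volume_eq_prod, setIntegral_prod]
  · rw [intervalIntegral.integral_of_le hρ]
    refine setIntegral_congr_fun measurableSet_Ioc fun r _ => ?_
    simp only
    rw [integral_const_mul, intervalIntegral.integral_of_le hpi, integral_Ioc_eq_integral_Ioo]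
  · exact (hc.continuousOn.integrableOn_compact (isCompact_Icc.prod isCompact_Icc)).mono_set
      (Set.prod_mono Set.Ioc_subset_Icc_self Set.Ioo_subset_Icc_self)

lemma integral_mul_exp_neg_sq {α : ℝ} (hα : 0 < α) (ρ : ℝ) :
    ∫ r in (0 : ℝ)..ρ, r * Real.exp (-α * r ^ 2) = (1 - Real.exp (-α * ρ ^ 2)) / (2 * α) := by
  rw [intervalIntegral.integral_eq_sub_of_hasDerivAt
    (f := fun r => -Real.exp (-α * r ^ 2) / (2 * α))]
  · simp
    ring
  · intro r _
    have h1 : HasDerivAt (fun r : ℝ => -α * r ^ 2) (-α * (2 * r)) r := by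
      simpa using (hasDerivAt_pow 2 r).const_mul (-α)
    have h2 := (h1.exp.neg).div_const (2 * α)
    have h3 : r * Real.exp (-α * r ^ 2) =
        -(Real.exp (-α * r ^ 2) * (-α * (2 * r))) / (2 * α) := by field_simp
    rw [h3]
    exact h2
  · exact Continuous.intervalIntegrable (by fun_prop) _ _

/-- A weighted mean value inequality on the disc of radius `ρ`. -/
lemma normSq_le_disc_add {v : ℂ → ℂ} (hv : ContDiff ℝ 1 v) {ρ δ α : ℝ} (hρ : 0 < ρ)
    (hδ : 0 < δ) (hα : 0 < α) :
    ‖v 0‖ ^ 2 ≤ (1 + δ) / π * (α + 1 / ρ ^ 2) *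
        (∫ x in Metric.closedBall 0 ρ, ‖v x‖ ^ 2 * Real.exp (-α * ‖x‖ ^ 2)) +
      (1 + 1 / δ) * (2 * ρ / π) *
        ∫ t in (0 : ℝ)..ρ, ∫ θ in (-π)..π, ‖dbar v (circleMap 0 t θ)‖ ^ 2 := by
  have hpi : (-π : ℝ) ≤ π := by linarith [Real.pi_pos]
  have hcm := continuous_circleMap_uncurry
  have hG : Continuous fun x => ‖v x‖ ^ 2 * Real.exp (-α * ‖x‖ ^ 2) := by
    have := hv.continuous
    fun_prop
  set T := (1 + 1 / δ) * (2 * ρ / π) *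
        ∫ t in (0 : ℝ)..ρ, ∫ θ in (-π)..π, ‖dbar v (circleMap 0 t θ)‖ ^ 2 with hT
  have hT0 : 0 ≤ T := by
    have : 0 ≤ ∫ t in (0 : ℝ)..ρ, ∫ θ in (-π)..π, ‖dbar v (circleMap 0 t θ)‖ ^ 2 :=
      intervalIntegral.integral_nonneg hρ.le fun t _ =>
        intervalIntegral.integral_nonneg hpi fun θ _ => sq_nonneg _
    positivity
  set J := ∫ x in Metric.closedBall 0 ρ, ‖v x‖ ^ 2 * Real.exp (-α * ‖x‖ ^ 2) with hJ
  have hJ0 : 0 ≤ J := integral_nonneg fun x => by positivity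
  have h1 : ∫ r in (0 : ℝ)..ρ, r * Real.exp (-α * r ^ 2) * (‖v 0‖ ^ 2 - T) ≤
      ∫ r in (0 : ℝ)..ρ, (1 + δ) / (2 * π) *
        (r * ∫ θ in (-π)..π, ‖v (circleMap 0 r θ)‖ ^ 2 *
          Real.exp (-α * ‖circleMap 0 r θ‖ ^ 2)) := by
    refine intervalIntegral.integral_mono_on hρ.le
      (Continuous.intervalIntegrable (by fun_prop) _ _)
      (Continuous.intervalIntegrable ?_ _ _) fun r hr => ?_
    · refine continuous_const.mul (continuous_id.mul ?_)
      exact intervalIntegral.continuous_parametric_intervalIntegral_of_continuous'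
        (f := fun t θ => ‖v (circleMap 0 t θ)‖ ^ 2 * Real.exp (-α * ‖circleMap 0 t θ‖ ^ 2))
        (hG.comp hcm) _ _
    · have h2 := normSq_le_circle_add hv hr.1 hr.2 hδ
      rw [← hT] at h2
      simp only [norm_circleMap_zero, sq_abs]
      rw [intervalIntegral.integral_mul_const]
      have h3 : 0 ≤ r * Real.exp (-α * r ^ 2) := mul_nonneg hr.1 (Real.exp_pos _).le
      calc r * Real.exp (-α * r ^ 2) * (‖v 0‖ ^ 2 - T)
          ≤ r * Real.exp (-α * r ^ 2) *
            ((1 + δ) / (2 * π) * (∫ θ in (-π)..π, ‖v (circleMap 0 r θ)‖ ^ 2)) :=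
            mul_le_mul_of_nonneg_left (by linarith) h3
        _ = _ := by ring
  rw [intervalIntegral.integral_mul_const, integral_mul_exp_neg_sq hα,
    intervalIntegral.integral_const_mul, integral_polar_closedBall hG hρ.le, ← hJ] at h1
  by_cases hneg : ‖v 0‖ ^ 2 - T ≤ 0
  · have : 0 ≤ (1 + δ) / π * (α + 1 / ρ ^ 2) * J := by positivity
    linarith
  push Not at hneg
  set y := α * ρ ^ 2 with hy
  have hy0 : 0 < y := by positivity
  have h4 : y / (1 + y) ≤ 1 - Real.exp (-α * ρ ^ 2) := by
    have h5 : Real.exp (-α * ρ ^ 2) = (Real.exp y)⁻¹ := by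
      rw [← Real.exp_neg]
      congr 1
      rw [hy]
      ring
    have h6 : (Real.exp y)⁻¹ ≤ (1 + y)⁻¹ :=
      inv_anti₀ (by positivity) (by linarith [Real.add_one_le_exp y])
    have h7 : y / (1 + y) = 1 - (1 + y)⁻¹ := by
      field_simp
      ring
    rw [h5, h7]
    linarith
  have h8 : y / (1 + y) / (2 * α) * (‖v 0‖ ^ 2 - T) ≤ (1 + δ) / (2 * π) * J :=
    (mul_le_mul_of_nonneg_right (div_le_div_of_nonneg_right h4 (by positivity)) hneg.le).trans h1
  have h9 : (2 * α * (1 + y) / y) * (y / (1 + y) / (2 * α) * (‖v 0‖ ^ 2 - T)) =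
      ‖v 0‖ ^ 2 - T := by
    field_simp
  have h10 := mul_le_mul_of_nonneg_left h8 (show 0 ≤ 2 * α * (1 + y) / y by positivity)
  rw [h9] at h10
  have h11 : 2 * α * (1 + y) / y * ((1 + δ) / (2 * π) * J) =
      (1 + δ) / π * (α + 1 / ρ ^ 2) * J := by
    rw [hy]
    field_simp
    ring
  linarith

end MeanValueSq

section Taylor

/-- Second order Taylor expansion, uniformly in the base point, with the quadratic part split
into a harmonic polynomial and the Laplacian. -/
lemma exists_taylor_of_periodicC {f : ℂ → ℝ} (hp : PeriodicC f) (hf : ContDiff ℝ (⊤ : ℕ∞) f)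
    {ω : ℝ} (hω : 0 < ω) :
    ∃ r₀ > 0, ∀ z, ∃ p q : ℂ, ∀ x : ℂ, ‖x‖ ≤ r₀ →
      |f (z + x) - (((f z : ℂ) + p * x + q * x ^ 2).re + lapC f z * ‖x‖ ^ 2 / 4)| ≤
        ω * ‖x‖ ^ 2 := by
  have hf2 : ContDiff ℝ 2 f := hf.of_le (by norm_cast)
  have hD : ContDiff ℝ 1 (fderiv ℝ f) := hf2.fderiv_right (by norm_num)
  have hDd : Differentiable ℝ (fderiv ℝ f) := hD.differentiable (by simp)
  have hDDc : Continuous (fderiv ℝ (fderiv ℝ f)) := hD.continuous_fderiv (by simp)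
  have hDDp : PeriodicC (fderiv ℝ (fderiv ℝ f)) := hp.fderiv.fderiv
  obtain ⟨r₀, hr₀, hr⟩ := Metric.uniformContinuous_iff.1 (hDDp.uniformContinuous hDDc) ω hω
  refine ⟨r₀ / 2, by positivity, fun z => ?_⟩
  set B := fderiv ℝ (fderiv ℝ f) z with hB
  have hsymm : ∀ x y, B x y = B y x := by
    intro x y
    exact second_derivative_symmetric (f := f) (f' := fderiv ℝ f)
      (fun y => (hf2.differentiable (by simp) y).hasFDerivAt) (hDd z).hasFDerivAt x y
  have hball : ∀ x ∈ Metric.closedBall (0 : ℂ) (r₀ / 2),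
      ‖fderiv ℝ f (z + x) - fderiv ℝ f z - B x‖ ≤ ω * ‖x‖ := by
    intro x hx
    have := (convex_closedBall z (r₀ / 2)).norm_image_sub_le_of_norm_fderiv_le' (𝕜 := ℝ)
      (f := fderiv ℝ f) (C := ω) (φ := B) (x := z) (y := z + x) (fun y _ => hDd y) (fun y hy => ?_)
      (Metric.mem_closedBall_self (by positivity)) (by simpa using hx)
    · simpa using this
    · have := hr (a := y) (b := z) (lt_of_le_of_lt hy (by linarith))
      rw [dist_eq_norm] at this
      exact this.le
  have hquad : ∀ x, HasFDerivAt (fun x => f (z + x) - f z - fderiv ℝ f z x - B x x / 2)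
      (fderiv ℝ f (z + x) - fderiv ℝ f z - B x) x := by
    intro x
    have h1 : HasFDerivAt (fun x => f (z + x)) (fderiv ℝ f (z + x)) x := by
      have := ((hf2.differentiable (by simp) (z + x)).hasFDerivAt).comp x
        ((hasFDerivAt_id x).const_add z)
      rw [ContinuousLinearMap.comp_id] at this
      exact this
    have h2 : HasFDerivAt (fun x => B x x) (B x + B.flip x) x := by
      have := B.hasFDerivAt_of_bilinear (hasFDerivAt_id x) (hasFDerivAt_id x)
      have e : B x + B.flip x = B.precompR ℂ (id x) (ContinuousLinearMap.id ℝ ℂ) +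
          B.precompL ℂ (ContinuousLinearMap.id ℝ ℂ) (id x) := by
        ext; simp
      rw [e]
      exact this
    have h3 := ((h1.sub_const (f z)).sub (fderiv ℝ f z).hasFDerivAt).sub
      (h2.const_mul (1 / 2 : ℝ))
    have e1 : fderiv ℝ f (z + x) - fderiv ℝ f z - (1 / 2 : ℝ) • (B x + B.flip x) =
        fderiv ℝ f (z + x) - fderiv ℝ f z - B x := by
      ext y
      simp [hsymm y x]
      ring
    rw [e1] at h3
    refine h3.congr_of_eventuallyEq (Filter.Eventually.of_forall fun y => ?_)
    simp
    ring
  set a := fderiv ℝ f z 1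
  set b := fderiv ℝ f z Complex.I
  refine ⟨⟨a, -b⟩, ⟨(B 1 1 - B Complex.I Complex.I) / 4, - B 1 Complex.I / 2⟩, fun x hx => ?_⟩
  have hx' : x ∈ Metric.closedBall (0 : ℂ) ‖x‖ := by simp
  have h1 := (convex_closedBall (0 : ℂ) ‖x‖).norm_image_sub_le_of_norm_hasFDerivWithin_le
    (𝕜 := ℝ) (C := ω * ‖x‖) (x := 0) (y := x) (fun y _ => (hquad y).hasFDerivWithinAt)
    (fun y hy => by
      have hy' : ‖y‖ ≤ ‖x‖ := by simpa using hy
      exact (hball y (by simpa using hy'.trans hx)).trans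
        (mul_le_mul_of_nonneg_left hy' hω.le)) (by simp) hx'
  have e2 : x = x.re • (1 : ℂ) + x.im • Complex.I := by simp
  have e3 : fderiv ℝ f z x = x.re * a + x.im * b := by
    conv_lhs => rw [e2]
    rw [map_add, map_smul, map_smul]
    simp [a, b]
  have e4 : B x x = x.re ^ 2 * B 1 1 + 2 * x.re * x.im * B 1 Complex.I +
      x.im ^ 2 * B Complex.I Complex.I := by
    conv_lhs => rw [e2]
    simp only [map_add, map_smul, add_apply, smul_apply,
      smul_eq_mul]
    rw [hsymm Complex.I 1]
    ring
  have e5 : lapC f z = B 1 1 + B Complex.I Complex.I := by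
    rw [lapC, fderiv_fderiv_apply hf2.contDiffAt, fderiv_fderiv_apply hf2.contDiffAt]
  have e6 : ‖x‖ ^ 2 = x.re ^ 2 + x.im ^ 2 := by
    rw [← Complex.normSq_eq_norm_sq, Complex.normSq_apply]
    ring
  simp only [add_zero, sub_self, map_zero, zero_div, sub_zero,
    Real.norm_eq_abs] at h1
  rw [e3, e4] at h1
  have e7 : f (z + x) - (((f z : ℂ) + (⟨a, -b⟩ : ℂ) * x +
      (⟨(B 1 1 - B Complex.I Complex.I) / 4, - B 1 Complex.I / 2⟩ : ℂ) * x ^ 2).re +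
        lapC f z * ‖x‖ ^ 2 / 4) = f (z + x) - f z - (x.re * a + x.im * b) -
      (x.re ^ 2 * B 1 1 + 2 * x.re * x.im * B 1 Complex.I +
      x.im ^ 2 * B Complex.I Complex.I) / 2 := by
    rw [e5, e6]
    simp [pow_two]
    ring
  rw [e7]
  refine h1.trans_eq ?_
  ring

lemma dbar_mul_of_differentiable {w e : ℂ → ℂ} {x : ℂ} (hw : DifferentiableAt ℝ w x)
    (he : DifferentiableAt ℂ e x) : dbar (fun y => w y * e y) x = dbar w x * e x := by
  have h1 : HasFDerivAt e ((fderiv ℂ e x).restrictScalars ℝ) x :=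
    he.hasFDerivAt.restrictScalars ℝ
  have h2 := (hw.hasFDerivAt.mul h1).fderiv
  have h3 : fderiv ℂ e x Complex.I = Complex.I * fderiv ℂ e x 1 := by
    rw [← smul_eq_mul, ← map_smul]
    simp
  have h4 : fderiv ℝ (fun y => w y * e y) x = w x • (fderiv ℂ e x).restrictScalars ℝ +
      e x • fderiv ℝ w x := h2
  rw [dbar, h4, dbar]
  simp only [add_apply, smul_apply,
    ContinuousLinearMap.coe_restrictScalars', smul_eq_mul, h3]
  linear_combination (w x * fderiv ℂ e x 1 / 2) * Complex.I_mul_I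

lemma dbar_comp_const_add (w : ℂ → ℂ) (z x : ℂ) :
    dbar (fun y => w (z + y)) x = dbar w (z + x) := by
  simp only [dbar, fderiv_comp_add_left]

end Taylor

section Pointwise

lemma continuous_wInt_integrand {f : ℂ → ℝ} {u : ℂ → ℂ} (hf : Continuous f) (hu : Continuous u)
    (h : ℝ) : Continuous fun z => ‖u z‖ ^ 2 * Real.exp (-2 * f z / h) := by
  fun_prop

lemma PeriodicC.wInt_integrand {f : ℂ → ℝ} {u : ℂ → ℂ} (hf : PeriodicC f) (hu : PeriodicC u)
    (h : ℝ) : PeriodicC fun z => ‖u z‖ ^ 2 * Real.exp (-2 * f z / h) :=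
  hu.comp₂ hf fun a b => ‖a‖ ^ 2 * Real.exp (-2 * b / h)

lemma wInt_nonneg (f : ℂ → ℝ) (h : ℝ) (u : ℂ → ℂ) : 0 ≤ wInt f h u :=
  integral_nonneg fun z => by positivity

lemma wInt_const_mul (f : ℂ → ℝ) (h : ℝ) (a : ℂ) (u : ℂ → ℂ) :
    wInt f h (fun z => a * u z) = ‖a‖ ^ 2 * wInt f h u := by
  simp only [wInt, norm_mul, mul_pow, mul_assoc]
  rw [integral_const_mul]

lemma ball_ae_eq_closedBall (z : ℂ) (r : ℝ) :
    Metric.ball z r =ᵐ[volume] Metric.closedBall z r := by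
  refine (ae_le_set.2 ?_).antisymm (ae_le_set.2 ?_)
  · rw [Set.sdiff_eq_empty.2 Metric.ball_subset_closedBall, measure_empty]
  · rw [Metric.closedBall_sdiff_ball]
    exact Measure.addHaar_sphere _ _ _

/-- Pointwise bound of a smooth periodic function by its weighted norm and its `∂̄`. -/
lemma normSq_mul_exp_le {f : ℂ → ℝ} (hp : PeriodicC f) (hf : Continuous f) {z p q : ℂ}
    {ω ρ b δ h : ℝ} (hρ : 0 < ρ) (hρπ : ρ ≤ π) (hω : 0 ≤ ω) (hb : 0 < b) (hfb : lapC f z ≤ b)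
    (hδ : 0 < δ) (hh : 0 < h)
    (hT : ∀ x : ℂ, ‖x‖ ≤ ρ →
      |f (z + x) - (((f z : ℂ) + p * x + q * x ^ 2).re + lapC f z * ‖x‖ ^ 2 / 4)| ≤ ω * ‖x‖ ^ 2)
    {w : ℂ → ℂ} (hw : ContDiff ℝ (⊤ : ℕ∞) w) (hwp : PeriodicC w) :
    ‖w z‖ ^ 2 * Real.exp (-2 * f z / h) ≤
      (1 + δ) / π * (b / (2 * h) + 1 / ρ ^ 2) * Real.exp (2 * ω * ρ ^ 2 / h) * wInt f h w +
      (1 + 1 / δ) * (2 * ρ / π) * Real.exp ((b / 2 + 2 * ω) * ρ ^ 2 / h) *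
        ∫ t in (0 : ℝ)..ρ, ∫ θ in (-π)..π, ‖dbar w (z + circleMap 0 t θ)‖ ^ 2 *
          Real.exp (-2 * f (z + circleMap 0 t θ) / h) := by
  have hpi : (-π : ℝ) ≤ π := by linarith [Real.pi_pos]
  have hcm := continuous_circleMap_uncurry
  set F : ℂ → ℂ := fun x => (f z : ℂ) + p * x + q * x ^ 2 with hF
  set e : ℂ → ℂ := fun x => Complex.exp (-F x / h) with he
  have hec : ContDiff ℂ 1 e := by
    rw [he, hF]
    fun_prop
  have hwc : ContDiff ℝ 1 fun x => w (z + x) :=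
    (hw.of_le (by norm_cast)).comp (contDiff_const.add contDiff_id)
  have hdw : Continuous (dbar w) := (ContDiff.dbar hw).continuous
  have hv : ContDiff ℝ 1 fun x => w (z + x) * e x := hwc.mul (hec.restrict_scalars ℝ)
  have hne (x : ℂ) : ‖e x‖ ^ 2 = Real.exp (-2 * (F x).re / h) := by
    rw [he]
    simp only
    rw [Complex.norm_exp, ← Real.exp_nat_mul]
    congr 1
    have : (-F x / (h : ℂ)).re = -(F x).re / h := by
      rw [Complex.div_ofReal_re, Complex.neg_re]
    rw [this]
    push_cast
    ring
  have hdv (x : ℂ) : dbar (fun x => w (z + x) * e x) x = dbar w (z + x) * e x := by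
    rw [dbar_mul_of_differentiable (w := fun x => w (z + x))
      (hwc.differentiable (by simp) x) (hec.differentiable (by simp) x), dbar_comp_const_add]
  have h0 := normSq_le_disc_add hv hρ hδ (show 0 < b / (2 * h) by positivity)
  have hz : ‖w (z + 0) * e 0‖ ^ 2 = ‖w z‖ ^ 2 * Real.exp (-2 * f z / h) := by
    rw [norm_mul, mul_pow, hne, add_zero]
    simp [hF]
  rw [hz] at h0
  refine h0.trans (add_le_add ?_ ?_)
  · rw [mul_assoc _ (Real.exp _)]
    refine mul_le_mul_of_nonneg_left ?_ (by positivity)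
    have hGc := continuous_wInt_integrand hf hw.continuous h
    have h1 : ∫ x in Metric.closedBall 0 ρ,
        ‖w (z + x) * e x‖ ^ 2 * Real.exp (-(b / (2 * h)) * ‖x‖ ^ 2) ≤
        ∫ x in Metric.closedBall 0 ρ, Real.exp (2 * ω * ρ ^ 2 / h) *
          (‖w (x + z)‖ ^ 2 * Real.exp (-2 * f (x + z) / h)) := by
      refine setIntegral_mono_on
        (ContinuousOn.integrableOn_compact (isCompact_closedBall _ _)
          (Continuous.continuousOn ?_))
        (ContinuousOn.integrableOn_compact (isCompact_closedBall _ _)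
          (Continuous.continuousOn ?_))
        Metric.isClosed_closedBall.measurableSet fun x hx => ?_
      · have := hv.continuous
        fun_prop
      · exact continuous_const.mul (hGc.comp (continuous_add_const z))
      · have hx' : ‖x‖ ≤ ρ := by simpa using hx
        rw [norm_mul, mul_pow, hne, add_comm x z, mul_left_comm, mul_assoc]
        refine mul_le_mul_of_nonneg_left ?_ (by positivity)
        rw [← Real.exp_add, ← Real.exp_add, Real.exp_le_exp]
        have h2 := (abs_le.1 (hT x hx')).2
        have h3 : ‖x‖ ^ 2 ≤ ρ ^ 2 := pow_le_pow_left₀ (norm_nonneg _) hx' 2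
        have h4 : lapC f z * ‖x‖ ^ 2 ≤ b * ‖x‖ ^ 2 :=
          mul_le_mul_of_nonneg_right hfb (by positivity)
        have h5 : ω * ‖x‖ ^ 2 ≤ ω * ρ ^ 2 := mul_le_mul_of_nonneg_left h3 hω
        have h6 : -2 * (F x).re - b * ‖x‖ ^ 2 / 2 ≤ 2 * ω * ρ ^ 2 - 2 * f (z + x) := by
          linarith
        have h7 := div_le_div_of_nonneg_right h6 hh.le
        calc _ = (-2 * (F x).re - b * ‖x‖ ^ 2 / 2) / h := by
              field_simp
              ring
          _ ≤ _ := h7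
          _ = _ := by ring
    refine h1.trans ?_
    rw [integral_const_mul]
    refine mul_le_mul_of_nonneg_left ?_ (by positivity)
    have h8 := (hp.wInt_integrand hwp h).shift z
    have h9 := h8.setIntegral_ball_le (hGc.comp (continuous_add_const z))
      (fun x => by positivity) 0 hρπ
    rw [(hp.wInt_integrand hwp h).setIntegral_shift hGc z] at h9
    rwa [setIntegral_congr_set (ball_ae_eq_closedBall 0 ρ)] at h9
  · rw [mul_assoc _ (Real.exp _)]
    refine mul_le_mul_of_nonneg_left ?_ (by positivity)
    rw [← intervalIntegral.integral_const_mul]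
    have hgc := continuous_wInt_integrand hf hdw h
    have hgc2 : Continuous fun x => ‖dbar w (z + x)‖ ^ 2 * Real.exp (-2 * f (z + x) / h) :=
      hgc.comp (continuous_const_add z)
    have hdvc : Continuous fun x => ‖dbar (fun x => w (z + x) * e x) x‖ ^ 2 := by
      simp only [hdv]
      have := hec.continuous
      fun_prop
    refine intervalIntegral.integral_mono_on hρ.le (Continuous.intervalIntegrable ?_ _ _)
      (Continuous.intervalIntegrable ?_ _ _) fun t ht => ?_
    · exact intervalIntegral.continuous_parametric_intervalIntegral_of_continuous'
        (f := fun t θ => ‖dbar (fun x => w (z + x) * e x) (circleMap 0 t θ)‖ ^ 2)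
        (hdvc.comp hcm) _ _
    · exact continuous_const.mul
        (intervalIntegral.continuous_parametric_intervalIntegral_of_continuous'
        (f := fun t θ => ‖dbar w (z + circleMap 0 t θ)‖ ^ 2 *
          Real.exp (-2 * f (z + circleMap 0 t θ) / h)) (hgc2.comp hcm) _ _)
    rw [← intervalIntegral.integral_const_mul]
    refine intervalIntegral.integral_mono_on hpi
      ((hdvc.comp (continuous_circleMap 0 t)).intervalIntegrable _ _)
      ((continuous_const.mul (hgc2.comp (continuous_circleMap 0 t))).intervalIntegrable _ _)
      fun θ _ => ?_
    have hx' : ‖circleMap 0 t θ‖ ≤ ρ := by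
      rw [norm_circleMap_zero, abs_of_nonneg ht.1]
      exact ht.2
    set x := circleMap 0 t θ
    rw [hdv, norm_mul, mul_pow, hne, mul_left_comm]
    refine mul_le_mul_of_nonneg_left ?_ (by positivity)
    rw [← Real.exp_add, Real.exp_le_exp]
    have h2 := (abs_le.1 (hT x hx')).2
    have h3 : ‖x‖ ^ 2 ≤ ρ ^ 2 := pow_le_pow_left₀ (norm_nonneg _) hx' 2
    have h4 : lapC f z * ‖x‖ ^ 2 ≤ b * ‖x‖ ^ 2 :=
      mul_le_mul_of_nonneg_right hfb (by positivity)
    have h5 : ω * ‖x‖ ^ 2 ≤ ω * ρ ^ 2 := mul_le_mul_of_nonneg_left h3 hω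
    have h5' : b * ‖x‖ ^ 2 ≤ b * ρ ^ 2 := mul_le_mul_of_nonneg_left h3 hb.le
    have h6 : -2 * (F x).re ≤ (b / 2 + 2 * ω) * ρ ^ 2 - 2 * f (z + x) := by
      linarith
    have h7 := div_le_div_of_nonneg_right h6 hh.le
    refine h7.trans_eq ?_
    ring

lemma PeriodicC.setIntegral_circle {G : ℂ → ℝ} (hp : PeriodicC G) (hG : Continuous G) (ρ : ℝ) :
    ∫ z in Efd, (∫ t in (0 : ℝ)..ρ, ∫ θ in (-π)..π, G (z + circleMap 0 t θ)) =
      2 * π * ρ * ∫ z in Efd, G z := by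
  have hcm := continuous_circleMap_uncurry
  have hsub := Efd_subset_closedBall
  have hc1 : Continuous fun p : ℝ × ℂ => ∫ θ in (-π)..π, G (p.2 + circleMap 0 p.1 θ) := by
    refine intervalIntegral.continuous_parametric_intervalIntegral_of_continuous'
      (f := fun (p : ℝ × ℂ) θ => G (p.2 + circleMap 0 p.1 θ)) ?_ _ _
    refine hG.comp ?_
    exact (continuous_snd.comp continuous_fst).add
      (hcm.comp ((continuous_fst.comp continuous_fst).prodMk continuous_snd))
  rw [← intervalIntegral_integral_swap (f := fun t z => ∫ θ in (-π)..π, G (z + circleMap 0 t θ))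
    (integrable_uncurry_restrict hc1 hsub (isCompact_closedBall _ _) 0 ρ)]
  have h2 (t : ℝ) : ∫ z in Efd, (∫ θ in (-π)..π, G (z + circleMap 0 t θ)) =
      2 * π * ∫ z in Efd, G z := by
    rw [← intervalIntegral_integral_swap (f := fun θ z => G (z + circleMap 0 t θ))
      (integrable_uncurry_restrict (K := fun θ z => G (z + circleMap 0 t θ))
        (hG.comp (continuous_snd.add
        ((continuous_circleMap 0 t).comp continuous_fst))) hsub (isCompact_closedBall _ _) _ _)]
    simp only [hp.setIntegral_shift hG]
    rw [intervalIntegral.integral_const, smul_eq_mul]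
    ring
  simp only [h2]
  rw [intervalIntegral.integral_const, smul_eq_mul]
  ring

end Pointwise

section Orthonormal

/-- A continuous periodic function with vanishing weighted norm vanishes. -/
lemma eq_zero_of_wInt_eq_zero {f : ℂ → ℝ} {u : ℂ → ℂ} {h : ℝ} (hf : Continuous f)
    (hpf : PeriodicC f) (hu : Continuous u) (hpu : PeriodicC u) (h0 : wInt f h u = 0) : u = 0 := by
  have hc := continuous_wInt_integrand hf hu h
  have hp := hpf.wInt_integrand hpu h
  have hint (z : ℂ) : ∫ w in Metric.ball z 1, ‖u w‖ ^ 2 * Real.exp (-2 * f w / h) = 0 := by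
    refine le_antisymm ?_ (integral_nonneg fun w => by positivity)
    rw [← h0]
    exact hp.setIntegral_ball_le hc (fun w => by positivity) z (by linarith [Real.pi_gt_three])
  funext z
  have h1 := hint z
  rw [setIntegral_eq_zero_iff_of_nonneg_ae (Filter.Eventually.of_forall fun w => by positivity)
    ((hc.continuousOn.integrableOn_compact (isCompact_closedBall z 1)).mono_set
      Metric.ball_subset_closedBall)] at h1
  have h2 := Measure.eqOn_open_of_ae_eq h1 Metric.isOpen_ball hc.continuousOn
    continuousOn_const
  have h3 := h2 (Metric.mem_ball_self one_pos : z ∈ Metric.ball z 1)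
  simpa [(Real.exp_pos _).ne'] using h3

lemma exists_orthonormal {f : ℂ → ℝ} (hf : Continuous f) (hpf : PeriodicC f) (h : ℝ)
    (V : Submodule ℂ (ℂ → ℂ)) [FiniteDimensional ℂ V]
    (hV : ∀ u ∈ V, Continuous u ∧ PeriodicC u) :
    ∃ U : Fin (Module.finrank ℂ V) → ℂ → ℂ, (∀ i, U i ∈ V) ∧
      ∀ c : Fin (Module.finrank ℂ V) → ℂ,
        wInt f h (fun z => ∑ i, c i * U i z) = ∑ i, ‖c i‖ ^ 2 := by
  have hint (u v : V) : IntegrableOn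
      (fun z => (starRingEnd ℂ) (u.1 z) * v.1 z * Real.exp (-2 * f z / h)) Efd := by
    have h1 := (hV u u.2).1
    have h2 := (hV v v.2).1
    exact Continuous.integrableOn_Efd (by fun_prop)
  have hself (u : V) : ∫ z in Efd, (starRingEnd ℂ) (u.1 z) * u.1 z * Real.exp (-2 * f z / h) =
      (wInt f h u.1 : ℂ) := by
    rw [wInt, ← integral_complex_ofReal]
    congr 1
    ext z
    rw [← Complex.normSq_eq_conj_mul_self, Complex.normSq_eq_norm_sq]
    push_cast
    rfl
  let core : InnerProductSpace.Core ℂ V :=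
    { inner := fun u v =>
        ∫ z in Efd, (starRingEnd ℂ) (u.1 z) * v.1 z * Real.exp (-2 * f z / h)
      conj_inner_symm := fun u v => by
        rw [← integral_conj]
        congr 1
        ext z
        simp only [map_mul, Complex.conj_conj, Complex.conj_ofReal]
        ring
      re_inner_nonneg := fun u => by
        rw [hself]
        simpa using wInt_nonneg f h u.1
      add_left := fun u v w => by
        rw [← integral_add (hint u w) (hint v w)]
        congr 1
        ext z
        simp
        ring
      smul_left := fun u v r => by
        rw [← integral_const_mul]
        congr 1
        ext z
        simp
        ring
      definite := fun u hu => by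
        have h1 : (wInt f h u.1 : ℂ) = 0 := (hself u).symm.trans hu
        exact Subtype.ext (eq_zero_of_wInt_eq_zero hf hpf (hV u u.2).1 (hV u u.2).2
          (by exact_mod_cast h1)) }
  let : NormedAddCommGroup V := core.toNormedAddCommGroup
  let : InnerProductSpace ℂ V := InnerProductSpace.ofCore core.toCore
  let b := stdOrthonormalBasis ℂ V
  refine ⟨fun i => (b i).1, fun i => (b i).2, fun c => ?_⟩
  have h1 : (wInt f h (∑ i, c i • b i : V).1 : ℂ) =
      inner ℂ (∑ i, c i • b i) (∑ i, c i • b i) := (hself _).symm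
  have h2 : (∑ i, c i • b i : V).1 = fun z => ∑ i, c i * (b i).1 z := by
    ext z
    simp
  rw [h2, b.orthonormal.inner_sum] at h1
  have h3 : ∑ i, (starRingEnd ℂ) (c i) * c i = ((∑ i, ‖c i‖ ^ 2 : ℝ) : ℂ) := by
    push_cast
    refine Finset.sum_congr rfl fun i _ => ?_
    rw [← Complex.normSq_eq_conj_mul_self, Complex.normSq_eq_norm_sq]
    push_cast
    rfl
  rw [h3] at h1
  exact_mod_cast h1

end Orthonormal

section UpperBound

lemma dbar_sum_const_mul {ι : Type*} (s : Finset ι) (c : ι → ℂ) {U : ι → ℂ → ℂ}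
    (hU : ∀ i, Differentiable ℝ (U i)) (x : ℂ) :
    dbar (fun y => ∑ i ∈ s, c i * U i y) x = ∑ i ∈ s, c i * dbar (U i) x := by
  have h1 : fderiv ℝ (fun y => ∑ i ∈ s, c i * U i y) x = ∑ i ∈ s, c i • fderiv ℝ (U i) x := by
    rw [fderiv_fun_sum fun i _ => (hU i x).const_mul (c i)]
    exact Finset.sum_congr rfl fun i _ => fderiv_const_mul (hU i x) (c i)
  simp only [dbar, h1, sum_apply, smul_apply, smul_eq_mul]
  rw [Finset.mul_sum, ← Finset.sum_add_distrib, Finset.sum_div]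
  refine Finset.sum_congr rfl fun i _ => ?_
  ring

lemma norm_sum_mul_sq_le {ι : Type*} (s : Finset ι) (c d : ι → ℂ) :
    ‖∑ i ∈ s, c i * d i‖ ^ 2 ≤ (∑ i ∈ s, ‖c i‖ ^ 2) * ∑ i ∈ s, ‖d i‖ ^ 2 := by
  refine (pow_le_pow_left₀ (norm_nonneg _) (norm_sum_le _ _) 2).trans ?_
  simp only [norm_mul]
  exact Finset.sum_mul_sq_le_sq_mul_sq s _ _

lemma one_add_sq_mul_le {δ P ε : ℝ} (hδ : 0 ≤ δ) (hδ1 : δ ≤ 1) (hP : 0 ≤ P) (hε : 0 ≤ ε)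
    (h : δ * (P + ε) = ε / 8) : (1 + δ) ^ 2 * (P + ε / 2) ≤ (1 - δ) * (P + ε) := by
  have h4 : (1 + δ) ^ 2 ≤ 1 + 3 * δ := by nlinarith
  have h5 : (1 + δ) ^ 2 * (P + ε / 2) ≤ (1 + 3 * δ) * (P + ε / 2) :=
    mul_le_mul_of_nonneg_right h4 (by positivity)
  have h6 : 0 ≤ δ * ε := by positivity
  linarith

set_option maxHeartbeats 1000000 in
/-- The dimension of a space of smooth periodic functions satisfying `‖h∂̄u‖ ≤ e^{-c/h}‖u‖` in
the weighted norm of `f` is at most `(2πh)⁻¹ (∫ (Δf)₊ + ε)` for small `h`. -/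
theorem exists_finrank_le {f : ℂ → ℝ} (hf : ContDiff ℝ (⊤ : ℕ∞) f) (hp : PeriodicC f)
    {c ε : ℝ} (hc : 0 < c) (hε : 0 < ε) :
    ∃ h₀ > 0, ∀ h, 0 < h → h ≤ h₀ → ∀ V : Submodule ℂ (ℂ → ℂ),
      (∀ u ∈ V, ContDiff ℝ (⊤ : ℕ∞) u ∧ PeriodicC u) →
      (∀ u ∈ V, wInt f h (fun z => (h : ℂ) * dbar u z) ≤ Real.exp (-2 * c / h) * wInt f h u) →
      2 * π * h * Module.finrank ℂ V ≤ (∫ z in Efd, max (lapC f z) 0) + ε := by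
  have hfc := hf.continuous
  have hlc : Continuous (lapC f) := (ContDiff.lapC hf).continuous
  have hlp : PeriodicC (lapC f) := hp.lapC
  set P := ∫ z in Efd, max (lapC f z) 0 with hP
  have hP0 : 0 ≤ P := integral_nonneg fun z => le_max_right _ _
  obtain ⟨L, hL, hLb⟩ := hlp.exists_bound hlc
  set v := volume.real Efd with hv
  have hv0 : 0 ≤ v := measureReal_nonneg
  set ν := ε / (4 * (v + 1)) with hν
  have hν0 : 0 < ν := by positivity
  have hνv : ν * v ≤ ε / 4 := by
    rw [hν, div_mul_eq_mul_div, div_le_div_iff₀ (by positivity) (by positivity)]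
    nlinarith
  set S := 8 * (v + 1) / ε with hS
  have hS0 : 0 < S := by positivity
  have hSv : 2 / S * v ≤ ε / 4 := by
    rw [hS]
    have : 2 / (8 * (v + 1) / ε) * v = ε * v / (4 * (v + 1)) := by
      field_simp
      ring
    rw [this, div_le_div_iff₀ (by positivity) (by positivity)]
    nlinarith
  set δ := ε / (8 * (P + ε)) with hδ
  have hδ0 : 0 < δ := by positivity
  have hδε : δ * (P + ε) = ε / 8 := by
    rw [hδ]
    field_simp
  have hδ1 : δ ≤ 1 / 8 := by
    rw [hδ, div_le_div_iff₀ (by positivity) (by positivity)]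
    linarith
  set ω := Real.log (1 + δ) / (2 * S) with hω
  have hω0 : 0 < ω := div_pos (Real.log_pos (by linarith)) (by positivity)
  have hωS : Real.exp (2 * ω * S) = 1 + δ := by
    have : 2 * ω * S = Real.log (1 + δ) := by
      rw [hω]
      field_simp
    rw [this, Real.exp_log (by positivity)]
  obtain ⟨r₀, hr₀, hT⟩ := exists_taylor_of_periodicC hp hf hω0
  set m := min r₀ π with hm
  have hm0 : 0 < m := lt_min hr₀ Real.pi_pos
  set C := (1 + 1 / δ) * 4 * S * Real.exp (((L + ν) / 2 + 2 * ω) * S) with hC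
  have hC0 : 0 < C := by positivity
  refine ⟨min (m ^ 2 / S) (2 * c ^ 2 * δ / C), by positivity, fun h hh hle V hV hVe => ?_⟩
  have hhm : S * h ≤ m ^ 2 := by
    have := hle.trans (min_le_left _ _)
    rw [le_div_iff₀ hS0] at this
    linarith
  have hhC : C * (Real.exp (-2 * c / h) / h) ≤ δ := by
    have h1 := hle.trans (min_le_right _ _)
    rw [le_div_iff₀ hC0] at h1
    have h2 := Real.quadratic_le_exp_of_nonneg (x := 2 * c / h) (by positivity)
    have h3 : 2 * c ^ 2 / h ^ 2 ≤ Real.exp (2 * c / h) := by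
      have : (2 * c / h) ^ 2 / 2 = 2 * c ^ 2 / h ^ 2 := by
        field_simp
      have : 0 < 2 * c / h := by positivity
      linarith
    have h4 : Real.exp (-2 * c / h) ≤ h ^ 2 / (2 * c ^ 2) := by
      have : -2 * c / h = -(2 * c / h) := by ring
      rw [this, Real.exp_neg, ← inv_div (2 * c ^ 2)]
      exact inv_anti₀ (by positivity) h3
    calc C * (Real.exp (-2 * c / h) / h) ≤ C * (h ^ 2 / (2 * c ^ 2) / h) := by gcongr
      _ = h * C / (2 * c ^ 2) := by
        field_simp
      _ ≤ δ := by
        rw [div_le_iff₀ (by positivity)]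
        linarith
  by_cases hfin : FiniteDimensional ℂ V
  swap
  · rw [Module.finrank_of_not_finite hfin]
    simp only [CharP.cast_eq_zero, mul_zero]
    positivity
  obtain ⟨U, hUV, hU⟩ := exists_orthonormal hfc hp h V fun u hu =>
    ⟨(hV u hu).1.continuous, (hV u hu).2⟩
  generalize Module.finrank ℂ V = n at U hUV hU ⊢
  have hUs (i : Fin n) : ContDiff ℝ (⊤ : ℕ∞) (U i) := (hV _ (hUV i)).1
  have hUp (i : Fin n) : PeriodicC (U i) := (hV _ (hUV i)).2
  have hUc (i : Fin n) : Continuous (U i) := (hUs i).continuous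
  have hdc (i : Fin n) : Continuous (dbar (U i)) := (ContDiff.dbar (hUs i)).continuous
  have hdp (i : Fin n) : PeriodicC (dbar (U i)) := (hUp i).dbar
  have hU1 (i : Fin n) : wInt f h (U i) = 1 := by
    have := hU (Pi.single i 1)
    simpa [Pi.single_apply, apply_ite] using this
  set ρ := √(S * h) with hρ
  have hρ0 : 0 < ρ := Real.sqrt_pos.2 (by positivity)
  have hρ2 : ρ ^ 2 = S * h := Real.sq_sqrt (by positivity)
  have hρm : ρ ≤ m := by
    rw [hρ, Real.sqrt_le_left hm0.le]
    exact hhm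
  set G : ℂ → ℝ := fun z => ∑ i, ‖dbar (U i) z‖ ^ 2 * Real.exp (-2 * f z / h) with hG
  have hGc : Continuous G :=
    continuous_finsetSum _ fun i _ => continuous_wInt_integrand hfc (hdc i) h
  have hG0 (z : ℂ) : 0 ≤ G z := Finset.sum_nonneg fun i _ => by positivity
  have hGp : PeriodicC G := fun z => by
    refine ⟨Finset.sum_congr rfl fun i _ => ?_, Finset.sum_congr rfl fun i _ => ?_⟩
    · exact (hp.wInt_integrand (hdp i) h z).1
    · exact (hp.wInt_integrand (hdp i) h z).2
  have hpi : (-π : ℝ) ≤ π := by linarith [Real.pi_pos]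
  have hcm := continuous_circleMap_uncurry
  set M := (1 + 1 / δ) * (2 * ρ / π) * Real.exp (((L + ν) / 2 + 2 * ω) * S) with hM
  have hM0 : 0 ≤ M := by positivity
  set b : ℂ → ℝ := fun z => max (lapC f z) 0 + ν with hb
  have hbL (z : ℂ) : b z ≤ L + ν := by
    have := (le_abs_self _).trans (hLb z)
    simp only [hb]
    gcongr
    exact max_le this hL.le
  have hb0 (z : ℂ) : 0 < b z := add_pos_of_nonneg_of_pos (le_max_right _ _) hν0
  have key (z : ℂ) : ∑ i, ‖U i z‖ ^ 2 * Real.exp (-2 * f z / h) ≤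
      (1 + δ) ^ 2 / (2 * π * h) * (b z + 2 / S) +
        M * ∫ t in (0 : ℝ)..ρ, ∫ θ in (-π)..π, G (z + circleMap 0 t θ) := by
    set X := ∑ i, ‖U i z‖ ^ 2 with hX
    have hJ0 : 0 ≤ ∫ t in (0 : ℝ)..ρ, ∫ θ in (-π)..π, G (z + circleMap 0 t θ) :=
      intervalIntegral.integral_nonneg hρ0.le fun t _ =>
        intervalIntegral.integral_nonneg hpi fun θ _ => hG0 _
    have hX0 : 0 ≤ X := Finset.sum_nonneg fun i _ => by positivity
    rw [← Finset.sum_mul]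
    rcases hX0.eq_or_lt with hX' | hX'
    · rw [← hX, ← hX', zero_mul]
      have := (hb0 z).le
      positivity
    obtain ⟨p, q, hpq⟩ := hT z
    set w : ℂ → ℂ := fun y => ∑ i, (starRingEnd ℂ) (U i z) * U i y with hw
    have hwV : w ∈ V := by
      have : w = ∑ i, (starRingEnd ℂ) (U i z) • U i := by
        ext y
        simp [hw]
      rw [this]
      exact V.sum_mem fun i _ => V.smul_mem _ (hUV i)
    have h1 := normSq_mul_exp_le hp hfc hρ0 (hρm.trans (min_le_right _ _)) hω0.le (hb0 z)
      ((le_max_left _ _).trans (le_add_of_nonneg_right hν0.le)) hδ0 hh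
      (fun x hx => hpq x (hx.trans (hρm.trans (min_le_left _ _)))) (hV w hwV).1 (hV w hwV).2
    have hwz : ‖w z‖ = X := by
      have : w z = (X : ℂ) := by
        simp only [hw, hX]
        push_cast
        refine Finset.sum_congr rfl fun i _ => ?_
        rw [← Complex.normSq_eq_conj_mul_self, Complex.normSq_eq_norm_sq]
        push_cast
        rfl
      rw [this, Complex.norm_real, Real.norm_of_nonneg hX0]
    have hwI : wInt f h w = X := by
      rw [hw, hU]
      simp [hX]
    have hdw (y : ℂ) : ‖dbar w y‖ ^ 2 * Real.exp (-2 * f y / h) ≤ X * G y := by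
      rw [hw, dbar_sum_const_mul _ _ fun i => (hUs i).differentiable (by simp)]
      have := norm_sum_mul_sq_le Finset.univ (fun i => (starRingEnd ℂ) (U i z))
        fun i => dbar (U i) y
      simp only [RCLike.norm_conj] at this
      simp only [hG]
      rw [← Finset.sum_mul, ← mul_assoc]
      exact mul_le_mul_of_nonneg_right this (Real.exp_pos _).le
    have hint : ∫ t in (0 : ℝ)..ρ, ∫ θ in (-π)..π, ‖dbar w (z + circleMap 0 t θ)‖ ^ 2 *
          Real.exp (-2 * f (z + circleMap 0 t θ) / h) ≤
        X * ∫ t in (0 : ℝ)..ρ, ∫ θ in (-π)..π, G (z + circleMap 0 t θ) := by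
      have hc1 : Continuous fun x => ‖dbar w (z + x)‖ ^ 2 * Real.exp (-2 * f (z + x) / h) :=
        (continuous_wInt_integrand hfc (ContDiff.dbar (hV w hwV).1).continuous h).comp
          (continuous_const_add z)
      have hc2 : Continuous fun x => G (z + x) := hGc.comp (continuous_const_add z)
      rw [← intervalIntegral.integral_const_mul]
      refine intervalIntegral.integral_mono_on hρ0.le (Continuous.intervalIntegrable ?_ _ _)
        (Continuous.intervalIntegrable ?_ _ _) fun t _ => ?_
      · exact intervalIntegral.continuous_parametric_intervalIntegral_of_continuous'
          (f := fun t θ => ‖dbar w (z + circleMap 0 t θ)‖ ^ 2 *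
            Real.exp (-2 * f (z + circleMap 0 t θ) / h)) (hc1.comp hcm) _ _
      · exact continuous_const.mul
          (intervalIntegral.continuous_parametric_intervalIntegral_of_continuous'
            (f := fun t θ => G (z + circleMap 0 t θ)) (hc2.comp hcm) _ _)
      rw [← intervalIntegral.integral_const_mul]
      exact intervalIntegral.integral_mono_on hpi
        ((hc1.comp (continuous_circleMap 0 t)).intervalIntegrable _ _)
        ((continuous_const.mul (hc2.comp (continuous_circleMap 0 t))).intervalIntegrable _ _)
        fun θ _ => hdw _
    rw [hwz, hwI, hρ2] at h1
    have e1 : 2 * ω * (S * h) / h = 2 * ω * S := by field_simp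
    have e2 : (b z / 2 + 2 * ω) * (S * h) / h = (b z / 2 + 2 * ω) * S := by field_simp
    rw [e1, e2, hωS] at h1
    have h2 : (1 + 1 / δ) * (2 * ρ / π) * Real.exp ((b z / 2 + 2 * ω) * S) ≤ M := by
      rw [hM]
      have := hbL z
      gcongr
    have h3 := mul_le_mul h2 hint (by
      refine intervalIntegral.integral_nonneg hρ0.le fun t _ =>
        intervalIntegral.integral_nonneg hpi fun θ _ => by positivity) hM0
    have h4 : X * (X * Real.exp (-2 * f z / h)) ≤ X * ((1 + δ) ^ 2 / (2 * π * h) * (b z + 2 / S) +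
        M * ∫ t in (0 : ℝ)..ρ, ∫ θ in (-π)..π, G (z + circleMap 0 t θ)) := by
      have e3 : (1 + δ) / π * (b z / (2 * h) + 1 / (S * h)) * (1 + δ) * X =
          X * ((1 + δ) ^ 2 / (2 * π * h) * (b z + 2 / S)) := by
        field_simp
      rw [e3] at h1
      calc X * (X * Real.exp (-2 * f z / h)) = X ^ 2 * Real.exp (-2 * f z / h) := by ring
        _ ≤ _ := h1
        _ ≤ _ := add_le_add_right h3 _
        _ = _ := by ring
    exact le_of_mul_le_mul_left h4 hX'
  have hbc : Continuous b := (hlc.max continuous_const).add continuous_const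
  have hJc : Continuous fun z => ∫ t in (0 : ℝ)..ρ, ∫ θ in (-π)..π, G (z + circleMap 0 t θ) := by
    refine intervalIntegral.continuous_parametric_intervalIntegral_of_continuous'
      (f := fun z t => ∫ θ in (-π)..π, G (z + circleMap 0 t θ)) ?_ _ _
    refine intervalIntegral.continuous_parametric_intervalIntegral_of_continuous'
      (f := fun (p : ℂ × ℝ) θ => G (p.1 + circleMap 0 p.2 θ)) ?_ _ _
    exact hGc.comp ((continuous_fst.comp continuous_fst).add
      (hcm.comp ((continuous_snd.comp continuous_fst).prodMk continuous_snd)))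
  have hI := setIntegral_mono (μ := volume) (s := Efd)
    (f := fun z => ∑ i, ‖U i z‖ ^ 2 * Real.exp (-2 * f z / h))
    (g := fun z => (1 + δ) ^ 2 / (2 * π * h) * (b z + 2 / S) +
        M * ∫ t in (0 : ℝ)..ρ, ∫ θ in (-π)..π, G (z + circleMap 0 t θ))
    (Continuous.integrableOn_Efd
      (continuous_finsetSum _ fun i _ => continuous_wInt_integrand hfc (hUc i) h))
    (Continuous.integrableOn_Efd ((continuous_const.mul (hbc.add continuous_const)).add
      (continuous_const.mul hJc))) key
  rw [integral_finsetSum _ fun i _ =>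
    (Continuous.integrableOn_Efd (continuous_wInt_integrand hfc (hUc i) h))] at hI
  have hsum : ∑ i, ∫ z in Efd, ‖U i z‖ ^ 2 * Real.exp (-2 * f z / h) = n := by
    have : ∀ i, ∫ z in Efd, ‖U i z‖ ^ 2 * Real.exp (-2 * f z / h) = 1 := hU1
    simp only [this]
    simp
  have hGint : ∫ z in Efd, G z ≤ n * (Real.exp (-2 * c / h) / h ^ 2) := by
    rw [hG, integral_finsetSum _ fun i _ =>
      (Continuous.integrableOn_Efd (continuous_wInt_integrand hfc (hdc i) h))]
    have h1 (i : Fin n) : ∫ z in Efd, ‖dbar (U i) z‖ ^ 2 * Real.exp (-2 * f z / h) ≤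
        Real.exp (-2 * c / h) / h ^ 2 := by
      have h2 := hVe (U i) (hUV i)
      rw [wInt_const_mul, hU1, mul_one, Complex.norm_real, Real.norm_of_nonneg hh.le] at h2
      rw [le_div_iff₀ (by positivity), mul_comm]
      exact h2
    refine (Finset.sum_le_sum fun i _ => h1 i).trans_eq ?_
    simp
  have hi1 : IntegrableOn (fun z => (1 + δ) ^ 2 / (2 * π * h) * (b z + 2 / S)) Efd :=
    Continuous.integrableOn_Efd (continuous_const.mul (hbc.add continuous_const))
  have hi2 : IntegrableOn (fun z => M * ∫ t in (0 : ℝ)..ρ, ∫ θ in (-π)..π,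
      G (z + circleMap 0 t θ)) Efd := Continuous.integrableOn_Efd (continuous_const.mul hJc)
  rw [hsum, integral_add hi1 hi2, integral_const_mul,
    integral_const_mul, hGp.setIntegral_circle hGc] at hI
  have hbint : ∫ z in Efd, (b z + 2 / S) = P + ν * v + 2 / S * v := by
    have hc0 (a : ℝ) : IntegrableOn (fun _ : ℂ => a) Efd :=
      Continuous.integrableOn_Efd continuous_const
    rw [integral_add (Continuous.integrableOn_Efd hbc) (hc0 _), hb,
      integral_add (Continuous.integrableOn_Efd (hlc.max continuous_const)) (hc0 _),
      setIntegral_const, setIntegral_const, smul_eq_mul, smul_eq_mul]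
    ring
  rw [hbint] at hI
  have hlast : M * (2 * π * ρ * ∫ z in Efd, G z) ≤ δ * n := by
    calc M * (2 * π * ρ * ∫ z in Efd, G z)
        ≤ M * (2 * π * ρ * (n * (Real.exp (-2 * c / h) / h ^ 2))) := by gcongr
      _ = (1 + 1 / δ) * 4 * ρ ^ 2 * Real.exp (((L + ν) / 2 + 2 * ω) * S) *
          (n * (Real.exp (-2 * c / h) / h ^ 2)) := by
        rw [hM]
        field_simp
        ring
      _ = C * (Real.exp (-2 * c / h) / h) * n := by
        rw [hρ2, hC]
        field_simp
      _ ≤ δ * n := by gcongr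
  have hfinal : (1 - δ) * (2 * π * h * n) ≤ (1 + δ) ^ 2 * (P + ε / 2) := by
    have h1 : (n : ℝ) * (1 - δ) ≤ (1 + δ) ^ 2 / (2 * π * h) * (P + ν * v + 2 / S * v) := by
      linarith
    have h2 := mul_le_mul_of_nonneg_left h1 (show 0 ≤ 2 * π * h by positivity)
    calc (1 - δ) * (2 * π * h * n) = 2 * π * h * (n * (1 - δ)) := by ring
      _ ≤ _ := h2
      _ = (1 + δ) ^ 2 * (P + ν * v + 2 / S * v) := by field_simp
      _ ≤ _ := mul_le_mul_of_nonneg_left (by linarith) (by positivity)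
  have h3 : (1 + δ) ^ 2 * (P + ε / 2) ≤ (1 - δ) * (P + ε) :=
    one_add_sq_mul_le hδ0.le (by linarith) hP0 hε.le hδε
  exact le_of_mul_le_mul_left (hfinal.trans h3) (by linarith)

end UpperBound

/-- Comparison of weighted norms for weights which are close in one direction. -/
lemma wInt_le_exp_mul_wInt {f g : ℂ → ℝ} {u : ℂ → ℂ} {h d : ℝ} (hf : Continuous f)
    (hg : Continuous g) (hu : Continuous u) (hh : 0 < h) (hd : ∀ z, g z - f z ≤ d) :
    wInt f h u ≤ Real.exp (2 * d / h) * wInt g h u := by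
  unfold wInt
  rw [← integral_const_mul]
  refine setIntegral_mono (Continuous.integrableOn_Efd (continuous_wInt_integrand hf hu h))
    (Continuous.integrableOn_Efd (continuous_const.mul (continuous_wInt_integrand hg hu h)))
    fun z => ?_
  have : Real.exp (-2 * f z / h) ≤ Real.exp (2 * d / h) * Real.exp (-2 * g z / h) := by
    rw [← Real.exp_add, ← add_div]
    refine Real.exp_le_exp.2 ?_
    gcongr
    linarith [hd z]
  calc ‖u z‖ ^ 2 * Real.exp (-2 * f z / h)
      ≤ ‖u z‖ ^ 2 * (Real.exp (2 * d / h) * Real.exp (-2 * g z / h)) := by gcongr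
    _ = _ := by ring

namespace IsObst

variable {φ ψ : ℂ → ℝ} {τ : ℝ}

/-- Upper bound for the dimension of spaces of quasimodes. -/
lemma exists_finrank_le (O : IsObst φ ψ τ) {ε : ℝ} (hε : 0 < ε) :
    ∃ h₀ > 0, ∀ h, 0 < h → h ≤ h₀ → ∀ V : Submodule ℂ (ℂ → ℂ),
      (∀ u ∈ V, ContDiff ℝ (⊤ : ℕ∞) u ∧ PeriodicC u) →
      (∀ u ∈ V, wInt φ h (fun z => (h : ℂ) * dbar u z) ≤
        Real.exp (-τ / h) ^ 2 * wInt φ h u) →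
      2 * π * h * Module.finrank ℂ V ≤
        (∫ z in {z | ψ z = φ z} ∩ Efd, lapC φ z) + ε := by
  set Φ := ∫ z in {z | ψ z = φ z} ∩ Efd, lapC φ z
  set A := ∫ z in Efd, |lapC φ z| with hA
  have hA0 : 0 ≤ A := integral_nonneg fun _ => abs_nonneg _
  have hτ := O.pos
  set s := min (1 / 2) (ε / (4 * (A + 1))) with hs
  have hs0 : 0 < s := lt_min (by norm_num) (by positivity)
  have hs1 : s ≤ 1 / 2 := min_le_left _ _
  have hsA : s * A ≤ ε / 4 := by
    have : s ≤ ε / (4 * (A + 1)) := min_le_right _ _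
    rw [le_div_iff₀ (by positivity)] at this
    nlinarith
  set a := s * τ / 4 with ha
  have ha0 : 0 < a := by positivity
  obtain ⟨κ₁, hκ₁, hcl⟩ := O.per'.exists_moll_close O.cont ha0
  have hev : ∀ᶠ κ in 𝓝[>] (0 : ℝ), (∫ z in Efd, max (lapC (moll κ ψ) z) 0) < Φ + ε / 4 :=
    O.tendsto_integral_pos_part.eventually (gt_mem_nhds (by linarith))
  have hev2 : ∀ᶠ κ in 𝓝[>] (0 : ℝ), κ ∈ Set.Ioc 0 κ₁ := Ioc_mem_nhdsGT hκ₁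
  obtain ⟨κ, hκi, hκ0, hκ1⟩ := (hev.and hev2).exists
  have hcl := hcl κ hκ0 hκ1
  have hm : ContDiff ℝ (⊤ : ℕ∞) (moll κ ψ) := contDiff_moll O.cont hκ0
  set f : ℂ → ℝ := fun z => (1 - s) * moll κ ψ z + s * φ z with hf
  have hfs : ContDiff ℝ (⊤ : ℕ∞) f := (contDiff_const.mul hm).add (contDiff_const.mul O.smooth)
  have hfp : PeriodicC f :=
    (O.per'.moll κ).comp₂ O.per fun x y => (1 - s) * x + s * y
  have hlap (z : ℂ) : lapC f z = (1 - s) * lapC (moll κ ψ) z + s * lapC φ z := by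
    have h1 : ContDiffAt ℝ 2 (moll κ ψ) z := hm.contDiffAt_two
    have h2 : ContDiffAt ℝ 2 φ z := O.smooth.contDiffAt_two
    rw [hf, lapC_add (contDiffAt_const.mul h1) (contDiffAt_const.mul h2), lapC_const_mul _ h1,
      lapC_const_mul _ h2]
  obtain ⟨h₀, hh₀, H⟩ := _root_.exists_finrank_le hfs hfp (c := s * τ / 2) (by positivity)
    (half_pos hε)
  refine ⟨h₀, hh₀, fun h hh hle V hV hVe => (H h hh hle V hV fun u hu => ?_).trans ?_⟩
  · have hus := (hV u hu).1
    have hdc : Continuous (fun z => (h : ℂ) * dbar u z) :=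
      continuous_const.mul hus.dbar.continuous
    have e1 := wInt_le_exp_mul_wInt (f := f) (g := φ) (h := h) (d := (1 - s) * (τ + a))
      hfs.continuous O.smooth.continuous hdc hh fun z => by
        have h1 := (abs_le.1 (hcl z)).1
        have h2 := O.lower z
        have : φ z - f z = (1 - s) * (φ z - moll κ ψ z) := by simp only [hf]; ring
        rw [this]
        gcongr
        · linarith
        · linarith
    have e2 := wInt_le_exp_mul_wInt (f := φ) (g := f) (h := h) (d := a)
      O.smooth.continuous hfs.continuous hus.continuous hh fun z => by
        have h1 := (abs_le.1 (hcl z)).2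
        have h2 := O.upper z
        have : f z - φ z = (1 - s) * (moll κ ψ z - φ z) := by simp only [hf]; ring
        rw [this]
        nlinarith
    calc wInt f h (fun z => (h : ℂ) * dbar u z)
        ≤ Real.exp (2 * ((1 - s) * (τ + a)) / h) * (Real.exp (-τ / h) ^ 2 *
          (Real.exp (2 * a / h) * wInt f h u)) := by
          refine e1.trans ?_
          gcongr
          refine (hVe u hu).trans ?_
          gcongr
      _ = Real.exp ((2 * ((1 - s) * (τ + a)) - 2 * τ + 2 * a) / h) * wInt f h u := by
          rw [← Real.exp_nat_mul, ← mul_assoc, ← mul_assoc, ← Real.exp_add, ← Real.exp_add]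
          congr 2
          push_cast
          ring
      _ ≤ _ := by
          have := wInt_nonneg f h u
          gcongr
          nlinarith
  · have hc1 : Continuous fun z => max (lapC (moll κ ψ) z) 0 :=
      hm.lapC.continuous.max continuous_const
    have hc2 : Continuous fun z => s * |lapC φ z| :=
      continuous_const.mul O.smooth.lapC.continuous.abs
    have : (∫ z in Efd, max (lapC f z) 0) ≤
        ∫ z in Efd, (max (lapC (moll κ ψ) z) 0 + s * |lapC φ z|) := by
      refine setIntegral_mono (Continuous.integrableOn_Efd
        (hfs.lapC.continuous.max continuous_const)) (Continuous.integrableOn_Efd (hc1.add hc2))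
        fun z => ?_
      have h1 : 0 ≤ max (lapC (moll κ ψ) z) 0 := le_max_right _ _
      have h2 : lapC (moll κ ψ) z ≤ max (lapC (moll κ ψ) z) 0 := le_max_left _ _
      have h3 : 0 ≤ s * |lapC φ z| := by positivity
      have h4 : s * lapC φ z ≤ s * |lapC φ z| := by gcongr; exact le_abs_self _
      refine max_le ?_ (by positivity)
      rw [hlap]
      nlinarith
    rw [integral_add hc1.integrableOn_Efd hc2.integrableOn_Efd, integral_const_mul, ← hA] at this
    linarith

/-- The set whose supremum defines `countN` is bounded above, and `countN` satisfies the
upper half of the Weyl law. -/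
lemma exists_countN_le (O : IsObst φ ψ τ) {ε : ℝ} (hε : 0 < ε) :
    ∃ h₀ > 0, ∀ h, 0 < h → h ≤ h₀ →
      2 * π * h * (countN φ (Real.exp (-τ / h)) h : ℝ) ≤
        (∫ z in {z | ψ z = φ z} ∩ Efd, lapC φ z) + ε ∧
      ∀ V : Submodule ℂ (ℂ → ℂ),
        (∀ u ∈ V, ContDiff ℝ (⊤ : ℕ∞) u ∧ PeriodicC u) →
        (∀ u ∈ V, wInt φ h (fun z => (h : ℂ) * dbar u z) ≤
          Real.exp (-τ / h) ^ 2 * wInt φ h u) →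
        Module.finrank ℂ V ≤ countN φ (Real.exp (-τ / h)) h := by
  obtain ⟨h₀, hh₀, H⟩ := O.exists_finrank_le hε
  refine ⟨h₀, hh₀, fun h hh hle => ?_⟩
  have H := H h hh hle
  set S := {n : ℕ | ∃ V : Submodule ℂ (ℂ → ℂ),
    Module.finrank ℂ V = n ∧
    (∀ u ∈ V, ContDiff ℝ (⊤ : ℕ∞) u ∧ PeriodicC u) ∧
    (∀ u ∈ V, wInt φ h (fun z => (h : ℂ) * dbar u z) ≤
      Real.exp (-τ / h) ^ 2 * wInt φ h u)} with hS
  have hb : BddAbove S := by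
    refine ⟨⌈((∫ z in {z | ψ z = φ z} ∩ Efd, lapC φ z) + ε) / (2 * π * h)⌉₊, ?_⟩
    rintro n ⟨V, rfl, hV, hVe⟩
    have := H V hV hVe
    have h2 : (Module.finrank ℂ V : ℝ) ≤
        ((∫ z in {z | ψ z = φ z} ∩ Efd, lapC φ z) + ε) / (2 * π * h) := by
      rw [le_div_iff₀ (by positivity)]
      linarith
    exact_mod_cast h2.trans (Nat.le_ceil _)
  have hne : S.Nonempty := by
    refine ⟨0, ⊥, by simp, ?_, ?_⟩
    · rintro u hu
      rw [(Submodule.mem_bot ℂ).1 hu]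
      exact ⟨contDiff_const, fun z => ⟨rfl, rfl⟩⟩
    · rintro u hu
      rw [(Submodule.mem_bot ℂ).1 hu]
      have : dbar (0 : ℂ → ℂ) = 0 := by
        funext z
        simp [dbar]
      simp [this, wInt]
  refine ⟨?_, fun V hV hVe => le_csSup hb ⟨V, rfl, hV, hVe⟩⟩
  obtain ⟨V, hV1, hV, hVe⟩ := Nat.sSup_mem hne hb
  have h3 : countN φ (Real.exp (-τ / h)) h = Module.finrank ℂ V := hV1.symm
  rw [h3]
  exact H V hV hVe

end IsObst

/-- The periodic function `2 - cos x - cos y`, comparable to the squared distance from the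
lattice. -/
def cosGap (z : ℂ) : ℝ := 2 - Real.cos z.re - Real.cos z.im

lemma contDiff_cosGap : ContDiff ℝ (⊤ : ℕ∞) cosGap :=
  (contDiff_const.sub (Real.contDiff_cos.comp Complex.reCLM.contDiff)).sub
    (Real.contDiff_cos.comp Complex.imCLM.contDiff)

lemma continuous_cosGap : Continuous cosGap := contDiff_cosGap.continuous

lemma periodicC_cosGap : PeriodicC cosGap := fun z => by
  simp [cosGap]

lemma cosGap_nonneg (z : ℂ) : 0 ≤ cosGap z := by
  unfold cosGap
  linarith [Real.cos_le_one z.re, Real.cos_le_one z.im]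

lemma cosGap_le (z : ℂ) : cosGap z ≤ ‖z‖ ^ 2 / 2 := by
  have h1 := Real.one_sub_sq_div_two_le_cos (x := z.re)
  have h2 := Real.one_sub_sq_div_two_le_cos (x := z.im)
  rw [← Complex.normSq_eq_norm_sq, Complex.normSq_apply]
  unfold cosGap
  nlinarith

lemma exists_lattice_eq_of_cosGap_eq_zero {z : ℂ} (h : cosGap z = 0) :
    ∃ m n : ℤ, z = (m : ℂ) * (2 * π : ℝ) + n * ((2 * π : ℝ) * I) := by
  unfold cosGap at h
  have h1 : Real.cos z.re = 1 := by linarith [Real.cos_le_one z.re, Real.cos_le_one z.im]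
  have h2 : Real.cos z.im = 1 := by linarith [Real.cos_le_one z.re, Real.cos_le_one z.im]
  obtain ⟨m, hm⟩ := (Real.cos_eq_one_iff _).1 h1
  obtain ⟨n, hn⟩ := (Real.cos_eq_one_iff _).1 h2
  refine ⟨m, n, Complex.ext ?_ ?_⟩
  · simp [← hm]
  · simp [← hn]

lemma fderiv_cosGap (z e : ℂ) :
    fderiv ℝ cosGap z e = Real.sin z.re * e.re + Real.sin z.im * e.im := by
  have h1 : HasFDerivAt (fun z : ℂ => Real.cos z.re) (-Real.sin z.re • Complex.reCLM) z :=
    (Real.hasDerivAt_cos z.re).comp_hasFDerivAt z Complex.reCLM.hasFDerivAt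
  have h2 : HasFDerivAt (fun z : ℂ => Real.cos z.im) (-Real.sin z.im • Complex.imCLM) z :=
    (Real.hasDerivAt_cos z.im).comp_hasFDerivAt z Complex.imCLM.hasFDerivAt
  have : HasFDerivAt cosGap _ z := ((hasFDerivAt_const (2 : ℝ) z).sub h1).sub h2
  rw [this.fderiv]
  simp

lemma lapC_cosGap (z : ℂ) : lapC cosGap z = 2 - cosGap z := by
  have h1 : HasFDerivAt (fun z : ℂ => Real.sin z.re) (Real.cos z.re • Complex.reCLM) z :=
    (Real.hasDerivAt_sin z.re).comp_hasFDerivAt z Complex.reCLM.hasFDerivAt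
  have h2 : HasFDerivAt (fun z : ℂ => Real.sin z.im) (Real.cos z.im • Complex.imCLM) z :=
    (Real.hasDerivAt_sin z.im).comp_hasFDerivAt z Complex.imCLM.hasFDerivAt
  simp only [lapC, fderiv_cosGap, Complex.one_re, Complex.one_im, Complex.I_re, Complex.I_im,
    mul_one, mul_zero, add_zero, zero_add]
  rw [h1.fderiv, h2.fderiv]
  simp [cosGap]
  ring

/-- Lower bound for the Laplacian of the barrier `log c + 1 - c / a`. -/
lemma le_lapC_barrier {a : ℝ} (ha : 0 < a) {b z : ℂ} (hz : cosGap (z - b) ≠ 0) :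
    -(1 / 2 + 2 / a) ≤
      lapC (fun w => Real.log (cosGap (w - b)) - cosGap (w - b) / a) z := by
  have hpos : 0 < cosGap (z - b) := lt_of_le_of_ne (cosGap_nonneg _) hz.symm
  have htr := lapC_comp_add (fun w => Real.log (cosGap w) - cosGap w / a) (-b) z
  simp only [← sub_eq_add_neg] at htr
  rw [htr]
  set w := z - b
  have hd1 : ∀ᶠ s in 𝓝 (cosGap w), HasDerivAt (fun s => Real.log s - s / a) (s⁻¹ - 1 / a) s := by
    filter_upwards [lt_mem_nhds hpos] with s hs
    exact (Real.hasDerivAt_log hs.ne').sub ((hasDerivAt_id s).div_const a)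
  have hd2 : HasDerivAt (fun s : ℝ => s⁻¹ - 1 / a) (-((cosGap w) ^ 2)⁻¹) (cosGap w) :=
    (hasDerivAt_inv hpos.ne').sub_const _
  rw [lapC_comp (P := fun s => Real.log s - s / a) contDiff_cosGap.contDiffAt_two hd1 hd2,
    lapC_cosGap, fderiv_cosGap, fderiv_cosGap]
  simp only [Complex.one_re, Complex.one_im, Complex.I_re, Complex.I_im,
    mul_one, mul_zero, add_zero, zero_add]
  have hs1 := Real.sin_sq_add_cos_sq w.re
  have hs2 := Real.sin_sq_add_cos_sq w.im
  have hc : cosGap w = 2 - Real.cos w.re - Real.cos w.im := rfl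
  set c := cosGap w
  set p := Real.cos w.re
  set q := Real.cos w.im
  have e1 : Real.sin w.re ^ 2 + Real.sin w.im ^ 2 ≤ 2 * c - c ^ 2 / 2 := by
    rw [hc]
    nlinarith [sq_nonneg (p - q)]
  have e2 : (c⁻¹ - 1 / a) * (2 - c) + -(c ^ 2)⁻¹ * (2 * c - c ^ 2 / 2) =
      -(1 / 2 + 2 / a) + c / a := by
    field_simp
    ring
  have e3 : (c ^ 2)⁻¹ * (Real.sin w.re ^ 2 + Real.sin w.im ^ 2) ≤
      (c ^ 2)⁻¹ * (2 * c - c ^ 2 / 2) := by gcongr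
  have : 0 ≤ c / a := by positivity
  linarith

/-- Sublevel sets of `cosGap` are contained in lattice translates of discs. -/
lemma exists_norm_le_of_cosGap_le {ε r : ℝ} (hr0 : 0 ≤ r) (hrε : 4 * r ^ 2 ≤ ε)
    (hε : ε < 1) {z : ℂ} (hz : cosGap z ≤ (1 - ε) * r ^ 2 / 2) :
    ∃ m n : ℤ, ‖z + (m : ℂ) * (2 * π : ℝ) + n * ((2 * π : ℝ) * I)‖ ≤ r := by
  obtain ⟨m, n, h⟩ := exists_add_lattice_mem_Efd (z + (π : ℂ) + π * I)
  refine ⟨m, n, ?_⟩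
  rw [← periodicC_cosGap.add_lattice m n] at hz
  set w := z + (m : ℂ) * (2 * π : ℝ) + n * ((2 * π : ℝ) * I) with hw
  have hw2 : z + (π : ℂ) + π * I + (m : ℂ) * (2 * π : ℝ) + n * ((2 * π : ℝ) * I) =
      w + π + π * I := by rw [hw]; ring
  rw [hw2] at h
  obtain ⟨⟨h1, h2⟩, h3, h4⟩ := h
  simp at h1 h2 h3 h4
  have hx : |w.re| ≤ π := abs_le.2 ⟨by linarith, by linarith⟩
  have hy : |w.im| ≤ π := abs_le.2 ⟨by linarith, by linarith⟩
  have cx := Real.cos_le_one_sub_mul_cos_sq hx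
  have cy := Real.cos_le_one_sub_mul_cos_sq hy
  have hn : ‖w‖ ^ 2 = w.re ^ 2 + w.im ^ 2 := by
    rw [← Complex.normSq_eq_norm_sq, Complex.normSq_apply]; ring
  have hc : cosGap w = 2 - Real.cos w.re - Real.cos w.im := rfl
  have hbig : ‖w‖ ^ 2 ≤ 4 * r ^ 2 := by
    have hpi : 1 / 8 ≤ 2 / π ^ 2 := by
      rw [div_le_div_iff₀ (by norm_num) (by positivity)]
      nlinarith [Real.pi_le_four, Real.pi_pos]
    have h5 : 2 / π ^ 2 * ‖w‖ ^ 2 ≤ r ^ 2 / 2 := by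
      rw [hn]
      nlinarith [sq_nonneg r]
    have h6 : 1 / 8 * ‖w‖ ^ 2 ≤ 2 / π ^ 2 * ‖w‖ ^ 2 := by gcongr
    linarith
  have hx2 : w.re ^ 2 ≤ 4 * r ^ 2 := by nlinarith [sq_nonneg w.im]
  have hy2 : w.im ^ 2 ≤ 4 * r ^ 2 := by nlinarith [sq_nonneg w.re]
  have aux (x : ℝ) (hx : x ^ 2 ≤ 4 * r ^ 2) : (1 - ε) * x ^ 2 / 2 ≤ 1 - Real.cos x := by
    have hx1 : |x| ≤ 1 := by
      rw [← sq_le_one_iff_abs_le_one]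
      nlinarith
    have hb := (abs_le.1 (Real.cos_bound hx1)).2
    have : |x| ^ 4 = x ^ 2 * x ^ 2 := by
      rw [← sq_abs x]; ring
    nlinarith [mul_le_mul_of_nonneg_left (hx.trans hrε) (sq_nonneg x), sq_nonneg x]
  have a1 := aux _ hx2
  have a2 := aux _ hy2
  have : ‖w‖ ^ 2 ≤ r ^ 2 := by
    rw [hn]
    nlinarith
  exact abs_le_of_sq_le_sq' this hr0 |>.2

/-- The periods `2π`, `2πi`. -/
def torusPair : PeriodPair where
  ω₁ := (2 * π : ℝ)
  ω₂ := (2 * π : ℝ) * I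
  indep := by
    rw [LinearIndependent.pair_iff]
    intro s t h
    have hπ := Real.pi_ne_zero
    have h1 := congrArg Complex.re h
    have h2 := congrArg Complex.im h
    simp at h1 h2
    exact ⟨by tauto, by tauto⟩

lemma cosGap_eq_zero_of_mem_lattice {z : ℂ} (hz : z ∈ torusPair.lattice) : cosGap z = 0 := by
  obtain ⟨m, n, rfl⟩ := PeriodPair.mem_lattice.1 hz
  have := periodicC_cosGap.add_lattice m n 0
  rw [zero_add] at this
  refine this.trans ?_
  norm_num [cosGap]

/-- Elliptic functions with a pole of order `j + 2` at the lattice points and no other poles. -/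
def ellip (j : ℕ) (z : ℂ) : ℂ :=
  torusPair.weierstrassP z ^ (j / 2) *
    if Even j then torusPair.weierstrassP z else torusPair.derivWeierstrassP z

lemma periodicC_ellip (j : ℕ) : PeriodicC (ellip j) := fun z => by
  have h1 : ((2 * π : ℝ) : ℂ) ∈ torusPair.lattice := torusPair.ω₁_mem_lattice
  have h2 : ((2 * π : ℝ) : ℂ) * I ∈ torusPair.lattice := torusPair.ω₂_mem_lattice
  have p1 (l : ℂ) (hl : l ∈ torusPair.lattice) := torusPair.weierstrassP_add_coe z ⟨l, hl⟩
  have p2 (l : ℂ) (hl : l ∈ torusPair.lattice) := torusPair.derivWeierstrassP_add_coe z ⟨l, hl⟩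
  simp only [ellip]
  rw [p1 _ h1, p1 _ h2, p2 _ h1, p2 _ h2]
  exact ⟨rfl, rfl⟩

lemma differentiableAt_ellip (j : ℕ) {z : ℂ} (hz : cosGap z ≠ 0) :
    DifferentiableAt ℂ (ellip j) z := by
  have hmem : (torusPair.lattice : Set ℂ)ᶜ ∈ 𝓝 z :=
    torusPair.isClosed_lattice.isOpen_compl.mem_nhds fun h => hz (cosGap_eq_zero_of_mem_lattice h)
  have h1 := torusPair.differentiableOn_weierstrassP.differentiableAt hmem
  have h2 := torusPair.differentiableOn_derivWeierstrassP.differentiableAt hmem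
  unfold ellip
  split_ifs
  · exact (h1.pow _).mul h1
  · exact (h1.pow _).mul h2

lemma tendsto_sq_mul_weierstrassP :
    Filter.Tendsto (fun z => z ^ 2 * torusPair.weierstrassP z) (𝓝[≠] 0) (𝓝 1) := by
  have hc : ContinuousAt (fun z => z ^ 2 * torusPair.weierstrassPExcept 0 z + 1) 0 := by
    have := (torusPair.analyticAt_weierstrassPExcept 0).continuousAt
    fun_prop
  have := hc.tendsto.mono_left (nhdsWithin_le_nhds (s := {0}ᶜ))
  simp only [ne_eq, OfNat.ofNat_ne_zero, not_false_eq_true, zero_pow, zero_mul, zero_add] at this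
  refine this.congr' ?_
  filter_upwards [self_mem_nhdsWithin] with z hz
  have hz0 : z ≠ 0 := hz
  have h1 := torusPair.weierstrassPExcept_add 0 z
  rw [← h1]
  simp
  field_simp

lemma tendsto_cube_mul_derivWeierstrassP :
    Filter.Tendsto (fun z => z ^ 3 * torusPair.derivWeierstrassP z) (𝓝[≠] 0) (𝓝 (-2)) := by
  have hc : ContinuousAt (fun z => z ^ 3 * torusPair.derivWeierstrassPExcept 0 z + -2) 0 := by
    have := (torusPair.analyticAt_derivWeierstrassPExcept 0).continuousAt
    fun_prop
  have := hc.tendsto.mono_left (nhdsWithin_le_nhds (s := {0}ᶜ))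
  simp only [ne_eq, OfNat.ofNat_ne_zero, not_false_eq_true, zero_pow, zero_mul, zero_add] at this
  refine this.congr' ?_
  filter_upwards [self_mem_nhdsWithin] with z hz
  have hz0 : z ≠ 0 := hz
  have h1 := torusPair.derivWeierstrassPExcept_sub 0 z
  rw [← h1]
  simp
  field_simp
  ring

lemma tendsto_pow_mul_ellip (j : ℕ) :
    ∃ C : ℂ, C ≠ 0 ∧ Filter.Tendsto (fun z => z ^ (j + 2) * ellip j z) (𝓝[≠] 0) (𝓝 C) := by
  have hp := tendsto_sq_mul_weierstrassP
  have hd := tendsto_cube_mul_derivWeierstrassP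
  rcases Nat.even_or_odd j with hj | hj
  · refine ⟨1 ^ (j / 2) * 1, by norm_num, ((hp.pow (j / 2)).mul hp).congr fun z => ?_⟩
    have e : j + 2 = 2 * (j / 2) + 2 := by obtain ⟨k, rfl⟩ := hj; omega
    rw [ellip, if_pos hj, e, pow_add, pow_mul, mul_pow]
    ring
  · refine ⟨1 ^ (j / 2) * -2, by norm_num, ((hp.pow (j / 2)).mul hd).congr fun z => ?_⟩
    have e : j + 2 = 2 * (j / 2) + 3 := by obtain ⟨k, rfl⟩ := hj; omega
    rw [ellip, if_neg (Nat.not_even_iff_odd.2 hj), e, pow_add, pow_mul, mul_pow]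
    ring

/-- The truncated barrier `s ↦ s e^{1-s}`, equal to `1` for `s ≥ 1`. -/
def trunc (s : ℝ) : ℝ := min s 1 * Real.exp (1 - min s 1)

lemma continuous_trunc : Continuous trunc := by
  unfold trunc
  fun_prop

lemma trunc_zero : trunc 0 = 0 := by simp [trunc]

lemma trunc_nonneg {s : ℝ} (hs : 0 ≤ s) : 0 ≤ trunc s :=
  mul_nonneg (le_min hs zero_le_one) (Real.exp_nonneg _)

lemma mul_exp_one_sub_le_one (s : ℝ) : s * Real.exp (1 - s) ≤ 1 := by
  have h := Real.add_one_le_exp (s - 1)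
  calc s * Real.exp (1 - s) ≤ Real.exp (s - 1) * Real.exp (1 - s) := by
        gcongr
        linarith
    _ = 1 := by rw [← Real.exp_add]; simp

lemma trunc_le_one (s : ℝ) : trunc s ≤ 1 := mul_exp_one_sub_le_one _

lemma trunc_of_one_le {s : ℝ} (hs : 1 ≤ s) : trunc s = 1 := by simp [trunc, hs]

lemma trunc_of_le_one {s : ℝ} (hs : s ≤ 1) : trunc s = s * Real.exp (1 - s) := by
  simp [trunc, hs]

lemma le_trunc (s : ℝ) : s * Real.exp (1 - s) ≤ trunc s := by
  rcases le_total s 1 with h | h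
  · exact (trunc_of_le_one h).ge
  · exact (mul_exp_one_sub_le_one s).trans (trunc_of_one_le h).ge

lemma trunc_le {s : ℝ} (hs : 0 ≤ s) : trunc s ≤ s * Real.exp 1 := by
  unfold trunc
  have : 0 ≤ min s 1 := le_min hs zero_le_one
  gcongr
  · exact min_le_left _ _
  · linarith

lemma exp_neg_one_le_trunc {s : ℝ} (hs : 1 / 2 ≤ s) : Real.exp (-1) ≤ trunc s := by
  have h1 : 1 / 2 ≤ min s 1 := le_min hs (by norm_num)
  have h2 : min s 1 ≤ 1 := min_le_right _ _
  have h3 : Real.exp (-1) ≤ 1 / 2 := by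
    rw [Real.exp_neg, inv_le_comm₀ (Real.exp_pos _) (by norm_num)]
    have := Real.add_one_le_exp (1 : ℝ)
    norm_num at this ⊢
    exact this
  have h4 : 1 ≤ Real.exp (1 - min s 1) := Real.one_le_exp (by linarith)
  unfold trunc
  nlinarith

/-- Second order condition at a local maximum of `|u|² e^{-2f/h} (c e^{-c/a})^M`, where `u` is
holomorphic. -/
lemma neg_lapC_le_of_isLocalMax {f : ℂ → ℝ} (hf : ContDiff ℝ (⊤ : ℕ∞) f) {u : ℂ → ℂ} {b z₀ : ℂ}
    {a h : ℝ} (ha : 0 < a) (hh : 0 < h) (M : ℕ) (hu : AnalyticAt ℂ u z₀) (hu0 : u z₀ ≠ 0)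
    (hb : cosGap (z₀ - b) ≠ 0)
    (hmax : IsLocalMax (fun z => ‖u z‖ ^ 2 * Real.exp (-2 * f z / h) *
      (cosGap (z - b) * Real.exp (-(cosGap (z - b) / a))) ^ M) z₀) :
    -2 * lapC f z₀ ≤ M * h * (1 / 2 + 2 / a) := by
  set L : ℂ → ℝ := fun z => Real.log ‖u z‖
  set B : ℂ → ℝ := fun w => Real.log (cosGap (w - b)) - cosGap (w - b) / a with hB
  have hL := hu.harmonicAt_log_norm hu0
  have hL2 : ContDiffAt ℝ 2 L z₀ := hL.1
  have hL0 : lapC L z₀ = 0 := by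
    rw [lapC_eq_laplacian hL2]
    exact hL.2.self_of_nhds
  have hcg : ContDiffAt ℝ 2 (fun w => cosGap (w - b)) z₀ :=
    (contDiff_cosGap.comp (contDiff_id.sub contDiff_const)).contDiffAt_two
  have hB2 : ContDiffAt ℝ 2 B z₀ := (hcg.log hb).sub (hcg.div_const a)
  have hf2 : ContDiffAt ℝ 2 f z₀ := hf.contDiffAt_two
  set G : ℂ → ℝ := fun z => 2 * L z + ((-2 / h) * f z + M * B z) with hG
  have hG2 : ContDiffAt ℝ 2 G z₀ :=
    (contDiffAt_const.mul hL2).add ((contDiffAt_const.mul hf2).add (contDiffAt_const.mul hB2))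
  have hlap : lapC G z₀ = (-2 / h) * lapC f z₀ + M * lapC B z₀ := by
    rw [hG, lapC_add (contDiffAt_const.mul hL2)
      ((contDiffAt_const.mul hf2).add (contDiffAt_const.mul hB2)),
      lapC_add (contDiffAt_const.mul hf2) (contDiffAt_const.mul hB2), lapC_const_mul _ hL2,
      lapC_const_mul _ hf2, lapC_const_mul _ hB2, hL0]
    ring
  have hexp {z : ℂ} (h1 : u z ≠ 0) (h2 : cosGap (z - b) ≠ 0) :
      ‖u z‖ ^ 2 * Real.exp (-2 * f z / h) *
      (cosGap (z - b) * Real.exp (-(cosGap (z - b) / a))) ^ M = Real.exp (G z) := by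
    have p1 : 0 < ‖u z‖ := norm_pos_iff.2 h1
    have p2 : 0 < cosGap (z - b) := lt_of_le_of_ne (cosGap_nonneg _) h2.symm
    have e1 : ‖u z‖ ^ 2 = Real.exp (2 * L z) := by
      have := Real.exp_nat_mul (L z) 2
      push_cast at this
      rw [this, Real.exp_log p1]
    have e2 : cosGap (z - b) * Real.exp (-(cosGap (z - b) / a)) = Real.exp (B z) := by
      rw [hB, Real.exp_sub, Real.exp_log p2, Real.exp_neg]
      rfl
    rw [e1, e2, ← Real.exp_nat_mul, ← Real.exp_add, ← Real.exp_add]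
    congr 1
    simp only [hG]
    ring
  have hGmax : IsLocalMax G z₀ := by
    have n1 : ∀ᶠ z in 𝓝 z₀, u z ≠ 0 := hu.continuousAt.eventually_ne hu0
    have n2 : ∀ᶠ z in 𝓝 z₀, cosGap (z - b) ≠ 0 := hcg.continuousAt.eventually_ne hb
    filter_upwards [hmax, n1, n2] with z hz h1 h2
    rw [hexp h1 h2, hexp hu0 hb] at hz
    exact Real.exp_le_exp.1 hz
  have hle := hGmax.lapC_nonpos hG2
  rw [hlap] at hle
  have hBl := le_lapC_barrier ha hb
  have : (-2 / h) * lapC f z₀ ≤ M * (1 / 2 + 2 / a) := by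
    have : (M : ℝ) * -(1 / 2 + 2 / a) ≤ M * lapC B z₀ := by gcongr
    linarith
  calc -2 * lapC f z₀ = h * ((-2 / h) * lapC f z₀) := by field_simp
    _ ≤ h * (M * (1 / 2 + 2 / a)) := by gcongr
    _ = _ := by ring

/-- A finite family of sublevel sets of translates of `cosGap`, disjoint and placed in the region
where the weight `f` lies far below `φ`. -/
structure Packing (φ f : ℂ → ℝ) (τ η : ℝ) (ι : Type) where
  /-- The centres. -/
  b : ι → ℂ
  /-- The sizes. -/
  a : ι → ℝ
  /-- The masses. -/
  m : ι → ℝ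
  a_pos : ∀ i, 0 < a i
  m_pos : ∀ i, 0 < m i
  m_le : ∀ i, m i ≤ η
  disj : ∀ z i j, cosGap (z - b i) ≤ a i → cosGap (z - b j) ≤ a j → i = j
  low : ∀ z i, cosGap (z - b i) ≤ a i → f z < φ z - τ - 10 * η
  lap : ∀ z i, cosGap (z - b i) ≤ a i → m i * (1 / 2 + 2 / a i) < -2 * lapC f z

/-- Periodic functions which are holomorphic except for poles of order `< N i` at the points of
`b i` plus the lattice. -/
structure IsPolar {ι : Type} (b : ι → ℂ) (N : ι → ℕ) (u : ℂ → ℂ) : Prop where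
  per : PeriodicC u
  diff : ∀ z, (∀ i, cosGap (z - b i) ≠ 0) → DifferentiableAt ℂ u z
  pole : ∀ i, Filter.Tendsto (fun z => (z - b i) ^ N i * u z) (𝓝[≠] (b i)) (𝓝 0)

namespace IsPolar

variable {ι : Type} [Fintype ι] {b : ι → ℂ} {N : ι → ℕ} {u : ℂ → ℂ}

lemma analyticAt (hu : IsPolar b N u) {z : ℂ} (hz : ∀ i, cosGap (z - b i) ≠ 0) :
    AnalyticAt ℂ u z := by
  rw [Complex.analyticAt_iff_eventually_differentiableAt]
  have : ∀ᶠ w in 𝓝 z, ∀ i, cosGap (w - b i) ≠ 0 := Filter.eventually_all.2 fun i =>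
    (continuous_cosGap.comp (continuous_id.sub continuous_const)).continuousAt.eventually_ne (hz i)
  exact this.mono fun w hw => hu.diff w hw

end IsPolar

/-- The weighted modulus to which the maximum principle is applied. -/
def polarMod {ι : Type} [Fintype ι] (f : ℂ → ℝ) (h : ℝ) (b : ι → ℂ) (a : ι → ℝ) (N : ι → ℕ)
    (u : ℂ → ℂ) (z : ℂ) : ℝ :=
  ‖u z‖ ^ 2 * Real.exp (-2 * f z / h) * ∏ i, trunc (cosGap (z - b i) / a i) ^ N i

lemma trunc_div_nonneg {ι : Type} {b : ι → ℂ} {a : ι → ℝ} (ha : ∀ i, 0 < a i) (z : ℂ) (i : ι) :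
    0 ≤ trunc (cosGap (z - b i) / a i) :=
  trunc_nonneg (div_nonneg (cosGap_nonneg _) (ha i).le)

section

variable {ι : Type} [Fintype ι] {b : ι → ℂ} {a : ι → ℝ} {N : ι → ℕ} {u : ℂ → ℂ} {f : ℂ → ℝ} {h : ℝ}

lemma prod_trunc_le (ha : ∀ i, 0 < a i) (z : ℂ) (i : ι) :
    ∏ j, trunc (cosGap (z - b j) / a j) ^ N j ≤ trunc (cosGap (z - b i) / a i) ^ N i := by
  classical
  rw [← Finset.mul_prod_erase _ _ (Finset.mem_univ i)]
  refine mul_le_of_le_one_right (pow_nonneg (trunc_div_nonneg ha z i) _) ?_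
  exact Finset.prod_le_one (fun j _ => pow_nonneg (trunc_div_nonneg ha z j) _)
    fun j _ => pow_le_one₀ (trunc_div_nonneg ha z j) (trunc_le_one _)

lemma prod_trunc_le_one (ha : ∀ i, 0 < a i) (z : ℂ) :
    ∏ j, trunc (cosGap (z - b j) / a j) ^ N j ≤ 1 :=
  Finset.prod_le_one (fun j _ => pow_nonneg (trunc_div_nonneg ha z j) _)
    fun j _ => pow_le_one₀ (trunc_div_nonneg ha z j) (trunc_le_one _)

lemma prod_trunc_nonneg (ha : ∀ i, 0 < a i) (z : ℂ) :
    0 ≤ ∏ j, trunc (cosGap (z - b j) / a j) ^ N j :=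
  Finset.prod_nonneg fun j _ => pow_nonneg (trunc_div_nonneg ha z j) _

lemma polarMod_nonneg (ha : ∀ i, 0 < a i) (z : ℂ) : 0 ≤ polarMod f h b a N u z :=
  mul_nonneg (by positivity) (prod_trunc_nonneg ha z)

/-- If `z` is in no other sublevel set, only the `i`-th factor is present. -/
lemma prod_trunc_eq (ha : ∀ i, 0 < a i) {z : ℂ} {i : ι}
    (hz : ∀ j, j ≠ i → a j ≤ cosGap (z - b j)) :
    ∏ j, trunc (cosGap (z - b j) / a j) ^ N j = trunc (cosGap (z - b i) / a i) ^ N i := by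
  refine Finset.prod_eq_single i (fun j _ hj => ?_) (by simp)
  rw [trunc_of_one_le ((one_le_div (ha j)).2 (hz j hj)), one_pow]

lemma prod_trunc_eq_one (ha : ∀ i, 0 < a i) {z : ℂ} (hz : ∀ j, a j ≤ cosGap (z - b j)) :
    ∏ j, trunc (cosGap (z - b j) / a j) ^ N j = 1 := by
  refine Finset.prod_eq_one fun j _ => ?_
  rw [trunc_of_one_le ((one_le_div (ha j)).2 (hz j)), one_pow]

lemma periodicC_polarMod (hf : PeriodicC f) (hu : PeriodicC u) :
    PeriodicC (polarMod f h b a N u) := fun z => by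
  have hc (w z : ℂ) : cosGap (z + (2 * π : ℝ) - w) = cosGap (z - w) ∧
      cosGap (z + (2 * π : ℝ) * I - w) = cosGap (z - w) := by
    have := periodicC_cosGap (z - w)
    exact ⟨by rw [← this.1]; congr 1; ring, by rw [← this.2]; congr 1; ring⟩
  simp only [polarMod, (hc _ z).1, (hc _ z).2, (hf z).1, (hf z).2, (hu z).1, (hu z).2, and_self]

lemma continuous_polarMod (hf : Continuous f) (hfp : PeriodicC f) (ha : ∀ i, 0 < a i)
    (hN : ∀ i, N i ≠ 0) (hu : IsPolar b N u) : Continuous (polarMod f h b a N u) := by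
  have hcg (i : ι) : Continuous fun z => cosGap (z - b i) :=
    continuous_cosGap.comp (continuous_id.sub continuous_const)
  have hprod : Continuous fun z => ∏ i, trunc (cosGap (z - b i) / a i) ^ N i :=
    continuous_finsetProd _ fun i _ => (continuous_trunc.comp ((hcg i).div_const _)).pow _
  have hexp : Continuous fun z => Real.exp (-2 * f z / h) := by fun_prop
  have hper := periodicC_polarMod (h := h) (b := b) (a := a) (N := N) hfp hu.per
  have hpole (i : ι) : ContinuousAt (polarMod f h b a N u) (b i) := by
    have h0 : polarMod f h b a N u (b i) = 0 := by
      rw [polarMod]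
      refine mul_eq_zero_of_right _ (Finset.prod_eq_zero (Finset.mem_univ i) ?_)
      have : cosGap (b i - b i) = 0 := by norm_num [cosGap]
      rw [this, zero_div, trunc_zero, zero_pow (hN i)]
    rw [continuousAt_iff_punctured_nhds, h0]
    set K := (Real.exp 1 / (2 * a i)) ^ N i
    have hlim : Filter.Tendsto (fun z => ‖(z - b i) ^ N i * u z‖ ^ 2 *
        (Real.exp (-2 * f z / h) * K)) (𝓝[≠] (b i)) (𝓝 0) := by
      have h1 := ((hu.pole i).norm.pow 2).mul
        ((hexp.mul continuous_const).continuousAt.tendsto.mono_left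
          (nhdsWithin_le_nhds (a := b i) (s := {b i}ᶜ)) (f := fun z =>
            Real.exp (-2 * f z / h) * K))
      simpa using h1
    refine squeeze_zero (fun z => polarMod_nonneg ha z) (fun z => ?_) hlim
    have h1 : trunc (cosGap (z - b i) / a i) ^ N i ≤ (‖z - b i‖ ^ N i) ^ 2 * K := by
      have h2 : trunc (cosGap (z - b i) / a i) ≤ ‖z - b i‖ ^ 2 * (Real.exp 1 / (2 * a i)) := by
        refine (trunc_le (div_nonneg (cosGap_nonneg _) (ha i).le)).trans ?_
        have := cosGap_le (z - b i)
        have hai := ha i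
        calc cosGap (z - b i) / a i * Real.exp 1 ≤ ‖z - b i‖ ^ 2 / 2 / a i * Real.exp 1 := by
              gcongr
          _ = _ := by field_simp
      calc trunc (cosGap (z - b i) / a i) ^ N i
          ≤ (‖z - b i‖ ^ 2 * (Real.exp 1 / (2 * a i))) ^ N i :=
            pow_le_pow_left₀ (trunc_div_nonneg ha z i) h2 _
        _ = _ := by rw [mul_pow]; ring
    calc polarMod f h b a N u z
        ≤ ‖u z‖ ^ 2 * Real.exp (-2 * f z / h) * ((‖z - b i‖ ^ N i) ^ 2 * K) := by
          unfold polarMod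
          gcongr
          exact (prod_trunc_le ha z i).trans h1
      _ = _ := by rw [norm_mul, norm_pow]; ring
  refine continuous_iff_continuousAt.2 fun z => ?_
  by_cases hz : ∀ i, cosGap (z - b i) ≠ 0
  · exact (((hu.diff z hz).continuousAt.norm.pow 2).mul hexp.continuousAt).mul hprod.continuousAt
  · push Not at hz
    obtain ⟨i, hi⟩ := hz
    obtain ⟨k, l, hkl⟩ := exists_lattice_eq_of_cosGap_eq_zero hi
    have heq : polarMod f h b a N u = fun w => polarMod f h b a N u (w - (z - b i)) := by
      funext w
      rw [← hper.add_lattice k l (w - (z - b i)), hkl]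
      congr 1
      ring
    rw [heq]
    have h1 : ContinuousAt (fun w => w - (z - b i)) z := by fun_prop
    have h2 : ContinuousAt (polarMod f h b a N u) (z - (z - b i)) := by simpa using hpole i
    exact ContinuousAt.comp (g := polarMod f h b a N u) h2 h1

end

/-- Maximum principle: the weighted modulus is maximal where `f ≥ φ - η`. -/
lemma Packing.exists_max {ι : Type} [Fintype ι] {φ f : ℂ → ℝ} {τ η h : ℝ}
    (p : Packing φ f τ η ι)
    (hf : ContDiff ℝ (⊤ : ℕ∞) f) (hfp : PeriodicC f)
    (hlap : ∀ z, f z < φ z - η → lapC f z < 0) (hh : 0 < h) {N : ι → ℕ} (hN : ∀ i, N i ≠ 0)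
    (hNm : ∀ i, N i * h ≤ p.m i) {u : ℂ → ℂ} (hu : IsPolar p.b N u) :
    ∃ z₀, (∀ z, polarMod f h p.b p.a N u z ≤ polarMod f h p.b p.a N u z₀) ∧
      (polarMod f h p.b p.a N u z₀ = 0 ∨ φ z₀ - η ≤ f z₀) := by
  have ha := p.a_pos
  obtain ⟨z₀, hz₀⟩ := (periodicC_polarMod (h := h) (b := p.b) (a := p.a) (N := N) hfp
    hu.per).exists_isMax (continuous_polarMod hf.continuous hfp ha hN hu)
  refine ⟨z₀, hz₀, ?_⟩
  by_contra! hcon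
  obtain ⟨hne, hlow⟩ := hcon
  have hu0 : u z₀ ≠ 0 := fun h0 => hne (by simp [polarMod, h0])
  have hcg (i : ι) : cosGap (z₀ - p.b i) ≠ 0 := fun h0 => hne (by
    rw [polarMod]
    refine mul_eq_zero_of_right _ (Finset.prod_eq_zero (Finset.mem_univ i) ?_)
    rw [h0, zero_div, trunc_zero, zero_pow (hN i)])
  have han := hu.analyticAt hcg
  have hcont (i : ι) : Continuous fun z => cosGap (z - p.b i) :=
    continuous_cosGap.comp (continuous_id.sub continuous_const)
  by_cases hcase : ∃ i, cosGap (z₀ - p.b i) ≤ p.a i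
  · obtain ⟨i, hi⟩ := hcase
    have hev : ∀ᶠ z in 𝓝 z₀, ∀ j, j ≠ i → p.a j ≤ cosGap (z - p.b j) := by
      refine Filter.eventually_all.2 fun j => ?_
      by_cases hj : j = i
      · simp [hj]
      have : p.a j < cosGap (z₀ - p.b j) := by
        by_contra! hle
        exact hj (p.disj z₀ j i hle hi)
      filter_upwards [(hcont j).continuousAt.eventually (lt_mem_nhds this)] with z hz _
      exact hz.le
    have hai := ha i
    set K := (Real.exp 1 / p.a i) ^ N i with hK
    have hK0 : 0 < K := by positivity
    have hform (z : ℂ) : (cosGap (z - p.b i) / p.a i * Real.exp (1 - cosGap (z - p.b i) / p.a i))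
        ^ N i = (cosGap (z - p.b i) * Real.exp (-(cosGap (z - p.b i) / p.a i))) ^ N i * K := by
      rw [hK, ← mul_pow, Real.exp_sub, Real.exp_neg]
      congr 1
      field_simp
    have hmax : IsLocalMax (fun z => ‖u z‖ ^ 2 * Real.exp (-2 * f z / h) *
        (cosGap (z - p.b i) * Real.exp (-(cosGap (z - p.b i) / p.a i))) ^ N i) z₀ := by
      filter_upwards [hev] with z hz
      refine le_of_mul_le_mul_right ?_ hK0
      rw [mul_assoc (‖u z‖ ^ 2 * _), ← hform z, mul_assoc (‖u z₀‖ ^ 2 * _), ← hform z₀]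
      calc ‖u z‖ ^ 2 * Real.exp (-2 * f z / h) *
            (cosGap (z - p.b i) / p.a i * Real.exp (1 - cosGap (z - p.b i) / p.a i)) ^ N i
          ≤ ‖u z‖ ^ 2 * Real.exp (-2 * f z / h) * trunc (cosGap (z - p.b i) / p.a i) ^ N i := by
            have h0 := cosGap_nonneg (z - p.b i)
            gcongr
            exact le_trunc _
        _ = polarMod f h p.b p.a N u z := by rw [polarMod, prod_trunc_eq ha hz]
        _ ≤ polarMod f h p.b p.a N u z₀ := hz₀ z
        _ = _ := by
            rw [polarMod, prod_trunc_eq ha hev.self_of_nhds,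
              trunc_of_le_one ((div_le_one hai).2 hi)]
    have h1 := neg_lapC_le_of_isLocalMax hf hai hh (N i) han hu0 (hcg i) hmax
    have h2 := p.lap z₀ i hi
    have h3 : N i * h * (1 / 2 + 2 / p.a i) ≤ p.m i * (1 / 2 + 2 / p.a i) := by
      gcongr
      exact hNm i
    linarith
  · push Not at hcase
    have hev : ∀ᶠ z in 𝓝 z₀, ∀ j, p.a j ≤ cosGap (z - p.b j) :=
      Filter.eventually_all.2 fun j =>
        ((hcont j).continuousAt.eventually (lt_mem_nhds (hcase j))).mono fun z hz => hz.le
    have hb : cosGap (z₀ - (z₀ - π)) ≠ 0 := by norm_num [cosGap]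
    have hmax : IsLocalMax (fun z => ‖u z‖ ^ 2 * Real.exp (-2 * f z / h) *
        (cosGap (z - (z₀ - π)) * Real.exp (-(cosGap (z - (z₀ - π)) / 1))) ^ 0) z₀ := by
      filter_upwards [hev] with z hz
      have h1 := hz₀ z
      rw [polarMod, polarMod, prod_trunc_eq_one ha hz, prod_trunc_eq_one ha hev.self_of_nhds] at h1
      simpa using h1
    have h1 := neg_lapC_le_of_isLocalMax hf one_pos hh 0 han hu0 hb hmax
    have h2 := hlap z₀ hlow
    norm_num at h1
    linarith

/-- Sub-mean value estimate for functions holomorphic near `z₀`. -/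
lemma normSq_mul_exp_le_wInt {φ : ℂ → ℝ} (hp : PeriodicC φ) (hφ : Continuous φ) {w : ℂ → ℂ}
    (hw : ContDiff ℝ (⊤ : ℕ∞) w) (hwp : PeriodicC w) {z₀ : ℂ} {δ η h : ℝ} (hδ : 0 < δ)
    (hδπ : δ ≤ π) (hh : 0 < h) (hd : ∀ z ∈ Metric.closedBall z₀ δ, dbar w z = 0)
    (hη : ∀ z ∈ Metric.closedBall z₀ δ, φ z ≤ φ z₀ + η) :
    ‖w z₀‖ ^ 2 * Real.exp (-2 * φ z₀ / h) ≤
      4 / (π * δ ^ 2) * (Real.exp (2 * η / h) * wInt φ h w) := by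
  have hwc : ContDiff ℝ 1 fun x => w (z₀ + x) :=
    (hw.of_le (by norm_cast)).comp (contDiff_const.add contDiff_id)
  have h0 := normSq_le_disc_add hwc hδ one_pos (show 0 < 1 / δ ^ 2 by positivity)
  have hz : ∫ t in (0 : ℝ)..δ, ∫ θ in (-π)..π,
      ‖dbar (fun x => w (z₀ + x)) (circleMap 0 t θ)‖ ^ 2 = 0 := by
    rw [intervalIntegral.integral_congr (g := fun _ => (0 : ℝ))]
    · simp
    · intro t ht
      rw [Set.uIcc_of_le hδ.le] at ht
      have : ∀ θ : ℝ, ‖dbar (fun x => w (z₀ + x)) (circleMap 0 t θ)‖ ^ 2 = 0 := fun θ => by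
        rw [dbar_comp_const_add, hd]
        · simp
        · simp [abs_of_nonneg ht.1, ht.2]
      simp [this]
  rw [hz, mul_zero, add_zero, add_zero] at h0
  have hGc := continuous_wInt_integrand hφ hw.continuous h
  have h1 : (∫ x in Metric.closedBall 0 δ, ‖w (z₀ + x)‖ ^ 2 *
      Real.exp (-(1 / δ ^ 2) * ‖x‖ ^ 2)) * Real.exp (-2 * φ z₀ / h) ≤
      ∫ x in Metric.closedBall 0 δ, Real.exp (2 * η / h) *
        (‖w (x + z₀)‖ ^ 2 * Real.exp (-2 * φ (x + z₀) / h)) := by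
    rw [← integral_mul_const]
    refine setIntegral_mono_on
        (ContinuousOn.integrableOn_compact (isCompact_closedBall _ _)
          (Continuous.continuousOn ?_))
        (ContinuousOn.integrableOn_compact (isCompact_closedBall _ _)
          (Continuous.continuousOn ?_))
        Metric.isClosed_closedBall.measurableSet fun x hx => ?_
    · have := hwc.continuous
      fun_prop
    · exact continuous_const.mul (hGc.comp (continuous_add_const z₀))
    · have hx' : ‖x‖ ≤ δ := by simpa using hx
      have h2 : φ (x + z₀) ≤ φ z₀ + η := hη _ (by simpa using hx')
      have h3 : Real.exp (-(1 / δ ^ 2) * ‖x‖ ^ 2) ≤ 1 :=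
        Real.exp_le_one_iff.2 (by rw [neg_mul]; exact neg_nonpos.2 (by positivity))
      have h4 : Real.exp (-2 * φ z₀ / h) ≤
          Real.exp (2 * η / h) * Real.exp (-2 * φ (x + z₀) / h) := by
        rw [← Real.exp_add, ← add_div]
        refine Real.exp_le_exp.2 ?_
        gcongr
        linarith
      rw [add_comm z₀ x]
      calc ‖w (x + z₀)‖ ^ 2 * Real.exp (-(1 / δ ^ 2) * ‖x‖ ^ 2) * Real.exp (-2 * φ z₀ / h)
          ≤ ‖w (x + z₀)‖ ^ 2 * 1 *
            (Real.exp (2 * η / h) * Real.exp (-2 * φ (x + z₀) / h)) := by gcongr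
        _ = _ := by ring
  have h5 : (∫ x in Metric.closedBall 0 δ, Real.exp (2 * η / h) *
      (‖w (x + z₀)‖ ^ 2 * Real.exp (-2 * φ (x + z₀) / h))) ≤
      Real.exp (2 * η / h) * wInt φ h w := by
    rw [integral_const_mul]
    refine mul_le_mul_of_nonneg_left ?_ (by positivity)
    have h9 := ((hp.wInt_integrand hwp h).shift z₀).setIntegral_ball_le
      (hGc.comp (continuous_add_const z₀)) (fun _ => by positivity) 0 hδπ
    rw [setIntegral_congr_set (ball_ae_eq_closedBall 0 δ)] at h9
    exact h9.trans_eq ((hp.wInt_integrand hwp h).setIntegral_shift hGc z₀)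
  calc ‖w z₀‖ ^ 2 * Real.exp (-2 * φ z₀ / h)
      ≤ ((1 + 1) / π * (1 / δ ^ 2 + 1 / δ ^ 2) * ∫ x in Metric.closedBall 0 δ,
          ‖w (z₀ + x)‖ ^ 2 * Real.exp (-(1 / δ ^ 2) * ‖x‖ ^ 2)) * Real.exp (-2 * φ z₀ / h) := by
        gcongr
    _ = 4 / (π * δ ^ 2) * ((∫ x in Metric.closedBall 0 δ, ‖w (z₀ + x)‖ ^ 2 *
        Real.exp (-(1 / δ ^ 2) * ‖x‖ ^ 2)) * Real.exp (-2 * φ z₀ / h)) := by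
        field_simp
        ring
    _ ≤ _ := by
        exact mul_le_mul_of_nonneg_left (h1.trans h5) (by positivity)

/-- Smooth periodic cutoff vanishing near the poles. -/
def cutoff {ι : Type} [Fintype ι] (b : ι → ℂ) (a : ι → ℝ) (z : ℂ) : ℝ :=
  ∏ i, Real.smoothTransition (2 * (cosGap (z - b i) / a i) - 1)

section cutoff

variable {ι : Type} {b : ι → ℂ} {a : ι → ℝ}

lemma eventually_cosGap_lt {z : ℂ} {i : ι} {s : ℝ} (hz : cosGap (z - b i) < s) :
    ∀ᶠ w in 𝓝 z, cosGap (w - b i) < s :=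
  (continuous_cosGap.comp (continuous_id.sub continuous_const)).continuousAt.eventually
      (gt_mem_nhds hz)

lemma cosGap_ne_zero_of_half_le (ha : ∀ i, 0 < a i) {z : ℂ}
    (hz : ∀ i, a i / 2 ≤ cosGap (z - b i)) (i : ι) : cosGap (z - b i) ≠ 0 :=
  (lt_of_lt_of_le (half_pos (ha i)) (hz i)).ne'

variable [Fintype ι]

lemma contDiff_cutoff : ContDiff ℝ (⊤ : ℕ∞) (cutoff b a) := by
  refine contDiff_prod fun i _ => Real.smoothTransition.contDiff.comp ?_
  have : ContDiff ℝ (⊤ : ℕ∞) fun z => cosGap (z - b i) :=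
    contDiff_cosGap.comp (contDiff_id.sub contDiff_const)
  fun_prop

lemma periodicC_cutoff : PeriodicC (cutoff b a) := fun z => by
  have hc (w z : ℂ) : cosGap (z + (2 * π : ℝ) - w) = cosGap (z - w) ∧
      cosGap (z + (2 * π : ℝ) * I - w) = cosGap (z - w) := by
    have := periodicC_cosGap (z - w)
    exact ⟨by rw [← this.1]; congr 1; ring, by rw [← this.2]; congr 1; ring⟩
  simp only [cutoff, (hc _ z).1, (hc _ z).2, and_self]

lemma cutoff_eq_one (ha : ∀ i, 0 < a i) {z : ℂ} (hz : ∀ i, a i ≤ cosGap (z - b i)) :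
    cutoff b a z = 1 := by
  refine Finset.prod_eq_one fun i _ => Real.smoothTransition.one_of_one_le ?_
  have := (one_le_div (ha i)).2 (hz i)
  linarith

lemma cutoff_eq_zero (ha : ∀ i, 0 < a i) {z : ℂ} {i : ι} (hz : cosGap (z - b i) ≤ a i / 2) :
    cutoff b a z = 0 := by
  refine Finset.prod_eq_zero (Finset.mem_univ i) (Real.smoothTransition.zero_of_nonpos ?_)
  have : cosGap (z - b i) / a i ≤ 1 / 2 := by
    rw [div_le_iff₀ (ha i)]
    linarith
  linarith

lemma eventually_lt_cosGap {z : ℂ} (hz : ∀ i, a i < cosGap (z - b i)) :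
    ∀ᶠ w in 𝓝 z, ∀ i, a i < cosGap (w - b i) :=
  Filter.eventually_all.2 fun i =>
    (continuous_cosGap.comp (continuous_id.sub continuous_const)).continuousAt.eventually
      (lt_mem_nhds (hz i))

end cutoff

lemma dbar_congr {u v : ℂ → ℂ} {z : ℂ} (h : u =ᶠ[𝓝 z] v) : dbar u z = dbar v z := by
  simp only [dbar, h.fderiv_eq]

lemma dbar_const (c z : ℂ) : dbar (fun _ => c) z = 0 := by simp [dbar]

lemma dbar_eq_zero {u : ℂ → ℂ} {z : ℂ} (hu : DifferentiableAt ℂ u z) : dbar u z = 0 := by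
  have := dbar_mul_of_differentiable (w := fun _ => 1) (differentiableAt_const _) hu
  simpa [dbar_const] using this

namespace IsPolar

variable {ι : Type} [Fintype ι] {b : ι → ℂ} {N : ι → ℕ} {u : ℂ → ℂ} {a : ι → ℝ}

lemma contDiff_cutoff_mul (hu : IsPolar b N u) (ha : ∀ i, 0 < a i) :
    ContDiff ℝ (⊤ : ℕ∞) fun z => (cutoff b a z : ℂ) * u z := by
  refine contDiff_iff_contDiffAt.2 fun z => ?_
  by_cases hz : ∀ i, a i / 2 ≤ cosGap (z - b i)
  · have h1 : ContDiff ℝ (⊤ : ℕ∞) fun z => (cutoff b a z : ℂ) :=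
      Complex.ofRealCLM.contDiff.comp contDiff_cutoff
    have h2 : ContDiffAt ℂ (⊤ : ℕ∞) u z := (hu.analyticAt (cosGap_ne_zero_of_half_le ha hz)).contDiffAt
    exact h1.contDiffAt.mul (h2.restrict_scalars ℝ)
  · push Not at hz
    obtain ⟨i, hi⟩ := hz
    refine (contDiffAt_const (c := (0 : ℂ))).congr_of_eventuallyEq ?_
    filter_upwards [eventually_cosGap_lt hi] with w hw
    simp [cutoff_eq_zero ha hw.le]

lemma periodicC_cutoff_mul (hu : IsPolar b N u) : PeriodicC fun z => (cutoff b a z : ℂ) * u z :=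
  periodicC_cutoff.comp₂ hu.per fun x y => (x : ℂ) * y

lemma dbar_cutoff_mul_eq_zero (hu : IsPolar b N u) (ha : ∀ i, 0 < a i) {z : ℂ}
    (hz : ∀ i, a i < cosGap (z - b i)) :
    dbar (fun z => (cutoff b a z : ℂ) * u z) z = 0 := by
  have : (fun z => (cutoff b a z : ℂ) * u z) =ᶠ[𝓝 z] u := by
    filter_upwards [eventually_lt_cosGap hz] with w hw
    simp [cutoff_eq_one ha fun i => (hw i).le]
  rw [dbar_congr this]
  exact dbar_eq_zero (hu.diff z fun i => ((ha i).trans (hz i)).ne')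

lemma dbar_cutoff_mul_eq_zero' (ha : ∀ i, 0 < a i) {z : ℂ} {i : ι}
    (hz : cosGap (z - b i) < a i / 2) :
    dbar (fun z => (cutoff b a z : ℂ) * u z) z = 0 := by
  have : (fun z => (cutoff b a z : ℂ) * u z) =ᶠ[𝓝 z] fun _ => 0 := by
    filter_upwards [eventually_cosGap_lt hz] with w hw
    simp [cutoff_eq_zero ha hw.le]
  rw [dbar_congr this, dbar_const]

lemma dbar_cutoff_mul (hu : IsPolar b N u) (ha : ∀ i, 0 < a i) {z : ℂ}
    (hz : ∀ i, a i / 2 ≤ cosGap (z - b i)) :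
    dbar (fun z => (cutoff b a z : ℂ) * u z) z = dbar (fun z => (cutoff b a z : ℂ)) z * u z := by
  have h1 : ContDiff ℝ (⊤ : ℕ∞) fun z => (cutoff b a z : ℂ) :=
    Complex.ofRealCLM.contDiff.comp contDiff_cutoff
  exact dbar_mul_of_differentiable (h1.contDiffAt.differentiableAt (by simp))
    (hu.diff z (cosGap_ne_zero_of_half_le ha hz))

end IsPolar

lemma tendsto_pow_mul_ellip_zero {j K : ℕ} (hj : j + 2 < K) :
    Filter.Tendsto (fun z => z ^ K * ellip j z) (𝓝[≠] 0) (𝓝 0) := by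
  obtain ⟨C, -, hC⟩ := tendsto_pow_mul_ellip j
  have h0 : Filter.Tendsto (fun z : ℂ => z ^ (K - (j + 2))) (𝓝[≠] 0) (𝓝 0) := by
    have := (continuous_pow (M := ℂ) (K - (j + 2))).tendsto 0
    rw [zero_pow (by omega)] at this
    exact this.mono_left nhdsWithin_le_nhds
  have := h0.mul hC
  rw [zero_mul] at this
  refine this.congr fun z => ?_
  rw [← mul_assoc, ← pow_add]
  congr 2
  omega

lemma tendsto_sub_nhdsNE (b : ℂ) : Filter.Tendsto (fun z => z - b) (𝓝[≠] b) (𝓝[≠] 0) := by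
  refine tendsto_nhdsWithin_iff.2 ⟨?_, ?_⟩
  · have : Filter.Tendsto (fun z => z - b) (𝓝 b) (𝓝 (b - b)) :=
      (continuous_id.sub continuous_const).tendsto b
    rw [sub_self] at this
    exact this.mono_left nhdsWithin_le_nhds
  · filter_upwards [self_mem_nhdsWithin] with z hz
    exact sub_ne_zero.2 hz

lemma eq_zero_of_cosGap_eq_zero {z : ℂ} (h0 : cosGap z = 0) (h1 : ‖z‖ < 1) : z = 0 := by
  obtain ⟨m, n, hmn⟩ := exists_lattice_eq_of_cosGap_eq_zero h0
  have key {k : ℤ} {x : ℝ} (hx : x = k * (2 * π)) (hx1 : |x| < 1) : x = 0 := by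
    rcases eq_or_ne k 0 with rfl | hk
    · simpa using hx
    · have h2 : (1 : ℝ) ≤ |(k : ℝ)| := by exact_mod_cast Int.one_le_abs hk
      rw [hx, abs_mul, abs_of_pos Real.two_pi_pos] at hx1
      nlinarith [Real.pi_gt_three]
  refine Complex.ext (key (k := m) ?_ ((Complex.abs_re_le_norm z).trans_lt h1))
    (key (k := n) ?_ ((Complex.abs_im_le_norm z).trans_lt h1))
  · rw [hmn]; simp
  · rw [hmn]; simp

/-- Linear combinations of elliptic functions with poles at the points `b i`. -/
def polarComb {ι : Type} [Fintype ι] (b : ι → ℂ) (N : ι → ℕ) (c : ((i : ι) × Fin (N i - 2)) → ℂ)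
    (z : ℂ) : ℂ :=
  ∑ p, c p * ellip p.2 (z - b p.1)

section polarComb

variable {ι : Type} {b : ι → ℂ} {N : ι → ℕ}

lemma tendsto_pow_mul_ellip_sub (hb : ∀ i j, cosGap (b i - b j) = 0 → i = j) {i k : ι} {K j : ℕ}
    (hK : K ≠ 0) (h : k = i → j + 2 < K) :
    Filter.Tendsto (fun z => (z - b i) ^ K * ellip j (z - b k)) (𝓝[≠] (b i)) (𝓝 0) := by
  by_cases hk : k = i
  · subst hk
    exact (tendsto_pow_mul_ellip_zero (h rfl)).comp (tendsto_sub_nhdsNE (b k))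
  · have h1 : ContinuousAt (fun z => (z - b i) ^ K * ellip j (z - b k)) (b i) := by
      have h2 : ContinuousAt (ellip j) (b i - b k) :=
        (differentiableAt_ellip j fun h0 => hk (hb _ _ h0).symm).continuousAt
      have h3 : ContinuousAt (fun z => ellip j (z - b k)) (b i) :=
        ContinuousAt.comp (f := fun z => z - b k) h2 (by fun_prop)
      exact ContinuousAt.mul (by fun_prop) h3
    have := h1.tendsto.mono_left (nhdsWithin_le_nhds (s := {b i}ᶜ))
    simpa [zero_pow hK] using this

variable [Fintype ι]

lemma isPolar_polarComb (hb : ∀ i j, cosGap (b i - b j) = 0 → i = j) (hN : ∀ i, N i ≠ 0)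
    (c : ((i : ι) × Fin (N i - 2)) → ℂ) : IsPolar b N (polarComb b N c) where
  per := fun z => by
    have hc (j : ℕ) (w z : ℂ) : ellip j (z + (2 * π : ℝ) - w) = ellip j (z - w) ∧
        ellip j (z + (2 * π : ℝ) * I - w) = ellip j (z - w) := by
      have := periodicC_ellip j (z - w)
      exact ⟨by rw [← this.1]; congr 1; ring, by rw [← this.2]; congr 1; ring⟩
    simp only [polarComb, (hc _ _ z).1, (hc _ _ z).2, and_self]
  diff := fun z hz => by
    unfold polarComb
    refine DifferentiableAt.fun_sum fun p _ => DifferentiableAt.const_mul ?_ _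
    exact DifferentiableAt.comp (f := fun z => z - b p.1) z
      (differentiableAt_ellip _ (hz p.1)) (by fun_prop)
  pole := fun i => by
    have := tendsto_finsetSum (Finset.univ : Finset ((i : ι) × Fin (N i - 2))) fun p _ =>
      (tendsto_pow_mul_ellip_sub (i := i) (k := p.1) (j := p.2) hb (hN i) fun hp => by
        have := p.2.2
        have h2 : N p.1 = N i := by rw [hp]
        omega).const_mul (c p)
    simp only [mul_zero, Finset.sum_const_zero] at this
    refine this.congr fun z => ?_
    rw [polarComb, Finset.mul_sum]
    exact Finset.sum_congr rfl fun p _ => by ring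

lemma eq_zero_of_polarComb_eq_zero (hb : ∀ i j, cosGap (b i - b j) = 0 → i = j)
    {c : ((i : ι) × Fin (N i - 2)) → ℂ}
    (hc : ∀ z, (∀ i, cosGap (z - b i) ≠ 0) → polarComb b N c z = 0) : c = 0 := by
  classical
  by_contra hne
  obtain ⟨⟨i, j₀⟩, hp⟩ := Function.ne_iff.1 hne
  obtain ⟨J, hJ, hJmax⟩ := Finset.exists_max_image
    (Finset.univ.filter fun j : Fin (N i - 2) => c ⟨i, j⟩ ≠ 0) (fun j => (j : ℕ))
    ⟨j₀, by simpa using hp⟩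
  simp only [Finset.mem_filter, Finset.mem_univ, true_and] at hJ hJmax
  obtain ⟨C, hC0, hC⟩ := tendsto_pow_mul_ellip J
  have hlim : Filter.Tendsto (fun z => (z - b i) ^ ((J : ℕ) + 2) * polarComb b N c z)
      (𝓝[≠] (b i)) (𝓝 (∑ p : (i : ι) × Fin (N i - 2), if p = ⟨i, J⟩ then c ⟨i, J⟩ * C else 0)) := by
    have := tendsto_finsetSum (f := fun (p : (i : ι) × Fin (N i - 2)) z =>
      c p * ((z - b i) ^ ((J : ℕ) + 2) * ellip p.2 (z - b p.1))) (x := 𝓝[≠] (b i))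
      (a := fun p => if p = ⟨i, J⟩ then c ⟨i, J⟩ * C else 0) Finset.univ fun p _ => by
        split_ifs with hpJ
        · subst hpJ
          exact (hC.comp (tendsto_sub_nhdsNE (b i))).const_mul _
        · by_cases hcp : c p = 0
          · simp [hcp]
          · rw [← mul_zero (c p)]
            refine (tendsto_pow_mul_ellip_sub hb (by omega) fun hk => ?_).const_mul _
            obtain ⟨k, j⟩ := p
            obtain rfl : k = i := hk
            have h1 := hJmax j hcp
            have h2 : (j : ℕ) ≠ J := fun h => hpJ (by rw [Fin.ext h])
            have h3 : (j : ℕ) < J := lt_of_le_of_ne h1 h2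
            show (j : ℕ) + 2 < J + 2
            omega
    refine this.congr fun z => ?_
    rw [polarComb, Finset.mul_sum]
    exact Finset.sum_congr rfl fun p _ => by ring
  have hz : ∀ᶠ z in 𝓝[≠] (b i), ∀ k, cosGap (z - b k) ≠ 0 := by
    refine Filter.eventually_all.2 fun k => ?_
    by_cases hk : k = i
    · subst hk
      have h1 : ∀ᶠ z in 𝓝[≠] (b k), ‖z - b k‖ < 1 := by
        have : Metric.ball (b k) 1 ∈ 𝓝[≠] (b k) :=
          nhdsWithin_le_nhds (Metric.ball_mem_nhds _ one_pos)
        filter_upwards [this] with z hz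
        simpa [dist_eq_norm] using hz
      filter_upwards [h1, self_mem_nhdsWithin] with z h1 h2 h0
      exact h2 (sub_eq_zero.1 (eq_zero_of_cosGap_eq_zero h0 h1))
    · refine nhdsWithin_le_nhds ?_
      exact (continuous_cosGap.comp (continuous_id.sub continuous_const)).continuousAt.eventually_ne
        fun h0 => hk (hb _ _ h0).symm
  have hlim0 : Filter.Tendsto (fun z => (z - b i) ^ ((J : ℕ) + 2) * polarComb b N c z)
      (𝓝[≠] (b i)) (𝓝 0) := by
    refine tendsto_const_nhds.congr' ?_
    filter_upwards [hz] with z hz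
    rw [hc z hz, mul_zero]
  have := tendsto_nhds_unique hlim hlim0
  simp [hJ, hC0] at this

end polarComb

lemma cosGap_zero : cosGap 0 = 0 := by norm_num [cosGap]

namespace Packing

variable {ι : Type} [Fintype ι] {φ f : ℂ → ℝ} {τ η : ℝ}

/-- The weighted modulus is controlled by the norm of the cut-off function. -/
lemma exists_polarMod_le (p : Packing φ f τ η ι) (hφ : ContDiff ℝ (⊤ : ℕ∞) φ) (hφp : PeriodicC φ)
    (hf : ContDiff ℝ (⊤ : ℕ∞) f) (hfp : PeriodicC f) (hτ : 0 < τ) (hη : 0 < η)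
    (hlap : ∀ z, f z < φ z - η → lapC f z < 0) :
    ∃ K > 0, ∀ h, 0 < h → ∀ N : ι → ℕ, (∀ i, N i ≠ 0) → (∀ i, N i * h ≤ p.m i) →
      ∀ u, IsPolar p.b N u → ∀ z, polarMod f h p.b p.a N u z ≤
        K * (Real.exp (4 * η / h) * wInt φ h fun z => (cutoff p.b p.a z : ℂ) * u z) := by
  obtain ⟨δ₁, hδ₁, h₁⟩ := Metric.uniformContinuous_iff.1 (hφp.uniformContinuous hφ.continuous) η hη
  obtain ⟨δ₂, hδ₂, h₂⟩ := Metric.uniformContinuous_iff.1 (hfp.uniformContinuous hf.continuous) η hη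
  set δ := min (min (δ₁ / 2) (δ₂ / 2)) π
  have hδ : 0 < δ := by positivity
  have hd₁ : δ < δ₁ := lt_of_le_of_lt ((min_le_left _ _).trans (min_le_left _ _)) (half_lt_self hδ₁)
  have hd₂ : δ < δ₂ := lt_of_le_of_lt ((min_le_left _ _).trans (min_le_right _ _)) (half_lt_self hδ₂)
  refine ⟨4 / (π * δ ^ 2), by positivity, fun h hh N hN hNm u hu z => ?_⟩
  have hw0 := wInt_nonneg φ h fun z => (cutoff p.b p.a z : ℂ) * u z
  obtain ⟨z₀, hmax, hz₀⟩ := p.exists_max hf hfp hlap hh hN hNm hu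
  refine (hmax z).trans ?_
  rcases hz₀ with hz₀ | hz₀
  · rw [hz₀]
    positivity
  have hφz {z : ℂ} (hz : z ∈ Metric.closedBall z₀ δ) : |φ z - φ z₀| < η :=
    h₁ ((Metric.mem_closedBall.1 hz).trans_lt hd₁)
  have hfz {z : ℂ} (hz : z ∈ Metric.closedBall z₀ δ) : |f z - f z₀| < η :=
    h₂ ((Metric.mem_closedBall.1 hz).trans_lt hd₂)
  have hfar {z : ℂ} (hz : z ∈ Metric.closedBall z₀ δ) (i : ι) : p.a i < cosGap (z - p.b i) := by
    by_contra! hle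
    have := p.low z i hle
    linarith [abs_lt.1 (hφz hz), abs_lt.1 (hfz hz)]
  have hself : z₀ ∈ Metric.closedBall z₀ δ := Metric.mem_closedBall_self hδ.le
  have hmean := normSq_mul_exp_le_wInt hφp hφ.continuous (hu.contDiff_cutoff_mul p.a_pos)
    (hu.periodicC_cutoff_mul (a := p.a)) (z₀ := z₀) hδ (min_le_right _ _) hh
    (fun z hz => hu.dbar_cutoff_mul_eq_zero p.a_pos (hfar hz))
    (fun z hz => show φ z ≤ φ z₀ + η by linarith [abs_lt.1 (hφz hz)])
  rw [cutoff_eq_one p.a_pos fun i => (hfar hself i).le, Complex.ofReal_one, one_mul] at hmean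
  have hexp : Real.exp (-2 * f z₀ / h) ≤ Real.exp (2 * η / h) * Real.exp (-2 * φ z₀ / h) := by
    rw [← Real.exp_add, ← add_div]
    refine Real.exp_le_exp.2 ?_
    gcongr
    linarith
  calc polarMod f h p.b p.a N u z₀ ≤ ‖u z₀‖ ^ 2 * Real.exp (-2 * f z₀ / h) * 1 := by
        unfold polarMod
        gcongr
        exact prod_trunc_le_one p.a_pos z₀
    _ ≤ ‖u z₀‖ ^ 2 * (Real.exp (2 * η / h) * Real.exp (-2 * φ z₀ / h)) := by
        rw [mul_one]
        gcongr
    _ = Real.exp (2 * η / h) * (‖u z₀‖ ^ 2 * Real.exp (-2 * φ z₀ / h)) := by ring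
    _ ≤ Real.exp (2 * η / h) * (4 / (π * δ ^ 2) * (Real.exp (2 * η / h) *
        wInt φ h fun z => (cutoff p.b p.a z : ℂ) * u z)) := by gcongr
    _ = _ := by
        rw [show 4 * η / h = 2 * η / h + 2 * η / h by ring, Real.exp_add]
        ring

lemma normSq_dbar_le (p : Packing φ f τ η ι) {C h P : ℝ} (hh : 0 < h) (hP : 0 ≤ P)
    (hC : ∀ z, ‖dbar (fun z => (cutoff p.b p.a z : ℂ)) z‖ ≤ C) {N : ι → ℕ}
    (hNm : ∀ i, N i * h ≤ p.m i) {u : ℂ → ℂ} (hu : IsPolar p.b N u)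
    (hmax : ∀ z, polarMod f h p.b p.a N u z ≤ P) (z : ℂ) :
    ‖dbar (fun z => (cutoff p.b p.a z : ℂ) * u z) z‖ ^ 2 * Real.exp (-2 * φ z / h) ≤
      C ^ 2 * P * Real.exp (-(2 * τ + 19 * η) / h) := by
  by_cases h1 : ∀ i, p.a i < cosGap (z - p.b i)
  · rw [hu.dbar_cutoff_mul_eq_zero p.a_pos h1, norm_zero]
    simp only [ne_eq, OfNat.ofNat_ne_zero, not_false_eq_true, zero_pow, zero_mul]
    positivity
  by_cases h2 : ∀ i, p.a i / 2 ≤ cosGap (z - p.b i)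
  swap
  · push Not at h2
    obtain ⟨i, hi⟩ := h2
    rw [IsPolar.dbar_cutoff_mul_eq_zero' p.a_pos hi, norm_zero]
    simp only [ne_eq, OfNat.ofNat_ne_zero, not_false_eq_true, zero_pow, zero_mul]
    positivity
  push Not at h1
  obtain ⟨i, hi⟩ := h1
  have hlow := p.low z i hi
  rw [hu.dbar_cutoff_mul p.a_pos h2, norm_mul]
  have hprod : Real.exp (-(η / h)) ≤ ∏ j, trunc (cosGap (z - p.b j) / p.a j) ^ N j := by
    rw [prod_trunc_eq p.a_pos (i := i) fun j hj => by
      by_contra! hlt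
      exact hj (p.disj z j i hlt.le hi)]
    have h3 : Real.exp (-1) ≤ trunc (cosGap (z - p.b i) / p.a i) := by
      refine exp_neg_one_le_trunc ?_
      rw [le_div_iff₀ (p.a_pos i)]
      linarith [h2 i]
    refine le_trans ?_ (pow_le_pow_left₀ (Real.exp_nonneg _) h3 _)
    rw [← Real.exp_nat_mul]
    refine Real.exp_le_exp.2 ?_
    have : (N i : ℝ) ≤ η / h := by
      rw [le_div_iff₀ hh]
      exact (hNm i).trans (p.m_le i)
    linarith
  have h4 : ‖u z‖ ^ 2 * Real.exp (-2 * f z / h) * Real.exp (-(η / h)) ≤ P := by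
    refine le_trans ?_ (hmax z)
    unfold polarMod
    gcongr
  have h5 : Real.exp (-2 * φ z / h) ≤ Real.exp (-2 * f z / h) * Real.exp (-(η / h)) *
      Real.exp (-(2 * τ + 19 * η) / h) := by
    rw [← Real.exp_add, ← Real.exp_add, ← neg_div, ← add_div, ← add_div]
    refine Real.exp_le_exp.2 ?_
    gcongr
    linarith
  calc (‖dbar (fun z => (cutoff p.b p.a z : ℂ)) z‖ * ‖u z‖) ^ 2 * Real.exp (-2 * φ z / h)
      ≤ (C * ‖u z‖) ^ 2 * (Real.exp (-2 * f z / h) * Real.exp (-(η / h)) *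
      Real.exp (-(2 * τ + 19 * η) / h)) := by
        gcongr
        exact hC z
    _ = C ^ 2 * (‖u z‖ ^ 2 * Real.exp (-2 * f z / h) * Real.exp (-(η / h))) *
      Real.exp (-(2 * τ + 19 * η) / h) := by ring
    _ ≤ _ := by gcongr

/-- The quasimodes: cut-off elliptic functions. -/
def quasimode (p : Packing φ f τ η ι) (N : ι → ℕ) :
    (((i : ι) × Fin (N i - 2)) → ℂ) →ₗ[ℂ] (ℂ → ℂ) where
  toFun c := fun z => (cutoff p.b p.a z : ℂ) * polarComb p.b N c z
  map_add' c d := by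
    funext z
    simp only [polarComb, Pi.add_apply, add_mul, Finset.sum_add_distrib, mul_add]
  map_smul' r c := by
    funext z
    simp only [polarComb, Pi.smul_apply, smul_eq_mul, RingHom.id_apply, Finset.mul_sum]
    exact Finset.sum_congr rfl fun _ _ => by ring

/-- A packing yields a large space of quasimodes. -/
lemma eventually_exists_submodule (p : Packing φ f τ η ι) (hφ : ContDiff ℝ (⊤ : ℕ∞) φ)
    (hφp : PeriodicC φ) (hf : ContDiff ℝ (⊤ : ℕ∞) f) (hfp : PeriodicC f) (hτ : 0 < τ) (hη : 0 < η)
    (hlap : ∀ z, f z < φ z - η → lapC f z < 0) :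
    ∀ᶠ h : ℝ in 𝓝[>] 0, ∃ V : Submodule ℂ (ℂ → ℂ),
      (∀ u ∈ V, ContDiff ℝ (⊤ : ℕ∞) u ∧ PeriodicC u) ∧
      (∀ u ∈ V, wInt φ h (fun z => (h : ℂ) * dbar u z) ≤ Real.exp (-τ / h) ^ 2 * wInt φ h u) ∧
      Module.finrank ℂ V = ∑ i, (⌊p.m i / h⌋₊ - 2) := by
  obtain ⟨K, hK, hmod⟩ := p.exists_polarMod_le hφ hφp hf hfp hτ hη hlap
  have hχ : ContDiff ℝ (⊤ : ℕ∞) fun z => (cutoff p.b p.a z : ℂ) :=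
    Complex.ofRealCLM.contDiff.comp contDiff_cutoff
  obtain ⟨C, hC0, hC⟩ := (periodicC_cutoff.comp Complex.ofReal).dbar.exists_bound hχ.dbar.continuous
  have hb : ∀ i j, cosGap (p.b i - p.b j) = 0 → i = j := fun i j h0 =>
    p.disj (p.b i) i j (by simpa [cosGap_zero] using (p.a_pos i).le) (h0.trans_le (p.a_pos j).le)
  have e1 : ∀ᶠ h : ℝ in 𝓝[>] 0, ∀ i, h ≤ p.m i := Filter.eventually_all.2 fun i =>
    nhdsWithin_le_nhds (ge_mem_nhds (p.m_pos i))
  have e2 : ∀ᶠ h : ℝ in 𝓝[>] 0, h ^ 2 * (C ^ 2 * K * volume.real Efd) ≤ 1 := by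
    have : Filter.Tendsto (fun h : ℝ => h ^ 2 * (C ^ 2 * K * volume.real Efd)) (𝓝 0)
        (𝓝 (0 ^ 2 * (C ^ 2 * K * volume.real Efd))) := Continuous.tendsto (by fun_prop) 0
    rw [zero_pow two_ne_zero, zero_mul] at this
    exact nhdsWithin_le_nhds (this.eventually (ge_mem_nhds one_pos))
  filter_upwards [e1, e2, self_mem_nhdsWithin] with h e1 e2 hh
  replace hh : 0 < h := hh
  set N : ι → ℕ := fun i => ⌊p.m i / h⌋₊ with hNdef
  have hN (i : ι) : N i ≠ 0 :=
    (Nat.floor_pos.2 ((one_le_div hh).2 (e1 i))).ne'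
  have hNm (i : ι) : N i * h ≤ p.m i := by
    rw [← le_div_iff₀ hh]
    exact Nat.floor_le (div_nonneg (p.m_pos i).le hh.le)
  have hpol (c) : IsPolar p.b N (polarComb p.b N c) := isPolar_polarComb hb hN c
  have hsm (c) : ContDiff ℝ (⊤ : ℕ∞) (p.quasimode N c) := (hpol c).contDiff_cutoff_mul p.a_pos
  have hpe (c) : PeriodicC (p.quasimode N c) := (hpol c).periodicC_cutoff_mul
  refine ⟨LinearMap.range (p.quasimode N), ?_, ?_, ?_⟩
  · rintro _ ⟨c, rfl⟩
    exact ⟨hsm c, hpe c⟩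
  · rintro _ ⟨c, rfl⟩
    set w := p.quasimode N c with hw
    set P := K * (Real.exp (4 * η / h) * wInt φ h w) with hP
    have hw0 := wInt_nonneg φ h w
    have hP0 : 0 ≤ P := by positivity
    have hpt (z : ℂ) : ‖dbar w z‖ ^ 2 * Real.exp (-2 * φ z / h) ≤
        C ^ 2 * P * Real.exp (-(2 * τ + 19 * η) / h) :=
      p.normSq_dbar_le hh hP0 hC hNm (hpol c) (hmod h hh N hN hNm _ (hpol c)) z
    have hint : wInt φ h (dbar w) ≤
        volume.real Efd * (C ^ 2 * P * Real.exp (-(2 * τ + 19 * η) / h)) := by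
      have := setIntegral_mono
        (continuous_wInt_integrand hφ.continuous (hsm c).dbar.continuous h).integrableOn_Efd
        (continuous_const (y := C ^ 2 * P * Real.exp (-(2 * τ + 19 * η) / h))).integrableOn_Efd
        hpt
      rwa [setIntegral_const, smul_eq_mul] at this
    rw [wInt_const_mul, Complex.norm_real, Real.norm_of_nonneg hh.le]
    have hee : Real.exp (4 * η / h) * Real.exp (-(2 * τ + 19 * η) / h) ≤ Real.exp (-τ / h) ^ 2 := by
      rw [← Real.exp_nat_mul, ← Real.exp_add, ← add_div, ← mul_div_assoc]
      refine Real.exp_le_exp.2 ?_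
      push_cast
      gcongr
      linarith
    calc h ^ 2 * wInt φ h (dbar w)
        ≤ h ^ 2 * (volume.real Efd * (C ^ 2 * P * Real.exp (-(2 * τ + 19 * η) / h))) := by gcongr
      _ = h ^ 2 * (C ^ 2 * K * volume.real Efd) * ((Real.exp (4 * η / h) *
          Real.exp (-(2 * τ + 19 * η) / h)) * wInt φ h w) := by rw [hP]; ring
      _ ≤ 1 * (Real.exp (-τ / h) ^ 2 * wInt φ h w) := by gcongr
      _ = _ := one_mul _
  · have hinj : Function.Injective (p.quasimode N) := by
      rw [injective_iff_map_eq_zero]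
      intro c hc
      refine eq_zero_of_polarComb_eq_zero hb fun z hz => ?_
      have h1 := hmod h hh N hN hNm _ (hpol c) z
      have h2 : (fun z => (cutoff p.b p.a z : ℂ) * polarComb p.b N c z) = fun _ => 0 := hc
      rw [h2] at h1
      have h3 : wInt φ h (fun _ => 0) = 0 := by simp [wInt]
      rw [h3, mul_zero, mul_zero] at h1
      by_contra hne
      refine absurd h1 (not_le.2 ?_)
      unfold polarMod
      have h4 : 0 < ‖polarComb p.b N c z‖ := norm_pos_iff.2 hne
      refine mul_pos (by positivity) (Finset.prod_pos fun i _ => pow_pos ?_ _)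
      have h5 : 0 < cosGap (z - p.b i) := lt_of_le_of_ne (cosGap_nonneg _) (hz i).symm
      have h6 := le_trunc (cosGap (z - p.b i) / p.a i)
      have h7 := p.a_pos i
      exact lt_of_lt_of_le (by positivity) h6
    rw [LinearMap.finrank_range_of_inj hinj, Module.finrank_fintype_fun_eq_card,
      Fintype.card_sigma]
    simp [hNdef]

end Packing

/-- The interior of the fundamental domain. -/
def EfdInt : Set ℂ := {z : ℂ | z.re ∈ Set.Ioo 0 (2 * π) ∧ z.im ∈ Set.Ioo 0 (2 * π)}

lemma isOpen_EfdInt : IsOpen EfdInt :=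
  (isOpen_Ioo.preimage Complex.continuous_re).inter (isOpen_Ioo.preimage Complex.continuous_im)

lemma EfdInt_subset : EfdInt ⊆ Efd := fun _ hz =>
  ⟨Set.Ioo_subset_Ico_self hz.1, Set.Ioo_subset_Ico_self hz.2⟩

lemma EfdInt_ae_eq : EfdInt =ᵐ[volume] Efd := by
  have h : (Set.Ioo 0 (2 * π) ×ˢ Set.Ioo 0 (2 * π) : Set (ℝ × ℝ)) =ᵐ[volume]
      (Set.Ico 0 (2 * π) ×ˢ Set.Ico 0 (2 * π) : Set (ℝ × ℝ)) :=
    Measure.set_prod_ae_eq Ioo_ae_eq_Ico Ioo_ae_eq_Ico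
  exact Complex.volume_preserving_equiv_real_prod.quasiMeasurePreserving.preimage_ae_eq h

lemma EfdInt_lattice_unique {z : ℂ} {m n m' n' : ℤ}
    (h : z + (m : ℂ) * (2 * π : ℝ) + n * ((2 * π : ℝ) * I) ∈ EfdInt)
    (h' : z + (m' : ℂ) * (2 * π : ℝ) + n' * ((2 * π : ℝ) * I) ∈ EfdInt) : m = m' ∧ n = n' := by
  have key {x : ℝ} {k l : ℤ} (hk : x + k * (2 * π) ∈ Set.Ioo 0 (2 * π))
      (hl : x + l * (2 * π) ∈ Set.Ioo 0 (2 * π)) : k = l := by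
    have h1 : ((k - l : ℤ) : ℝ) < 1 := by
      push_cast
      nlinarith [hk.2, hl.1, Real.pi_pos]
    have h2 : (-1 : ℝ) < ((k - l : ℤ) : ℝ) := by
      push_cast
      nlinarith [hk.1, hl.2, Real.pi_pos]
    have h3 : k - l < 1 := by exact_mod_cast h1
    have h4 : -1 < k - l := by exact_mod_cast h2
    omega
  exact ⟨key (x := z.re) (by simpa using h.1) (by simpa using h'.1),
    key (x := z.im) (by simpa using h.2) (by simpa using h'.2)⟩

/-- Radii of discs on which `g` is nearly constant. -/
structure IsGoodRadius (g : ℂ → ℝ) (U : Set ℂ) (θ η : ℝ) (z : ℂ) (r : ℝ) : Prop where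
  pos : 0 < r
  subset : Metric.closedBall z r ⊆ U
  le_theta : 4 * r ^ 2 ≤ θ
  le_eta : g z * r ^ 2 ≤ η
  lt : ∀ t ∈ Metric.closedBall z r, (1 - θ) * g z < g t
  le : ∀ t ∈ Metric.closedBall z r, (1 - θ) * g t ≤ g z

lemma eventually_isGoodRadius {g : ℂ → ℝ} (hg : Continuous g) {U : Set ℂ} (hU : IsOpen U)
    {θ η : ℝ} (hθ : 0 < θ) (hη : 0 < η) {z : ℂ} (hz : z ∈ U) (hgz : 0 < g z) :
    ∀ᶠ r in 𝓝[>] (0 : ℝ), IsGoodRadius g U θ η z r := by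
  have h1 : ∀ᶠ t in 𝓝 z, t ∈ U ∧ (1 - θ) * g z < g t ∧ (1 - θ) * g t < g z := by
    refine (hU.eventually_mem hz).and ((hg.continuousAt.eventually (lt_mem_nhds (by nlinarith))).and ?_)
    have h2 : Continuous fun t => (1 - θ) * g t := by fun_prop
    exact h2.continuousAt.eventually (gt_mem_nhds (by nlinarith))
  obtain ⟨r₀, hr₀, hball⟩ := Metric.nhds_basis_closedBall.eventually_iff.1 h1
  have h2 : ∀ᶠ r in 𝓝[>] (0 : ℝ), 4 * r ^ 2 < θ := by
    have : Filter.Tendsto (fun r : ℝ => 4 * r ^ 2) (𝓝 0) (𝓝 (4 * 0 ^ 2)) :=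
      Continuous.tendsto (by fun_prop) 0
    exact nhdsWithin_le_nhds (this.eventually (gt_mem_nhds (by simpa using hθ)))
  have h3 : ∀ᶠ r in 𝓝[>] (0 : ℝ), g z * r ^ 2 < η := by
    have : Filter.Tendsto (fun r : ℝ => g z * r ^ 2) (𝓝 0) (𝓝 (g z * 0 ^ 2)) :=
      Continuous.tendsto (by fun_prop) 0
    exact nhdsWithin_le_nhds (this.eventually (gt_mem_nhds (by simpa using hη)))
  filter_upwards [h2, h3, self_mem_nhdsWithin, nhdsWithin_le_nhds (gt_mem_nhds hr₀)]
    with r h2 h3 h4 h5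
  have h6 {t : ℂ} (ht : t ∈ Metric.closedBall z r) := hball (Metric.closedBall_subset_closedBall h5.le ht)
  exact ⟨h4, fun t ht => (h6 ht).1, h2.le, h3.le, fun t ht => (h6 ht).2.1,
    fun t ht => (h6 ht).2.2.le⟩

lemma IsGoodRadius.setIntegral_le {g : ℂ → ℝ} (hg : Continuous g) {U : Set ℂ} {θ η r : ℝ} {z : ℂ}
    (hr : IsGoodRadius g U θ η z r) :
    (1 - θ) * ∫ t in Metric.closedBall z r, g t ≤ g z * (π * r ^ 2) := by
  rw [← integral_const_mul]
  have := setIntegral_mono_on (μ := volume)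
    ((continuous_const.mul hg).continuousOn.integrableOn_compact (isCompact_closedBall z r))
    ((continuous_const (y := g z)).continuousOn.integrableOn_compact (isCompact_closedBall z r))
    Metric.isClosed_closedBall.measurableSet hr.le
  rwa [setIntegral_const, volume_real_closedBall z hr.pos.le, smul_eq_mul, mul_comm (π * r ^ 2)]
    at this

/-- The mass placed in a disc. -/
def discMass (β θ r : ℝ) : ℝ := 2 * (1 - θ) * β / (1 / 2 + 2 / ((1 - θ) * r ^ 2 / 2))

section discMass

variable {β θ r : ℝ}

lemma discMass_mul (hθ : θ < 1) (hr : 0 < r) :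
    discMass β θ r * (1 / 2 + 2 / ((1 - θ) * r ^ 2 / 2)) = 2 * (1 - θ) * β := by
  have : 0 < 1 - θ := by linarith
  exact div_mul_cancel₀ _ (by positivity)

lemma discMass_pos (hβ : 0 < β) (hθ : θ < 1) (hr : 0 < r) : 0 < discMass β θ r := by
  have : 0 < 1 - θ := by linarith
  unfold discMass
  positivity

lemma discMass_le (hβ : 0 < β) (hθ0 : 0 < θ) (hθ : θ < 1) (hr : 0 < r) :
    discMass β θ r ≤ β * r ^ 2 := by
  have h1 : 0 < 1 - θ := by linarith
  unfold discMass
  rw [div_le_iff₀ (by positivity)]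
  have : β * r ^ 2 * (1 / 2 + 2 / ((1 - θ) * r ^ 2 / 2)) = β * r ^ 2 / 2 + 4 * β / (1 - θ) := by
    field_simp
    ring
  rw [this]
  have h2 : β ≤ β / (1 - θ) := by
    rw [le_div_iff₀ h1]
    nlinarith
  have h3 : 4 * β / (1 - θ) = 4 * (β / (1 - θ)) := by ring
  have h4 : 0 < β * r ^ 2 := by positivity
  nlinarith

lemma le_discMass (hβ : 0 < β) (hθ0 : 0 < θ) (hθ : θ < 1) (hr : 0 < r) (hrθ : 4 * r ^ 2 ≤ θ) :
    (1 - θ) ^ 3 * (β * (π * r ^ 2)) ≤ 2 * π * discMass β θ r := by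
  have h1 : 0 < 1 - θ := by linarith
  unfold discMass
  rw [← mul_div_assoc, le_div_iff₀ (by positivity)]
  have : (1 - θ) ^ 3 * (β * (π * r ^ 2)) * (1 / 2 + 2 / ((1 - θ) * r ^ 2 / 2)) =
      (π * β * (1 - θ)) * ((1 - θ) ^ 2 * r ^ 2 / 2 + 4 * (1 - θ)) := by
    field_simp
    ring
  rw [this]
  have h2 : (1 - θ) ^ 2 * r ^ 2 / 2 + 4 * (1 - θ) ≤ 4 := by
    have : (1 - θ) ^ 2 ≤ 1 := pow_le_one₀ h1.le (by linarith)
    nlinarith [sq_nonneg r]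
  calc (π * β * (1 - θ)) * ((1 - θ) ^ 2 * r ^ 2 / 2 + 4 * (1 - θ)) ≤ (π * β * (1 - θ)) * 4 := by
        gcongr
    _ = _ := by ring

end discMass

/-- A region on which `f` is superharmonic can be packed efficiently. -/
lemma exists_packing {φ f : ℂ → ℝ} {τ η : ℝ} (hφ : ContDiff ℝ (⊤ : ℕ∞) φ) (hφp : PeriodicC φ)
    (hf : ContDiff ℝ (⊤ : ℕ∞) f) (hfp : PeriodicC f) (hη : 0 < η)
    (hlap : ∀ z, f z < φ z - τ - 10 * η → lapC f z < 0) {ε : ℝ} (hε : 0 < ε) :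
    ∃ (ι : Type) (_ : Fintype ι) (p : Packing φ f τ η ι),
      (∫ z in {z | f z < φ z - τ - 10 * η} ∩ Efd, -lapC f z) - ε ≤ 2 * π * ∑ i, p.m i := by
  set g : ℂ → ℝ := fun z => -lapC f z with hgdef
  have hg : Continuous g := hf.lapC.continuous.neg
  set U : Set ℂ := {z | f z < φ z - τ - 10 * η} ∩ EfdInt with hUdef
  have hUo : IsOpen U := (isOpen_lt hf.continuous
    ((hφ.continuous.sub continuous_const).sub continuous_const)).inter isOpen_EfdInt
  have hUE : U ⊆ Efd := Set.inter_subset_right.trans EfdInt_subset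
  have hUg {z : ℂ} (hz : z ∈ U) : 0 < g z := neg_pos.2 (hlap z hz.1)
  have hUint : ∫ z in {z | f z < φ z - τ - 10 * η} ∩ Efd, g z = ∫ z in U, g z :=
    setIntegral_congr_set ((ae_eq_refl _).inter EfdInt_ae_eq.symm)
  rw [hUint]
  set J := ∫ z in U, g z with hJ
  have hJ0 : 0 ≤ J := setIntegral_nonneg hUo.measurableSet fun z hz => (hUg hz).le
  obtain ⟨θ, hθ0, hθ1, hθJ⟩ : ∃ θ : ℝ, 0 < θ ∧ θ < 1 ∧ 4 * θ * J ≤ ε / 2 := by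
    refine ⟨min (1 / 2) (ε / (8 * (J + 1))), by positivity,
      (min_le_left _ _).trans_lt (by norm_num), ?_⟩
    calc 4 * min (1 / 2) (ε / (8 * (J + 1))) * J ≤ 4 * (ε / (8 * (J + 1))) * (J + 1) := by
          gcongr
          · exact min_le_right _ _
          · linarith
      _ = ε / 2 := by field_simp; norm_num
  obtain ⟨t, r, htc, htU, htr, htcov, htd⟩ := Besicovitch.exists_disjoint_closedBall_covering_ae
    volume (fun z => {r | IsGoodRadius g U θ η z r}) U (fun z hz δ hδ => by
      obtain ⟨r, h1, h2⟩ := ((eventually_isGoodRadius hg hUo hθ0 hη hz (hUg hz)).and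
        (Ioo_mem_nhdsGT hδ)).exists
      exact ⟨r, h1, h2⟩) (fun _ => 1) (fun _ _ => one_pos)
  have hgood (i : t) : IsGoodRadius g U θ η i (r i) := (htr i i.2).1
  have : Countable t := htc
  have hsub : (⋃ i : t, Metric.closedBall (i : ℂ) (r i)) ⊆ U := Set.iUnion_subset fun i => (hgood i).subset
  have hsum : HasSum (fun i : t => ∫ z in Metric.closedBall (i : ℂ) (r i), g z) J := by
    have h1 := hasSum_integral_iUnion (μ := volume) (f := g)
      (s := fun i : t => Metric.closedBall (i : ℂ) (r i))
      (fun i => Metric.isClosed_closedBall.measurableSet)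
      (fun i j hij => htd i.2 j.2 fun h => hij (Subtype.ext h))
      (hg.integrableOn_Efd.mono_set (hsub.trans hUE))
    have h2 : U ≤ᵐ[volume] ⋃ i : t, Metric.closedBall (i : ℂ) (r i) := by
      rw [Set.biUnion_eq_iUnion] at htcov
      exact ae_le_set.2 htcov
    rwa [← setIntegral_congr_set (h2.antisymm (LE.le.eventuallyLE hsub))] at h1
  obtain ⟨s, hs⟩ := (hsum.eventually (lt_mem_nhds (show J - ε / 2 < J by linarith))).exists
  have hlat {z : ℂ} {i : t} (hz : cosGap (z - i) ≤ (1 - θ) * r i ^ 2 / 2) : ∃ m n : ℤ,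
      z + (m : ℂ) * (2 * π : ℝ) + n * ((2 * π : ℝ) * I) ∈ Metric.closedBall (i : ℂ) (r i) := by
    obtain ⟨m, n, h⟩ := exists_norm_le_of_cosGap_le (hgood i).pos.le (hgood i).le_theta hθ1 hz
    refine ⟨m, n, ?_⟩
    rw [mem_closedBall_iff_norm]
    rwa [show z + (m : ℂ) * (2 * π : ℝ) + n * ((2 * π : ℝ) * I) - (i : ℂ) =
      z - i + (m : ℂ) * (2 * π : ℝ) + n * ((2 * π : ℝ) * I) by ring]
  have h1θ : 0 < 1 - θ := by linarith
  refine ⟨s, inferInstance,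
    { b := fun i => (i : t)
      a := fun i => (1 - θ) * r (i : t) ^ 2 / 2
      m := fun i => discMass (g (i : t)) θ (r (i : t))
      a_pos := fun i => by
        have := (hgood i).pos
        positivity
      m_pos := fun i => discMass_pos (hUg (htU i.1.2)) hθ1 (hgood i).pos
      m_le := fun i =>
        (discMass_le (hUg (htU i.1.2)) hθ0 hθ1 (hgood i).pos).trans (hgood i).le_eta
      disj := fun z i j hi hj => by
        obtain ⟨m, n, h1⟩ := hlat hi
        obtain ⟨m', n', h2⟩ := hlat hj
        obtain ⟨rfl, rfl⟩ := EfdInt_lattice_unique ((hgood i).subset h1).2 ((hgood j).subset h2).2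
        by_contra hij
        have hne : ((i : t) : ℂ) ≠ (j : t) := fun h => hij (Subtype.ext (Subtype.ext h))
        exact Set.disjoint_left.1 (htd i.1.2 j.1.2 hne) h1 h2
      low := fun z i hi => by
        obtain ⟨m, n, h1⟩ := hlat hi
        have := ((hgood i).subset h1).1
        rwa [Set.mem_ofPred_eq, hfp.add_lattice, hφp.add_lattice] at this
      lap := fun z i hi => by
        obtain ⟨m, n, h1⟩ := hlat hi
        have := (hgood i).lt _ h1
        simp only [hgdef, hfp.lapC.add_lattice] at this
        rw [discMass_mul hθ1 (hgood i).pos]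
        simp only [hgdef]
        linarith }, ?_⟩
  have hmass (i : t) : (1 - 4 * θ) * ∫ z in Metric.closedBall (i : ℂ) (r i), g z ≤
      2 * π * discMass (g i) θ (r i) := by
    have hI0 : 0 ≤ ∫ z in Metric.closedBall (i : ℂ) (r i), g z :=
      setIntegral_nonneg Metric.isClosed_closedBall.measurableSet
        fun z hz => (hUg ((hgood i).subset hz)).le
    have h1 := (hgood i).setIntegral_le hg
    have h2 := le_discMass (hUg (htU i.2)) hθ0 hθ1 (hgood i).pos (hgood i).le_theta
    have h3 : 1 - 4 * θ ≤ (1 - θ) ^ 4 := by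
      have := one_add_mul_le_pow (a := -θ) (by linarith) 4
      push_cast at this
      rw [← sub_eq_add_neg] at this
      linarith
    calc (1 - 4 * θ) * ∫ z in Metric.closedBall (i : ℂ) (r i), g z
        ≤ (1 - θ) ^ 4 * ∫ z in Metric.closedBall (i : ℂ) (r i), g z := by gcongr
      _ = (1 - θ) ^ 3 * ((1 - θ) * ∫ z in Metric.closedBall (i : ℂ) (r i), g z) := by ring
      _ ≤ (1 - θ) ^ 3 * (g i * (π * r i ^ 2)) := by gcongr
      _ ≤ _ := h2
  have hle : ∑ i ∈ s, ∫ z in Metric.closedBall (i : ℂ) (r i), g z ≤ J :=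
    sum_le_hasSum s (fun i _ => setIntegral_nonneg Metric.isClosed_closedBall.measurableSet
      fun z hz => (hUg ((hgood i).subset hz)).le) hsum
  calc J - ε ≤ (∑ i ∈ s, ∫ z in Metric.closedBall (i : ℂ) (r i), g z) * (1 - 4 * θ) := by
        nlinarith
    _ = ∑ i ∈ s, (1 - 4 * θ) * ∫ z in Metric.closedBall (i : ℂ) (r i), g z := by
        rw [← Finset.mul_sum, mul_comm]
    _ ≤ ∑ i ∈ s, 2 * π * discMass (g i) θ (r i) := Finset.sum_le_sum fun i _ => hmass i
    _ = _ := by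
        rw [Finset.mul_sum]
        exact (Finset.sum_coe_sort s fun i => 2 * π * discMass (g i) θ (r i)).symm

/-- Lower bound for the counting function in terms of a trial weight `f`. -/
lemma IsObst.eventually_le_countN {φ ψ f : ℂ → ℝ} {τ η : ℝ} (O : IsObst φ ψ τ)
    (hf : ContDiff ℝ (⊤ : ℕ∞) f) (hfp : PeriodicC f) (hη : 0 < η)
    (hlap : ∀ z, f z < φ z - η → lapC f z < 0) {ε : ℝ} (hε : 0 < ε) :
    ∀ᶠ h : ℝ in 𝓝[>] 0,
      (∫ z in {z | f z < φ z - τ - 10 * η} ∩ Efd, -lapC f z) - ε ≤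
        2 * π * h * (countN φ (Real.exp (-τ / h)) h : ℝ) := by
  obtain ⟨ι, _, p, hp⟩ := exists_packing (τ := τ) O.smooth O.per hf hfp hη
    (fun z hz => hlap z (by linarith [O.pos])) (half_pos hε)
  obtain ⟨h₀, hh₀, hle⟩ := O.exists_countN_le one_pos
  have e1 : ∀ᶠ h : ℝ in 𝓝[>] 0, 6 * π * h * Fintype.card ι < ε / 2 := by
    have : Filter.Tendsto (fun h : ℝ => 6 * π * h * Fintype.card ι) (𝓝 0)
        (𝓝 (6 * π * 0 * Fintype.card ι)) := Continuous.tendsto (by fun_prop) 0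
    exact nhdsWithin_le_nhds (this.eventually (gt_mem_nhds (by simpa using hε)))
  filter_upwards [p.eventually_exists_submodule O.smooth O.per hf hfp O.pos hη hlap, e1,
    self_mem_nhdsWithin, nhdsWithin_le_nhds (gt_mem_nhds hh₀)] with h ⟨V, hV1, hV2, hV3⟩ e1 hh hlt
  replace hh : 0 < h := hh
  have h1 := (hle h hh hlt.le).2 V hV1 hV2
  rw [hV3] at h1
  have h2 : ∑ i, (p.m i - 3 * h) ≤ h * ((∑ i, (⌊p.m i / h⌋₊ - 2) : ℕ) : ℝ) := by
    push_cast
    rw [Finset.mul_sum]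
    refine Finset.sum_le_sum fun i _ => ?_
    have h3 : p.m i / h - 3 ≤ ((⌊p.m i / h⌋₊ - 2 : ℕ) : ℝ) := by
      have h4 := (Nat.lt_floor_add_one (p.m i / h)).le
      have h5 : ((⌊p.m i / h⌋₊ : ℕ) : ℝ) ≤ ((⌊p.m i / h⌋₊ - 2 : ℕ) : ℝ) + 2 := by
        exact_mod_cast (by omega : ⌊p.m i / h⌋₊ ≤ ⌊p.m i / h⌋₊ - 2 + 2)
      linarith
    calc p.m i - 3 * h = h * (p.m i / h - 3) := by field_simp
      _ ≤ _ := by gcongr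
  have h6 : h * ((∑ i, (⌊p.m i / h⌋₊ - 2) : ℕ) : ℝ) ≤
      h * (countN φ (Real.exp (-τ / h)) h : ℝ) := by
    gcongr
  rw [Finset.sum_sub_distrib, Finset.sum_const, Finset.card_univ, nsmul_eq_mul] at h2
  have h7 : 2 * π * ((∑ i, p.m i) - Fintype.card ι * (3 * h)) ≤
      2 * π * (h * (countN φ (Real.exp (-τ / h)) h : ℝ)) := by
    have := h2.trans h6
    gcongr
  linarith

/-- The Laplacian of a product of functions of `re z` and of `im z`. -/
lemma lapC_re_mul_im {A A' A'' B B' B'' : ℝ → ℝ} (hA : ∀ x, HasDerivAt A (A' x) x)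
    (hA' : ∀ x, HasDerivAt A' (A'' x) x) (hB : ∀ x, HasDerivAt B (B' x) x)
    (hB' : ∀ x, HasDerivAt B' (B'' x) x) (z : ℂ) :
    lapC (fun z => A z.re * B z.im) z = A'' z.re * B z.im + A z.re * B'' z.im := by
  have key {C C' D D' : ℝ → ℝ} (hC : ∀ x, HasDerivAt C (C' x) x) (hD : ∀ x, HasDerivAt D (D' x) x)
      (z : ℂ) : fderiv ℝ (fun z => C z.re * D z.im) z 1 = C' z.re * D z.im ∧
        fderiv ℝ (fun z => C z.re * D z.im) z I = C z.re * D' z.im := by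
    have h1 : HasFDerivAt (fun z : ℂ => C z.re) (C' z.re • Complex.reCLM) z :=
      (hC z.re).comp_hasFDerivAt (f := fun z : ℂ => z.re) z Complex.reCLM.hasFDerivAt
    have h2 : HasFDerivAt (fun z : ℂ => D z.im) (D' z.im • Complex.imCLM) z :=
      (hD z.im).comp_hasFDerivAt (f := fun z : ℂ => z.im) z Complex.imCLM.hasFDerivAt
    rw [(h1.fun_mul h2).fderiv]
    simp [mul_comm]
  unfold lapC
  have e1 : (fun w => fderiv ℝ (fun z : ℂ => A z.re * B z.im) w 1) =
      fun w => A' w.re * B w.im := funext fun w => (key hA hB w).1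
  have e2 : (fun w => fderiv ℝ (fun z : ℂ => A z.re * B z.im) w I) =
      fun w => A w.re * B' w.im := funext fun w => (key hA hB w).2
  rw [e1, e2, (key hA' hB z).1, (key hA hB' z).2]

/-- The logarithmic second derivative of `(2 + cos x) ^ (n + 2)`, up to the factor `n + 2`, as a
function of `cos x`. -/
def cosRatio (n : ℕ) (c : ℝ) : ℝ := (n + 1) * (1 - c ^ 2) / (2 + c) ^ 2 - c / (2 + c)

lemma hasDerivAt_two_add_cos_pow (n : ℕ) (x : ℝ) :
    HasDerivAt (fun x => (2 + Real.cos x) ^ (n + 2))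
      (-(n + 2) * Real.sin x * (2 + Real.cos x) ^ (n + 1)) x := by
  have h := ((Real.hasDerivAt_cos x).const_add 2).fun_pow (n + 2)
  refine h.congr_deriv ?_
  push_cast
  simp
  ring

lemma hasDerivAt_deriv_two_add_cos_pow (n : ℕ) (x : ℝ) :
    HasDerivAt (fun x => -(n + 2) * Real.sin x * (2 + Real.cos x) ^ (n + 1))
      ((n + 2) * (2 + Real.cos x) ^ (n + 2) * cosRatio n (Real.cos x)) x := by
  have h := ((Real.hasDerivAt_sin x).const_mul (-((n : ℝ) + 2))).fun_mul
    (((Real.hasDerivAt_cos x).const_add 2).fun_pow (n + 1))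
  refine h.congr_deriv ?_
  have hpos : 2 + Real.cos x ≠ 0 := by linarith [Real.neg_one_le_cos x]
  have hs := Real.sin_sq x
  unfold cosRatio
  rw [← hs]
  push_cast
  field_simp
  ring

lemma neg_third_le_cosRatio (n : ℕ) {c : ℝ} (h1 : -1 ≤ c) (h2 : c ≤ 1) : -(1 / 3) ≤ cosRatio n c := by
  have h3 : 0 ≤ (n + 1) * (1 - c ^ 2) / (2 + c) ^ 2 := by
    have : 0 ≤ 1 - c ^ 2 := by nlinarith
    positivity
  have h4 : c / (2 + c) ≤ 1 / 3 := by
    rw [div_le_iff₀ (by linarith)]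
    linarith
  unfold cosRatio
  linarith

lemma third_lt_cosRatio {n : ℕ} {c δ : ℝ} (hδ : 0 < δ) (hn : 12 / δ < n) (h1 : -1 ≤ c)
    (h2 : c ≤ 1 - δ) : 1 / 3 < cosRatio n c := by
  have hp : 0 < 2 + c := by linarith
  have hn' : 12 < n * δ := (div_lt_iff₀ hδ).1 hn
  have hn0 : (0 : ℝ) ≤ n := n.cast_nonneg
  have key : 2 * (2 + c) * (1 + 2 * c) / 3 < (n + 1) * (1 - c ^ 2) := by
    rcases le_or_gt c (-(1 / 2)) with hc | hc
    · rcases h1.eq_or_lt with h | h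
      · rw [← h]
        norm_num
      · have h3 : 0 < (n + 1) * (1 - c ^ 2) := by
          have : 0 < 1 - c ^ 2 := by nlinarith
          positivity
        have h4 : 2 * (2 + c) * (1 + 2 * c) / 3 ≤ 0 := by nlinarith
        linarith
    · have h3 : δ / 2 ≤ 1 - c ^ 2 := by nlinarith
      have h4 : 2 * (2 + c) * (1 + 2 * c) / 3 ≤ 6 := by nlinarith
      nlinarith
  unfold cosRatio
  rw [lt_sub_iff_add_lt, lt_div_iff₀ (by positivity)]
  have : (1 / 3 + c / (2 + c)) * (2 + c) ^ 2 = 2 * (2 + c) * (1 + 2 * c) / 3 := by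
    field_simp
    ring
  rw [this]
  exact key

/-- A small smooth periodic function which is superharmonic away from the lattice. -/
lemma exists_superharmonic_off_lattice {δ σ : ℝ} (hδ : 0 < δ) (hσ : 0 < σ) :
    ∃ g : ℂ → ℝ, ContDiff ℝ (⊤ : ℕ∞) g ∧ PeriodicC g ∧ (∀ z, |g z| ≤ σ) ∧
      (∀ z, |lapC g z| ≤ σ) ∧ ∀ z, 2 * δ ≤ cosGap z → lapC g z < 0 := by
  obtain ⟨n, hn⟩ := exists_nat_gt (12 / δ)
  set P : ℝ → ℝ := fun x => (2 + Real.cos x) ^ (n + 2) with hP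
  have hPpos (x : ℝ) : 0 < P x := pow_pos (by linarith [Real.neg_one_le_cos x]) _
  have hPs : ContDiff ℝ (⊤ : ℕ∞) P := (contDiff_const.add Real.contDiff_cos).pow _
  set G : ℂ → ℝ := fun z => P z.re * P z.im with hG
  have hGs : ContDiff ℝ (⊤ : ℕ∞) G :=
    (hPs.comp Complex.reCLM.contDiff).mul (hPs.comp Complex.imCLM.contDiff)
  have hGp : PeriodicC G := fun z => by simp [hG, hP]
  have hGl (z : ℂ) : 2 * δ ≤ cosGap z → 0 < lapC G z := fun hz => by
    rw [hG, lapC_re_mul_im (hasDerivAt_two_add_cos_pow n) (hasDerivAt_deriv_two_add_cos_pow n)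
      (hasDerivAt_two_add_cos_pow n) (hasDerivAt_deriv_two_add_cos_pow n)]
    have h3 : 0 < cosRatio n (Real.cos z.re) + cosRatio n (Real.cos z.im) := by
      have a1 := neg_third_le_cosRatio n (Real.neg_one_le_cos z.re) (Real.cos_le_one z.re)
      have a2 := neg_third_le_cosRatio n (Real.neg_one_le_cos z.im) (Real.cos_le_one z.im)
      by_cases hc : Real.cos z.re ≤ 1 - δ
      · linarith [third_lt_cosRatio hδ hn (Real.neg_one_le_cos z.re) hc]
      · have : Real.cos z.im ≤ 1 - δ := by
          unfold cosGap at hz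
          linarith
        linarith [third_lt_cosRatio hδ hn (Real.neg_one_le_cos z.im) this]
    have h1 := hPpos z.re
    have h2 := hPpos z.im
    have : 0 < (n + 2) * (P z.re * P z.im) *
        (cosRatio n (Real.cos z.re) + cosRatio n (Real.cos z.im)) := by positivity
    refine this.trans_eq ?_
    simp only [hP]
    ring
  obtain ⟨C₁, hC₁, hb₁⟩ := hGp.exists_bound hGs.continuous
  obtain ⟨C₂, hC₂, hb₂⟩ := hGp.lapC.exists_bound hGs.lapC.continuous
  set s := min (σ / C₁) (σ / C₂)
  have hs : 0 < s := by positivity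
  have hl (z : ℂ) : lapC (fun z => -s * G z) z = -s * lapC G z :=
    lapC_const_mul _ (hGs.contDiffAt_two : ContDiffAt ℝ 2 G z)
  refine ⟨fun z => -s * G z, contDiff_const.mul hGs, hGp.comp fun x => -s * x, fun z => ?_,
    fun z => ?_, fun z hz => ?_⟩
  · rw [abs_mul, abs_neg, abs_of_pos hs]
    calc s * |G z| ≤ σ / C₁ * C₁ := by
          gcongr
          · exact min_le_left _ _
          · exact hb₁ z
      _ = σ := by field_simp
  · rw [hl, abs_mul, abs_neg, abs_of_pos hs]
    calc s * |lapC G z| ≤ σ / C₂ * C₂ := by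
          gcongr
          · exact min_le_right _ _
          · exact hb₂ z
      _ = σ := by field_simp
  · rw [hl]
    have := mul_pos hs (hGl z hz)
    linarith

namespace IsObst

variable {φ ψ : ℂ → ℝ} {τ : ℝ}

/-- The solution mollified at scale `R` near the lower and at scale `κ` near the upper contact
set. -/
def glue (φ ψ : ℂ → ℝ) (τ R κ : ℝ) (z : ℂ) : ℝ :=
  if τ / 2 < φ z - ψ z then moll R ψ z else moll κ ψ z

lemma moll_eq_of_gap (O : IsObst φ ψ τ) {r : ℝ} (hr : 0 < r)
    (hgap : ∀ z t, t ∈ Metric.closedBall z r → |(φ t - ψ t) - (φ z - ψ z)| < τ / 12) {z : ℂ}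
    (h1 : 5 * τ / 12 < φ z - ψ z) (h2 : φ z - ψ z < 7 * τ / 12) : moll r ψ z = ψ z := by
  have := O.pos
  refine O.moll_eq hr fun t ht => ?_
  have := abs_lt.1 (hgap z t ht)
  exact ⟨by linarith, by linarith⟩

lemma glue_eventuallyEq_left (O : IsObst φ ψ τ) {R κ : ℝ} (hR : 0 < R) (hκ : 0 < κ)
    (gR : ∀ z t, t ∈ Metric.closedBall z R → |(φ t - ψ t) - (φ z - ψ z)| < τ / 12)
    (gκ : ∀ z t, t ∈ Metric.closedBall z κ → |(φ t - ψ t) - (φ z - ψ z)| < τ / 12) {z : ℂ}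
    (hz : 5 * τ / 12 < φ z - ψ z) : glue φ ψ τ R κ =ᶠ[𝓝 z] moll R ψ := by
  have := O.pos
  filter_upwards [O.continuous_gap.continuousAt.eventually (lt_mem_nhds hz)] with w hw
  unfold glue
  split_ifs with h
  · rfl
  · push Not at h
    rw [O.moll_eq_of_gap hR gR hw (by linarith), O.moll_eq_of_gap hκ gκ hw (by linarith)]

lemma glue_eventuallyEq_right (O : IsObst φ ψ τ) {R κ : ℝ} (hR : 0 < R) (hκ : 0 < κ)
    (gR : ∀ z t, t ∈ Metric.closedBall z R → |(φ t - ψ t) - (φ z - ψ z)| < τ / 12)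
    (gκ : ∀ z t, t ∈ Metric.closedBall z κ → |(φ t - ψ t) - (φ z - ψ z)| < τ / 12) {z : ℂ}
    (hz : φ z - ψ z < 7 * τ / 12) : glue φ ψ τ R κ =ᶠ[𝓝 z] moll κ ψ := by
  have := O.pos
  filter_upwards [O.continuous_gap.continuousAt.eventually (gt_mem_nhds hz)] with w hw
  unfold glue
  split_ifs with h
  · rw [O.moll_eq_of_gap hR gR (by linarith) hw, O.moll_eq_of_gap hκ gκ (by linarith) hw]
  · rfl

lemma contDiff_glue (O : IsObst φ ψ τ) {R κ : ℝ} (hR : 0 < R) (hκ : 0 < κ)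
    (gR : ∀ z t, t ∈ Metric.closedBall z R → |(φ t - ψ t) - (φ z - ψ z)| < τ / 12)
    (gκ : ∀ z t, t ∈ Metric.closedBall z κ → |(φ t - ψ t) - (φ z - ψ z)| < τ / 12) :
    ContDiff ℝ (⊤ : ℕ∞) (glue φ ψ τ R κ) := by
  have := O.pos
  refine contDiff_iff_contDiffAt.2 fun z => ?_
  rcases lt_or_ge (5 * τ / 12) (φ z - ψ z) with h | h
  · exact (contDiff_moll O.cont hR).contDiffAt.congr_of_eventuallyEq
      (O.glue_eventuallyEq_left hR hκ gR gκ h)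
  · exact (contDiff_moll O.cont hκ).contDiffAt.congr_of_eventuallyEq
      (O.glue_eventuallyEq_right hR hκ gR gκ (by linarith))

lemma periodicC_glue (O : IsObst φ ψ τ) (R κ : ℝ) : PeriodicC (glue φ ψ τ R κ) := fun z => by
  have h1 : φ (z + (2 * π : ℝ)) - ψ (z + (2 * π : ℝ)) = φ z - ψ z ∧
      φ (z + (2 * π : ℝ) * I) - ψ (z + (2 * π : ℝ) * I) = φ z - ψ z := O.periodic_gap z
  have h2 := O.per'.moll R z
  have h3 := O.per'.moll κ z
  simp only [glue, h2.1, h2.2, h3.1, h3.2]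
  exact ⟨by rw [h1.1], by rw [h1.2]⟩

lemma lapC_glue (O : IsObst φ ψ τ) {R κ : ℝ} (hR : 0 < R) (hκ : 0 < κ)
    (gR : ∀ z t, t ∈ Metric.closedBall z R → |(φ t - ψ t) - (φ z - ψ z)| < τ / 12)
    (gκ : ∀ z t, t ∈ Metric.closedBall z κ → |(φ t - ψ t) - (φ z - ψ z)| < τ / 12) (z : ℂ) :
    lapC (glue φ ψ τ R κ) z =
      if τ / 2 < φ z - ψ z then lapC (moll R ψ) z else lapC (moll κ ψ) z := by
  have := O.pos
  split_ifs with h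
  · exact lapC_congr (O.glue_eventuallyEq_left hR hκ gR gκ (by linarith))
  · exact lapC_congr (O.glue_eventuallyEq_right hR hκ gR gκ (by linarith))

/-- Smallness of the Laplacian mass of the mollified solution where it comes close to the lower
obstacle, after slightly enlarging the region. -/
lemma exists_lower_mass_le (O : IsObst φ ψ τ) {R ε : ℝ} (hR : 0 < R)
    (hint : ∫ z in Efd, {z | τ / 2 < φ z - ψ z ∧ φ z - τ ≤ moll R ψ z}.indicator
      (fun z => -lapC (moll R ψ) z) z < ε) {η₀ : ℝ} (hη₀ : 0 < η₀) :
    ∃ η, 0 < η ∧ η < η₀ ∧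
      ∫ z in Efd, {z | τ / 2 < φ z - ψ z ∧ φ z - τ - 11 * η ≤ moll R ψ z}.indicator
        (fun z => -lapC (moll R ψ) z) z < ε := by
  have hm := contDiff_moll O.cont hR
  obtain ⟨C, hC, hb⟩ := (O.per'.moll R).lapC.exists_bound hm.lapC.continuous
  have key := tendsto_setIntegral_Efd_of_bounded
    (F := fun η => {z | τ / 2 < φ z - ψ z ∧ φ z - τ - 11 * η ≤ moll R ψ z}.indicator
        (fun z => -lapC (moll R ψ) z))
    (G := {z | τ / 2 < φ z - ψ z ∧ φ z - τ ≤ moll R ψ z}.indicator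
      (fun z => -lapC (moll R ψ) z)) (C := C) one_pos ?_ ?_ ?_
  · obtain ⟨η, h1, h2⟩ := ((key.eventually (gt_mem_nhds hint)).and (Ioo_mem_nhdsGT hη₀)).exists
    exact ⟨η, h2.1, h2.2, h1⟩
  · intro η _
    refine hm.lapC.continuous.neg.measurable.indicator ?_
    exact (measurableSet_lt measurable_const O.continuous_gap.measurable).inter
      (measurableSet_le ((O.smooth.continuous.sub continuous_const).sub continuous_const).measurable
        hm.continuous.measurable)
  · intro η _ _ z
    rw [← Real.norm_eq_abs]
    refine (norm_indicator_le_norm_self _ _).trans ?_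
    rw [norm_neg]
    exact hb z
  · refine Filter.Eventually.of_forall fun z => ?_
    refine tendsto_const_nhds.congr' ?_
    by_cases hz : φ z - τ ≤ moll R ψ z
    · filter_upwards [self_mem_nhdsWithin] with η hη
      have hη' : 0 < η := hη
      have : φ z - τ - 11 * η ≤ moll R ψ z := by linarith
      simp only [Set.indicator, Set.mem_ofPred_eq, hz, this]
    · push Not at hz
      filter_upwards [Ioo_mem_nhdsGT (show 0 < (φ z - τ - moll R ψ z) / 11 by linarith)] with η hη
      have : ¬ φ z - τ - 11 * η ≤ moll R ψ z := by
        have := hη.2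
        rw [lt_div_iff₀ (by norm_num)] at this
        push Not
        linarith
      simp only [Set.indicator, Set.mem_ofPred_eq, not_le.2 hz, this]

/-- Near a contact point, the region where `cosGap` is small has small gap. -/
lemma exists_cosGap_gap_lt (O : IsObst φ ψ τ) {z₁ : ℂ} (hz₁ : ψ z₁ = φ z₁) {ρ : ℝ} (hρ : 0 < ρ) :
    ∃ δ > 0, ∀ z, cosGap (z - z₁) < 2 * δ → φ z - ψ z < ρ := by
  obtain ⟨r, hr, hg⟩ := O.exists_gap_uniform hρ
  set s := min r (1 / 4) with hs
  have hs0 : 0 < s := lt_min hr (by norm_num)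
  have hs1 : s ≤ 1 / 4 := min_le_right _ _
  refine ⟨s ^ 2 / 8, by positivity, fun z hz => ?_⟩
  obtain ⟨m, n, h⟩ := exists_norm_le_of_cosGap_le (ε := 1 / 2) (r := s) hs0.le (by nlinarith)
    (by norm_num) (z := z - z₁) (by linarith)
  have h1 := O.periodic_gap.add_lattice m n z
  have h2 := hg z₁ (z + (m : ℂ) * (2 * π : ℝ) + n * ((2 * π : ℝ) * I)) (by
    rw [Metric.mem_closedBall, dist_eq_norm]
    refine le_trans (le_of_eq (congrArg norm ?_)) (h.trans (min_le_left _ _))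
    ring)
  have h3 := (abs_lt.1 h2).2
  linarith

end IsObst

namespace IsObst

variable {φ ψ : ℂ → ℝ} {τ : ℝ}

/-- A trial weight whose Laplacian mass below `φ - τ` nearly exhausts the mass of the upper contact
set. -/
lemma exists_trial_weight (O : IsObst φ ψ τ) {z₁ : ℂ} (hz₁ : ψ z₁ = φ z₁) {ε : ℝ} (hε : 0 < ε) :
    ∃ f : ℂ → ℝ, ∃ η > 0, ContDiff ℝ (⊤ : ℕ∞) f ∧ PeriodicC f ∧
      (∀ z, f z < φ z - η → lapC f z < 0) ∧
      (∫ z in {z | ψ z = φ z} ∩ Efd, lapC φ z) - 3 * ε ≤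
        ∫ z in {z | f z < φ z - τ - 10 * η} ∩ Efd, -lapC f z := by
  have hτ := O.pos
  obtain ⟨ru, hru, gu⟩ := O.exists_gap_uniform (show 0 < τ / 12 by positivity)
  obtain ⟨R, hRint, hR⟩ := ((O.tendsto_integral_lower.eventually (gt_mem_nhds hε)).and
    (Ioo_mem_nhdsGT hru)).exists
  have hR0 := hR.1
  have gR : ∀ z t, t ∈ Metric.closedBall z R → |(φ t - ψ t) - (φ z - ψ z)| < τ / 12 :=
    fun z t ht => gu z t (Metric.closedBall_subset_closedBall hR.2.le ht)
  obtain ⟨η, hη, hητ, hT⟩ := O.exists_lower_mass_le hR0 hRint hτ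
  obtain ⟨δ, hδ, hgδ⟩ := O.exists_cosGap_gap_lt hz₁ (show 0 < η / 4 by positivity)
  set A := volume.real Efd with hA
  have hA0 : 0 ≤ A := measureReal_nonneg
  obtain ⟨σ, hσ, hση, hσA⟩ : ∃ σ > 0, σ ≤ η / 4 ∧ σ * A ≤ ε := by
    refine ⟨min (η / 4) (ε / (A + 1)), by positivity, min_le_left _ _, ?_⟩
    calc min (η / 4) (ε / (A + 1)) * A ≤ ε / (A + 1) * A := by gcongr; exact min_le_right _ _
      _ ≤ ε / (A + 1) * (A + 1) := by gcongr; linarith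
      _ = ε := by field_simp
  obtain ⟨g₀, hg₀s, hg₀p, hg₀b, hg₀l, hg₀n⟩ := exists_superharmonic_off_lattice hδ hσ
  obtain ⟨rη, hrη, gη⟩ := O.exists_gap_uniform (show 0 < η / 4 by positivity)
  obtain ⟨rm, hrm, hm⟩ := O.per'.exists_moll_close O.cont (show 0 < η / 4 by positivity)
  obtain ⟨κ, ⟨⟨hκint, hκu⟩, hκη⟩, hκm⟩ := (((O.tendsto_integral_upper.eventually
    (lt_mem_nhds (show (∫ z in {z | ψ z = φ z} ∩ Efd, lapC φ z) - ε < _ by linarith))).and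
    (Ioo_mem_nhdsGT hru)).and (Ioo_mem_nhdsGT hrη)).and (Ioo_mem_nhdsGT hrm) |>.exists
  have hκ0 := hκu.1
  have gκ : ∀ z t, t ∈ Metric.closedBall z κ → |(φ t - ψ t) - (φ z - ψ z)| < τ / 12 :=
    fun z t ht => gu z t (Metric.closedBall_subset_closedBall hκu.2.le ht)
  set F := glue φ ψ τ R κ with hF
  have hFs : ContDiff ℝ (⊤ : ℕ∞) F := O.contDiff_glue hR0 hκ0 gR gκ
  have hFp : PeriodicC F := O.periodicC_glue R κ
  have hFl := O.lapC_glue hR0 hκ0 gR gκ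
  rw [← hF] at hFl
  set g : ℂ → ℝ := fun z => g₀ (z + -z₁) with hg
  have hgs : ContDiff ℝ (⊤ : ℕ∞) g := hg₀s.comp (contDiff_id.add contDiff_const)
  have hgp : PeriodicC g := hg₀p.shift (-z₁)
  have hgl (z : ℂ) : lapC g z = lapC g₀ (z + -z₁) := lapC_comp_add g₀ (-z₁) z
  have hgb (z : ℂ) : |g z| ≤ η / 4 := (hg₀b _).trans hση
  have hgn (z : ℂ) (hz : η / 4 ≤ φ z - ψ z) : lapC g z < 0 := by
    rw [hgl]
    refine hg₀n _ ?_
    by_contra! h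
    rw [← sub_eq_add_neg] at h
    linarith [hgδ z h]
  have hfl (z : ℂ) : lapC (fun z => F z + g z) z = lapC F z + lapC g z :=
    lapC_add (hFs.contDiffAt_two) (hgs.contDiffAt_two)
  have hlow (z : ℂ) (hz : τ / 2 < φ z - ψ z) : lapC (moll R ψ) z ≤ 0 := by
    refine O.lapC_moll_nonpos hR0 fun t ht => ?_
    linarith [(abs_lt.1 (gR z t ht)).1]
  have hfs : ContDiff ℝ (⊤ : ℕ∞) fun z => F z + g z := hFs.add hgs
  refine ⟨fun z => F z + g z, η, hη, hfs, hFp.comp₂ hgp (fun a b => a + b),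
    fun z hz => ?_, ?_⟩
  · rw [hfl, hFl]
    have hb := abs_le.1 (hgb z)
    split_ifs with h
    · linarith [hlow z h, hgn z (by linarith)]
    · have hFz : F z = moll κ ψ z := by rw [hF, glue, if_neg h]
      have hmz := abs_le.1 (hm κ hκ0 hκm.2.le z)
      have hgap : η / 2 < φ z - ψ z := by linarith
      have : lapC (moll κ ψ) z ≤ 0 := by
        refine O.lapC_moll_nonpos hκ0 fun t ht => ?_
        linarith [(abs_lt.1 (gη z t (Metric.closedBall_subset_closedBall hκη.2.le ht))).1]
      linarith [hgn z (by linarith)]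
  · have hUm : MeasurableSet {z | F z + g z < φ z - τ - 10 * η} :=
      measurableSet_lt hfs.continuous.measurable
        ((O.smooth.continuous.sub continuous_const).sub continuous_const).measurable
    have hLm : MeasurableSet {z | φ z - ψ z ≤ τ / 2} :=
      measurableSet_le O.continuous_gap.measurable measurable_const
    have hTm : MeasurableSet {z | τ / 2 < φ z - ψ z ∧ φ z - τ - 11 * η ≤ moll R ψ z} :=
      (measurableSet_lt measurable_const O.continuous_gap.measurable).inter
      (measurableSet_le ((O.smooth.continuous.sub continuous_const).sub continuous_const).measurable
        (contDiff_moll O.cont hR0).continuous.measurable)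
    rw [Set.inter_comm {z | F z + g z < φ z - τ - 10 * η}, ← setIntegral_indicator hUm]
    have i0 : IntegrableOn (lapC F) Efd := hFs.lapC.continuous.integrableOn_Efd
    have i1 : IntegrableOn ({z | φ z - ψ z ≤ τ / 2}.indicator (lapC (moll κ ψ))) Efd :=
      (contDiff_moll O.cont hκ0).lapC.continuous.integrableOn_Efd.indicator hLm
    have i2 : IntegrableOn ({z | τ / 2 < φ z - ψ z ∧ φ z - τ - 11 * η ≤ moll R ψ z}.indicator
        (fun z => -lapC (moll R ψ) z)) Efd :=
      (contDiff_moll O.cont hR0).lapC.continuous.neg.integrableOn_Efd.indicator hTm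
    have i3 : IntegrableOn (fun _ : ℂ => σ) Efd := integrableOn_const volume_Efd_lt_top.ne
    have i4 : IntegrableOn ({z | F z + g z < φ z - τ - 10 * η}.indicator
        (fun z => -lapC (fun z => F z + g z) z)) Efd :=
      hfs.lapC.continuous.neg.integrableOn_Efd.indicator hUm
    have hmono : ∫ z in Efd, ({z | φ z - ψ z ≤ τ / 2}.indicator (lapC (moll κ ψ)) z - lapC F z -
        {z | τ / 2 < φ z - ψ z ∧ φ z - τ - 11 * η ≤ moll R ψ z}.indicator
          (fun z => -lapC (moll R ψ) z) z - σ) ≤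
        ∫ z in Efd, {z | F z + g z < φ z - τ - 10 * η}.indicator
          (fun z => -lapC (fun z => F z + g z) z) z := by
      refine setIntegral_mono (((i1.sub i0).sub i2).sub i3) i4 fun z => ?_
      have hb := abs_le.1 (hgb z)
      have hl : |lapC g z| ≤ σ := by rw [hgl]; exact hg₀l _
      have hl := abs_le.1 hl
      simp only [Set.indicator, Set.mem_ofPred_eq]
      rw [hfl, hFl]
      by_cases h : τ / 2 < φ z - ψ z
      · have hFz : F z = moll R ψ z := by rw [hF, glue, if_pos h]
        have hlz := hlow z h
        simp only [h, not_le.2 h, if_true, if_false, true_and]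
        rw [hFz]
        split_ifs with h1 h2 <;> linarith
      · have hFz : F z = moll κ ψ z := by rw [hF, glue, if_neg h]
        have hmz := abs_le.1 (hm κ hκ0 hκm.2.le z)
        have hU : ¬ F z + g z < φ z - τ - 10 * η := by
          push Not at h ⊢
          linarith
        simp only [h, not_lt.1 h, hU, if_true, if_false, false_and]
        linarith
    refine le_trans ?_ hmono
    rw [integral_sub ((i1.fun_sub i0).fun_sub i2) i3, integral_sub (i1.fun_sub i0) i2,
      integral_sub i1 i0,
      hFp.setIntegral_lapC hFs, setIntegral_const, smul_eq_mul, ← hA]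
    linarith

/-- Lower half of the Weyl law. -/
lemma eventually_contact_le_countN (O : IsObst φ ψ τ) {ε : ℝ} (hε : 0 < ε) :
    ∀ᶠ h : ℝ in 𝓝[>] 0, (∫ z in {z | ψ z = φ z} ∩ Efd, lapC φ z) - ε ≤
      2 * π * h * (countN φ (Real.exp (-τ / h)) h : ℝ) := by
  rcases Set.eq_empty_or_nonempty {z | ψ z = φ z} with h | ⟨z₁, hz₁⟩
  · rw [h, Set.empty_inter, setIntegral_empty]
    filter_upwards [self_mem_nhdsWithin] with t ht
    have ht' : 0 < t := ht
    have : 0 ≤ 2 * π * t * (countN φ (Real.exp (-τ / t)) t : ℝ) := by positivity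
    linarith
  · obtain ⟨f, η, hη, hf, hfp, hlap, hint⟩ := O.exists_trial_weight hz₁
      (show 0 < ε / 4 by positivity)
    filter_upwards [O.eventually_le_countN hf hfp hη hlap (show 0 < ε / 4 by positivity)] with t ht
    linarith

end IsObst

/-- **Theorem (Weyl law for the exponentially small singular values of `h ∂̄`).** -/
theorem weyl_law_optimal_weight
    (φ : ℂ → ℝ) (τ : ℝ)
    (hφ : ContDiff ℝ (⊤ : ℕ∞) φ) (hφp : PeriodicC φ) (hφnc : ∃ z w : ℂ, φ z ≠ φ w)
    (hτ0 : 0 < τ) (hτ : τ < sSup (φ '' Efd) - sInf (φ '' Efd))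
    (hnd : ∀ z : ℂ, lapC φ z = 0 → fderiv ℝ (lapC φ) z ≠ 0)
    -- ψ is the optimal weight:
    (ψ : ℂ → ℝ) (hψc : Continuous ψ) (hψp : PeriodicC ψ)
    (hbd : ∀ z, φ z - τ ≤ ψ z ∧ ψ z ≤ φ z)
    (hsub : DSubhOn ψ {z | φ z - τ < ψ z})
    (hsup : DSuphOn ψ {z | ψ z < φ z}) :
    ∀ ε > 0, ∃ h₀ > 0, ∀ h : ℝ, 0 < h → h ≤ h₀ →
      |2 * Real.pi * h * (countN φ (Real.exp (-τ / h)) h : ℝ) -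
        ∫ z in {z | ψ z = φ z} ∩ Efd, lapC φ z| ≤ ε := by

  intro ε hε
  have O : IsObst φ ψ τ := ⟨hφ, hφp, hτ0, hψc, hψp, fun z => (hbd z).1, fun z => (hbd z).2,
    hsub, hsup⟩
  obtain ⟨h₁, hh₁, hup⟩ := O.exists_countN_le hε
  obtain ⟨h₂, hh₂, hlo⟩ := mem_nhdsGT_iff_exists_Ioc_subset.1 (O.eventually_contact_le_countN hε)
  refine ⟨min h₁ h₂, lt_min hh₁ hh₂, fun h h0 hle => ?_⟩
  have h1 := (hup h h0 (hle.trans (min_le_left _ _))).1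
  have h2 : (∫ z in {z | ψ z = φ z} ∩ Efd, lapC φ z) - ε ≤
      2 * π * h * (countN φ (Real.exp (-τ / h)) h : ℝ) := hlo ⟨h0, hle.trans (min_le_right _ _)⟩
  exact abs_le.2 ⟨by linarith, by linarith⟩
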